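/- The circle S¹ is the only sphere Sⁿ (n ≥ 1) that admits a continuous exactly 2-to-1 map onto a sphere. -/

import Mathlib

set_option linter.unusedSectionVars false
set_option linter.unusedVariables false

namespace CompactCohomology

open Set Metric

section Algebra

variable {X Y W : Type*}

/-- The Alexander–Spanier coboundary, modulo two, on cochains evaluated on lists of points. -/
def d : (List X → ZMod 2) → List X → ZMod 2
  | _, [] => 0
  | φ, a :: l => φ l + d (fun m => φ (a :: m)) l

lemma d_nil (φ : List X → ZMod 2) : d φ [] = 0 := rfl

lemma d_cons (φ : List X → ZMod 2) (a : X) (l : List X) :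
    d φ (a :: l) = φ l + d (fun m => φ (a :: m)) l := rfl

lemma add_self_zmod (a : ZMod 2) : a + a = 0 := CharTwo.add_self_eq_zero a

lemma d_add (φ ψ : List X → ZMod 2) (l : List X) : d (φ + ψ) l = d φ l + d ψ l := by
  induction l generalizing φ ψ with
  | nil => simp [d_nil]
  | cons a l ih =>
    have h : (fun m => (φ + ψ) (a :: m)) = (fun m => φ (a :: m)) + fun m => ψ (a :: m) := rfl
    rw [d_cons, h, ih, d_cons, d_cons, Pi.add_apply]
    ring

lemma d_congr {φ ψ : List X → ZMod 2} {l : List X}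
    (h : ∀ m : List X, m.length + 1 = l.length → (∀ x ∈ m, x ∈ l) → φ m = ψ m) :
    d φ l = d ψ l := by
  induction l generalizing φ ψ with
  | nil => rfl
  | cons a l ih =>
    rw [d_cons, d_cons, h l (by simp) (by simp +contextual)]
    congr 1
    refine ih fun m hm hml => h _ (by simpa using hm) ?_
    intro x hx
    rcases List.mem_cons.1 hx with rfl | hx
    · simp
    · exact List.mem_cons_of_mem _ (hml x hx)

lemma d_zero (l : List X) : d (fun _ => 0) l = 0 := by
  induction l with
  | nil => rfl
  | cons a l ih => rw [d_cons, ih, add_zero]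

lemma d_eq_zero {φ : List X → ZMod 2} {l : List X}
    (h : ∀ m : List X, m.length + 1 = l.length → (∀ x ∈ m, x ∈ l) → φ m = 0) : d φ l = 0 := by
  rw [d_congr (ψ := fun _ => 0) h, d_zero]

lemma d_d (φ : List X → ZMod 2) (l : List X) : d (d φ) l = 0 := by
  induction l generalizing φ with
  | nil => rfl
  | cons a l ih =>
    have h : (fun m => d φ (a :: m)) = φ + d (fun m => φ (a :: m)) := rfl
    rw [d_cons, h, d_add, ih, add_zero, add_self_zmod]

lemma d_map (f : X → Y) (φ : List Y → ZMod 2) (l : List X) :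
    d (fun m => φ (m.map f)) l = d φ (l.map f) := by
  induction l generalizing φ with
  | nil => rfl
  | cons a l ih => simp only [d_cons, List.map_cons, ← ih]

/-- The prism operator: the chain homotopy between pulling back along `f` and along `g`. -/
def prism (f g : X → Y) : (List Y → ZMod 2) → List X → ZMod 2
  | _, [] => 0
  | φ, a :: l => φ (f a :: g a :: l.map g) + prism f g (fun m => φ (f a :: m)) l

lemma prism_nil (f g : X → Y) (φ : List Y → ZMod 2) : prism f g φ [] = 0 := rfl

lemma prism_cons (f g : X → Y) (φ : List Y → ZMod 2) (a : X) (l : List X) :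
    prism f g φ (a :: l) =
      φ (f a :: g a :: l.map g) + prism f g (fun m => φ (f a :: m)) l := rfl

lemma prism_add (f g : X → Y) (φ ψ : List Y → ZMod 2) (l : List X) :
    prism f g (φ + ψ) l = prism f g φ l + prism f g ψ l := by
  induction l generalizing φ ψ with
  | nil => simp [prism_nil]
  | cons a l ih =>
    have h : (fun m => (φ + ψ) (f a :: m)) = (fun m => φ (f a :: m)) + fun m => ψ (f a :: m) := rfl
    rw [prism_cons, h, ih, prism_cons, prism_cons, Pi.add_apply]
    ring

lemma prism_congr {f g : X → Y} {φ ψ : List Y → ZMod 2} {l : List X}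
    (h : ∀ m : List Y, m.length = l.length + 1 → (∀ y ∈ m, ∃ x ∈ l, y = f x ∨ y = g x) →
      φ m = ψ m) : prism f g φ l = prism f g ψ l := by
  induction l generalizing φ ψ with
  | nil => rfl
  | cons a l ih =>
    rw [prism_cons, prism_cons, h (f a :: g a :: l.map g) (by simp) ?_]
    · congr 1
      refine ih fun m hm hml => h _ (by simpa using hm) ?_
      intro y hy
      rcases List.mem_cons.1 hy with rfl | hy
      · exact ⟨a, by simp, Or.inl rfl⟩
      · obtain ⟨x, hx, hxy⟩ := hml y hy
        exact ⟨x, List.mem_cons_of_mem _ hx, hxy⟩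
    · intro y hy
      simp only [List.mem_cons, List.mem_map] at hy
      rcases hy with rfl | rfl | ⟨x, hx, rfl⟩
      · exact ⟨a, by simp, Or.inl rfl⟩
      · exact ⟨a, by simp, Or.inr rfl⟩
      · exact ⟨x, List.mem_cons_of_mem _ hx, Or.inr rfl⟩

lemma prism_zero (f g : X → Y) (l : List X) : prism f g (fun _ => 0) l = 0 := by
  induction l with
  | nil => rfl
  | cons a l ih => rw [prism_cons, ih, add_zero]

lemma prism_eq_zero {f g : X → Y} {φ : List Y → ZMod 2} {l : List X}
    (h : ∀ m : List Y, m.length = l.length + 1 → (∀ y ∈ m, ∃ x ∈ l, y = f x ∨ y = g x) →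
      φ m = 0) : prism f g φ l = 0 := by
  rw [prism_congr (ψ := fun _ => 0) h, prism_zero]

lemma d_prism (f g : X → Y) (φ : List Y → ZMod 2) (l : List X) :
    d (prism f g φ) l + prism f g (d φ) l = φ (l.map f) + φ (l.map g) := by
  induction l generalizing φ with
  | nil => simp [d_nil, prism_nil, add_self_zmod]
  | cons a l ih =>
    have h1 : (fun m => prism f g φ (a :: m)) =
        (fun m => φ (f a :: g a :: m.map g)) + prism f g (fun m => φ (f a :: m)) := rfl
    have h2 : (fun m => d φ (f a :: m)) = φ + d (fun m => φ (f a :: m)) := rfl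
    rw [d_cons, h1, d_add, prism_cons, h2, prism_add, d_cons, d_cons,
      d_map g (fun m => φ (f a :: g a :: m)) l]
    have h3 := ih (fun m => φ (f a :: m))
    simp only [List.map_cons]
    generalize prism f g φ l = p at *
    generalize d (fun m => φ (f a :: g a :: m)) (l.map g) = q at *
    generalize d (prism f g fun m => φ (f a :: m)) l = r at *
    generalize prism f g (d fun m => φ (f a :: m)) l = s at *
    calc p + (q + r) + (φ (g a :: l.map g) + (φ (f a :: l.map g) + q) + (p + s))
        = (p + p) + (q + q) + (r + s) + φ (g a :: l.map g) + φ (f a :: l.map g) := by ring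
      _ = φ (f a :: l.map f) + φ (g a :: l.map g) +
            (φ (f a :: l.map g) + φ (f a :: l.map g)) := by
          rw [h3, add_self_zmod, add_self_zmod]; ring
      _ = _ := by rw [add_self_zmod, add_zero]

end Algebra

section Cochains

variable {X Y W : Type*} [MetricSpace X] [MetricSpace Y] [MetricSpace W]

/-- All entries of the list lie in `Z`. -/
def Inn {X : Type*} (Z : Set X) (l : List X) : Prop := ∀ x ∈ l, x ∈ Z

/-- All mutual distances of entries are less than `ε`. -/
def Small (ε : ℝ) (l : List X) : Prop := ∀ x ∈ l, ∀ y ∈ l, dist x y < ε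

/-- On lists in `Z`, the cochain `φ` vanishes unless the list meets `K`. -/
def Supp (Z K : Set X) (φ : List X → ZMod 2) : Prop :=
  ∀ l, Inn Z l → (∀ x ∈ l, x ∉ K) → φ l = 0

/-- Cochains on `Z` with compact support. -/
def CC (Z : Set X) (φ : List X → ZMod 2) : Prop := ∃ K ⊆ Z, IsCompact K ∧ Supp Z K φ

/-- The cochain vanishes on sufficiently small lists of length `k` in `Z`. -/
def Van (k : ℕ) (Z : Set X) (φ : List X → ZMod 2) : Prop :=
  ∃ ε > 0, ∀ l : List X, l.length = k → Inn Z l → Small ε l → φ l = 0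

/-- `U` is relatively open in `Z`. -/
def OpenIn (U Z : Set X) : Prop := ∃ O, IsOpen O ∧ U = Z ∩ O

/-- `A` is relatively closed in `Z`. -/
def ClosedIn (A Z : Set X) : Prop := ∃ C, IsClosed C ∧ A = Z ∩ C

/-- Metric form of local compactness: compact subsets have compact neighbourhoods in `Z`. -/
def LC (Z : Set X) : Prop := ∀ K ⊆ Z, IsCompact K → ∃ η > 0, ∃ L ⊆ Z, IsCompact L ∧
  ∀ x ∈ K, ∀ z ∈ Z, dist x z < η → z ∈ L

/-- `f` restricts to a proper continuous map `Z → Z'`. -/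
structure ProperOn (f : X → Y) (Z : Set X) (Z' : Set Y) : Prop where
  mapsTo : ∀ x ∈ Z, f x ∈ Z'
  cont : ContinuousOn f Z
  compact : ∀ K ⊆ Z', IsCompact K → IsCompact (Z ∩ f ⁻¹' K)

open Classical in
/-- Extension by zero of a cochain on `U`. -/
noncomputable def cut (U : Set X) (φ : List X → ZMod 2) (l : List X) : ZMod 2 :=
  if Inn U l then φ l else 0

lemma cut_of_inn {U : Set X} {l : List X} (h : Inn U l) (φ : List X → ZMod 2) :
    cut U φ l = φ l := by simp [cut, h]

lemma cut_of_not {U : Set X} {l : List X} (h : ¬ Inn U l) (φ : List X → ZMod 2) :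
    cut U φ l = 0 := by simp [cut, h]

lemma cut_add (U : Set X) (φ ψ : List X → ZMod 2) : cut U (φ + ψ) = cut U φ + cut U ψ := by
  funext l; by_cases h : Inn U l <;> simp [cut, h]

lemma Inn.mono {U V : Set X} (h : U ⊆ V) {l : List X} (hl : Inn U l) : Inn V l :=
  fun x hx => h (hl x hx)

lemma cut_cut {U V : Set X} (h : U ⊆ V) (φ : List X → ZMod 2) : cut V (cut U φ) = cut U φ := by
  funext l
  by_cases hU : Inn U l
  · rw [cut_of_inn (hU.mono h)]
  · by_cases hV : Inn V l
    · rw [cut_of_inn hV]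
    · rw [cut_of_not hV, cut_of_not hU]

lemma d_add' {X : Type*} (φ ψ : List X → ZMod 2) : d (φ + ψ) = d φ + d ψ :=
  funext fun l => d_add φ ψ l

lemma d_d' {X : Type*} (φ : List X → ZMod 2) : d (d φ) = 0 := funext fun l => d_d φ l

lemma d_zero' {X : Type*} : d (0 : List X → ZMod 2) = 0 := funext fun l => d_zero l

lemma self_add {X : Type*} (φ : List X → ZMod 2) : φ + φ = 0 := funext fun l => add_self_zmod _

lemma Small.mono {ε δ : ℝ} (h : ε ≤ δ) {l : List X} (hl : Small ε l) : Small δ l :=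
  fun x hx y hy => (hl x hx y hy).trans_le h

lemma Small.sub {ε : ℝ} {l m : List X} (hl : Small ε l) (h : ∀ x ∈ m, x ∈ l) : Small ε m :=
  fun x hx y hy => hl x (h x hx) y (h y hy)

lemma Inn.sub {Z : Set X} {l m : List X} (hl : Inn Z l) (h : ∀ x ∈ m, x ∈ l) : Inn Z m :=
  fun x hx => hl x (h x hx)

lemma OpenIn.subset {U Z : Set X} (h : OpenIn U Z) : U ⊆ Z := by
  obtain ⟨O, -, rfl⟩ := h; exact inter_subset_left

lemma ClosedIn.subset {U Z : Set X} (h : ClosedIn U Z) : U ⊆ Z := by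
  obtain ⟨O, -, rfl⟩ := h; exact inter_subset_left

lemma OpenIn.refl (Z : Set X) : OpenIn Z Z := ⟨univ, isOpen_univ, by simp⟩

lemma ClosedIn.refl (Z : Set X) : ClosedIn Z Z := ⟨univ, isClosed_univ, by simp⟩

lemma OpenIn.trans {U V Z : Set X} (h : OpenIn U V) (h' : OpenIn V Z) : OpenIn U Z := by
  obtain ⟨O, hO, rfl⟩ := h
  obtain ⟨O', hO', rfl⟩ := h'
  exact ⟨O' ∩ O, hO'.inter hO, by rw [inter_assoc]⟩

lemma ClosedIn.diff {A Z : Set X} (h : ClosedIn A Z) : OpenIn (Z \ A) Z := by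
  obtain ⟨C, hC, rfl⟩ := h
  exact ⟨Cᶜ, hC.isOpen_compl, by ext x; simp +contextual⟩

lemma OpenIn.diff {A Z : Set X} (h : OpenIn A Z) : ClosedIn (Z \ A) Z := by
  obtain ⟨C, hC, rfl⟩ := h
  exact ⟨Cᶜ, hC.isClosed_compl, by ext x; simp +contextual⟩

lemma OpenIn.of_isOpen {U Z : Set X} (h : IsOpen U) (hZ : U ⊆ Z) : OpenIn U Z :=
  ⟨U, h, (inter_eq_right.2 hZ).symm⟩

lemma ClosedIn.of_isClosed {U Z : Set X} (h : IsClosed U) (hZ : U ⊆ Z) : ClosedIn U Z :=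
  ⟨U, h, (inter_eq_right.2 hZ).symm⟩

lemma OpenIn.inter {U Z : Set X} (h : OpenIn U Z) (V : Set X) : OpenIn (U ∩ V) (Z ∩ V) := by
  obtain ⟨O, hO, rfl⟩ := h
  exact ⟨O, hO, by ext; simp; tauto⟩

lemma ClosedIn.inter {U Z : Set X} (h : ClosedIn U Z) (V : Set X) : ClosedIn (U ∩ V) (Z ∩ V) := by
  obtain ⟨O, hO, rfl⟩ := h
  exact ⟨O, hO, by ext; simp; tauto⟩

lemma OpenIn.restrict {U Z V : Set X} (h : OpenIn U Z) (hUV : U ⊆ V) (hV : V ⊆ Z) :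
    OpenIn U V := by
  obtain ⟨O, hO, rfl⟩ := h
  exact ⟨O, hO, by ext x; exact ⟨fun hx => ⟨hUV hx, hx.2⟩, fun hx => ⟨hV hx.1, hx.2⟩⟩⟩

lemma ClosedIn.restrict {U Z V : Set X} (h : ClosedIn U Z) (hUV : U ⊆ V) (hV : V ⊆ Z) :
    ClosedIn U V := by
  obtain ⟨O, hO, rfl⟩ := h
  exact ⟨O, hO, by ext x; exact ⟨fun hx => ⟨hUV hx, hx.2⟩, fun hx => ⟨hV hx.1, hx.2⟩⟩⟩

lemma OpenIn.exists_nhd {U Z : Set X} (h : OpenIn U Z) {K : Set X} (hK : IsCompact K)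
    (hKU : K ⊆ U) : ∃ δ > 0, ∀ x ∈ K, ∀ z ∈ Z, dist x z < δ → z ∈ U := by
  obtain ⟨O, hO, rfl⟩ := h
  obtain ⟨δ, hδ, h⟩ := hK.exists_thickening_subset_open hO (hKU.trans inter_subset_right)
  refine ⟨δ, hδ, fun x hx z hz hd => ⟨hz, h (mem_thickening_iff.2 ⟨x, hx, ?_⟩)⟩⟩
  rwa [dist_comm]

lemma ClosedIn.isCompact {A Z K : Set X} (h : ClosedIn A Z) (hK : IsCompact K) (hKZ : K ⊆ Z) :
    IsCompact (A ∩ K) := by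
  obtain ⟨C, hC, rfl⟩ := h
  have : Z ∩ C ∩ K = K ∩ C := by
    ext x; exact ⟨fun h => ⟨h.2, h.1.2⟩, fun h => ⟨⟨hKZ h.1, h.2⟩, h.1⟩⟩
  rw [this]; exact hK.inter_right hC

lemma LC.openIn {U Z : Set X} (hZ : LC Z) (h : OpenIn U Z) : LC U := by
  intro K hKU hK
  obtain ⟨η, hη, K', hK'Z, hK', hn⟩ := hZ K (hKU.trans h.subset) hK
  obtain ⟨δ, hδ, hd⟩ := h.exists_nhd hK hKU
  refine ⟨min η (δ / 2), by positivity, K' ∩ cthickening (δ / 2) K, ?_,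
    hK'.inter_right isClosed_cthickening, ?_⟩
  · rintro x ⟨hx, hx'⟩
    rw [hK.cthickening_eq_biUnion_closedBall (by positivity)] at hx'
    simp only [mem_iUnion, mem_closedBall] at hx'
    obtain ⟨k, hk, hxk⟩ := hx'
    exact hd k hk x (hK'Z hx) (by rw [dist_comm]; linarith)
  · intro x hx z hz hxz
    refine ⟨hn x hx z (h.subset hz) (hxz.trans_le (min_le_left _ _)), ?_⟩
    refine mem_cthickening_of_dist_le z x _ K hx ?_
    rw [dist_comm]; exact (hxz.trans_le (min_le_right _ _)).le

lemma LC.closedIn {A Z : Set X} (hZ : LC Z) (h : ClosedIn A Z) : LC A := by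
  intro K hKU hK
  obtain ⟨η, hη, K', hK'Z, hK', hn⟩ := hZ K (hKU.trans h.subset) hK
  exact ⟨η, hη, A ∩ K', inter_subset_left, h.isCompact hK' hK'Z,
    fun x hx z hz hd => ⟨hz, hn x hx z (h.subset hz) hd⟩⟩

lemma LC.univ [ProperSpace X] : LC (univ : Set X) := by
  intro K _ hK
  refine ⟨1, one_pos, cthickening 1 K, subset_univ _, hK.cthickening, fun x hx z _ hd => ?_⟩
  exact mem_cthickening_of_dist_le z x _ K hx (by rw [dist_comm]; exact hd.le)

lemma LC.of_isCompact {Z : Set X} (h : IsCompact Z) : LC Z :=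
  fun _ _ _ => ⟨1, one_pos, Z, subset_rfl, h, fun _ _ _ hz _ => hz⟩

/-! ### Supports and vanishing -/

lemma Supp.mono {Z K K' : Set X} {φ : List X → ZMod 2} (h : Supp Z K φ) (hK : K ⊆ K') :
    Supp Z K' φ := fun l hl hl' => h l hl fun x hx hxK => hl' x hx (hK hxK)

lemma Supp.add {Z K : Set X} {φ ψ : List X → ZMod 2} (h : Supp Z K φ) (h' : Supp Z K ψ) :
    Supp Z K (φ + ψ) := fun l hl hl' => by simp [h l hl hl', h' l hl hl']

lemma Supp.d {Z K : Set X} {φ : List X → ZMod 2} (h : Supp Z K φ) : Supp Z K (d φ) :=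
  fun l hl hl' => d_eq_zero fun m _ hm => h m (hl.sub hm) fun x hx => hl' x (hm x hx)

lemma CC.add {Z : Set X} {φ ψ : List X → ZMod 2} (h : CC Z φ) (h' : CC Z ψ) : CC Z (φ + ψ) := by
  obtain ⟨K, hKZ, hK, hs⟩ := h
  obtain ⟨K', hKZ', hK', hs'⟩ := h'
  exact ⟨K ∪ K', union_subset hKZ hKZ', hK.union hK',
    (hs.mono subset_union_left).add (hs'.mono subset_union_right)⟩

lemma CC.zero (Z : Set X) : CC Z 0 := ⟨∅, empty_subset _, isCompact_empty, fun _ _ _ => rfl⟩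

lemma CC.d {Z : Set X} {φ : List X → ZMod 2} (h : CC Z φ) : CC Z (d φ) := by
  obtain ⟨K, hKZ, hK, hs⟩ := h
  exact ⟨K, hKZ, hK, hs.d⟩

lemma CC.nil {Z : Set X} {φ : List X → ZMod 2} (h : CC Z φ) : φ [] = 0 := by
  obtain ⟨K, hKZ, hK, hs⟩ := h
  exact hs [] (by simp [Inn]) (by simp)

lemma CC.cut {U Z : Set X} (hUZ : U ⊆ Z) {φ : List X → ZMod 2} (h : CC U φ) : CC Z (cut U φ) := by
  obtain ⟨K, hKZ, hK, hs⟩ := h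
  refine ⟨K, hKZ.trans hUZ, hK, fun l hl hl' => ?_⟩
  by_cases hU : Inn U l
  · rw [cut_of_inn hU, hs l hU hl']
  · exact cut_of_not hU _

lemma CC.res {A Z : Set X} (h : ClosedIn A Z) {φ : List X → ZMod 2} (hφ : CC Z φ) : CC A φ := by
  obtain ⟨K, hKZ, hK, hs⟩ := hφ
  exact ⟨A ∩ K, inter_subset_left, h.isCompact hK hKZ, fun l hl hl' =>
    hs l (hl.mono h.subset) fun x hx hxK => hl' x hx ⟨hl x hx, hxK⟩⟩

lemma CC.congr {Z : Set X} {φ ψ : List X → ZMod 2} (hφ : CC Z φ)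
    (h : ∀ l, Inn Z l → φ l = ψ l) : CC Z ψ := by
  obtain ⟨K, hKZ, hK, hs⟩ := hφ
  exact ⟨K, hKZ, hK, fun l hl hl' => by rw [← h l hl, hs l hl hl']⟩

lemma CC.pull {f : X → Y} {Z : Set X} {Z' : Set Y} (hf : ProperOn f Z Z') {φ : List Y → ZMod 2}
    (h : CC Z' φ) : CC Z (fun l => φ (l.map f)) := by
  obtain ⟨K, hKZ, hK, hs⟩ := h
  refine ⟨Z ∩ f ⁻¹' K, inter_subset_left, hf.compact K hKZ hK, fun l hl hl' => hs _ ?_ ?_⟩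
  · intro y hy
    obtain ⟨x, hx, rfl⟩ := List.mem_map.1 hy
    exact hf.mapsTo x (hl x hx)
  · intro y hy hyK
    obtain ⟨x, hx, rfl⟩ := List.mem_map.1 hy
    exact hl' x hx ⟨hl x hx, hyK⟩

lemma Van.add {k : ℕ} {Z : Set X} {φ ψ : List X → ZMod 2} (h : Van k Z φ) (h' : Van k Z ψ) :
    Van k Z (φ + ψ) := by
  obtain ⟨ε, hε, h⟩ := h
  obtain ⟨ε', hε', h'⟩ := h'
  refine ⟨min ε ε', by positivity, fun l hl hZ hs => ?_⟩
  simp [h l hl hZ (hs.mono (min_le_left _ _)), h' l hl hZ (hs.mono (min_le_right _ _))]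

lemma Van.zero (k : ℕ) (Z : Set X) : Van k Z 0 := ⟨1, one_pos, fun _ _ _ _ => rfl⟩

lemma Van.mono {k : ℕ} {A Z : Set X} (hAZ : A ⊆ Z) {φ : List X → ZMod 2} (h : Van k Z φ) :
    Van k A φ := by
  obtain ⟨ε, hε, h⟩ := h
  exact ⟨ε, hε, fun l hl hZ hs => h l hl (hZ.mono hAZ) hs⟩

lemma Van.congr {k : ℕ} {Z : Set X} {φ ψ : List X → ZMod 2} (h : Van k Z φ)
    (h' : ∀ l, l.length = k → Inn Z l → φ l = ψ l) : Van k Z ψ := by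
  obtain ⟨ε, hε, h⟩ := h
  exact ⟨ε, hε, fun l hl hZ hs => by rw [← h' l hl hZ, h l hl hZ hs]⟩

lemma Van.d {k : ℕ} {Z : Set X} {φ : List X → ZMod 2} (h : Van k Z φ) :
    Van (k + 1) Z (d φ) := by
  obtain ⟨ε, hε, h⟩ := h
  exact ⟨ε, hε, fun l hl hZ hs => d_eq_zero fun m hm hml =>
    h m (by omega) (hZ.sub hml) (hs.sub hml)⟩

lemma Van.cut {k : ℕ} {U Z : Set X} {φ : List X → ZMod 2} (h : Van k U φ) :
    Van k Z (cut U φ) := by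
  obtain ⟨ε, hε, h⟩ := h
  refine ⟨ε, hε, fun l hl hZ hs => ?_⟩
  by_cases hU : Inn U l
  · rw [cut_of_inn hU, h l hl hU hs]
  · exact cut_of_not hU _

lemma van_d_cut {U Z : Set X} (hU : OpenIn U Z) {φ : List X → ZMod 2} (h : CC U φ) (k : ℕ) :
    Van k Z (d (cut U φ) + cut U (d φ)) := by
  obtain ⟨K, hKU, hK, hs⟩ := h
  obtain ⟨δ, hδ, hd⟩ := hU.exists_nhd hK hKU
  have hs' : Supp Z K (CompactCohomology.cut U φ) := by
    intro l hl hl'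
    by_cases hU : Inn U l
    · rw [cut_of_inn hU, hs l hU hl']
    · exact cut_of_not hU _
  refine ⟨δ, hδ, fun l _ hZ hsm => ?_⟩
  by_cases hlU : Inn U l
  · rw [Pi.add_apply, cut_of_inn hlU,
      d_congr (ψ := φ) fun m _ hm => cut_of_inn (hlU.sub hm) φ, add_self_zmod]
  · rw [Pi.add_apply, cut_of_not hlU, add_zero]
    refine hs'.d l hZ fun x hx hxK => hlU fun y hy => ?_
    exact hd x hxK y (hZ y hy) (hsm x hx y hy)

lemma unif_cont {f : X → Y} {Z K : Set X} (hf : ContinuousOn f Z) (hKZ : K ⊆ Z)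
    (hK : IsCompact K) {ε : ℝ} (hε : 0 < ε) :
    ∃ δ > 0, ∀ x ∈ K, ∀ z ∈ Z, dist x z < δ → dist (f x) (f z) < ε := by
  by_contra! hcon
  choose x hx z hz hxz hfxz using fun n : ℕ => hcon (1 / ((n : ℝ) + 1)) (by positivity)
  obtain ⟨a, ha, s, hs, hlim⟩ := hK.tendsto_subseq hx
  have hz' : Filter.Tendsto (z ∘ s) Filter.atTop (nhds a) := by
    refine (tendsto_iff_of_dist ?_).1 hlim
    refine squeeze_zero (fun _ => dist_nonneg) (fun n => (hxz (s n)).le) ?_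
    exact tendsto_one_div_add_atTop_nhds_zero_nat.comp hs.tendsto_atTop
  have h1 := (hf a (hKZ ha)).tendsto.comp
    (tendsto_nhdsWithin_iff.2 ⟨hlim, Filter.Eventually.of_forall fun n => hKZ (hx (s n))⟩)
  have h2 := (hf a (hKZ ha)).tendsto.comp
    (tendsto_nhdsWithin_iff.2 ⟨hz', Filter.Eventually.of_forall fun n => hz (s n)⟩)
  have h3 := h1.dist h2
  rw [dist_self] at h3
  exact absurd (ge_of_tendsto' h3 fun n => hfxz (s n)) (not_le.2 hε)

lemma Van.pull {f : X → Y} {Z : Set X} {Z' : Set Y} (hf : ProperOn f Z Z') {k : ℕ}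
    {φ : List Y → ZMod 2} (hc : CC Z' φ) (h : Van k Z' φ) : Van k Z (fun l => φ (l.map f)) := by
  obtain ⟨K, hKZ, hK, hs⟩ := hc.pull hf
  obtain ⟨ε, hε, h⟩ := h
  obtain ⟨δ, hδ, hd⟩ := unif_cont hf.cont hKZ hK (half_pos hε)
  refine ⟨δ, hδ, fun l hl hZ hsm => ?_⟩
  by_cases hx : ∃ x ∈ l, x ∈ K
  · obtain ⟨x, hx, hxK⟩ := hx
    refine h _ (by simpa using hl) ?_ ?_
    · intro y hy
      obtain ⟨x, hx, rfl⟩ := List.mem_map.1 hy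
      exact hf.mapsTo x (hZ x hx)
    · intro y hy y' hy'
      obtain ⟨z, hz, rfl⟩ := List.mem_map.1 hy
      obtain ⟨z', hz', rfl⟩ := List.mem_map.1 hy'
      have h1 := hd x hxK z (hZ z hz) (hsm x hx z hz)
      have h2 := hd x hxK z' (hZ z' hz') (hsm x hx z' hz')
      linarith [dist_triangle_left (f z) (f z') (f x)]
  · push Not at hx
    exact hs l hZ hx

/-! ### Cocycles and coboundaries -/

/-- Compactly supported cocycles on lists of length `k`. -/
def Cocyc (k : ℕ) (Z : Set X) (φ : List X → ZMod 2) : Prop := CC Z φ ∧ Van (k + 1) Z (d φ)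

/-- Cochains that agree on small lists of length `k` with a compactly supported coboundary. -/
def Cobd (k : ℕ) (Z : Set X) (φ : List X → ZMod 2) : Prop := ∃ ψ, CC Z ψ ∧ Van k Z (φ + d ψ)

lemma Cocyc.add {k : ℕ} {Z : Set X} {φ ψ : List X → ZMod 2} (h : Cocyc k Z φ)
    (h' : Cocyc k Z ψ) : Cocyc k Z (φ + ψ) :=
  ⟨h.1.add h'.1, by rw [d_add']; exact h.2.add h'.2⟩

lemma Cocyc.zero (k : ℕ) (Z : Set X) : Cocyc k Z 0 :=
  ⟨CC.zero Z, by rw [d_zero']; exact Van.zero _ _⟩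

lemma Cobd.add {k : ℕ} {Z : Set X} {φ ψ : List X → ZMod 2} (h : Cobd k Z φ)
    (h' : Cobd k Z ψ) : Cobd k Z (φ + ψ) := by
  obtain ⟨a, ha, ha'⟩ := h
  obtain ⟨b, hb, hb'⟩ := h'
  refine ⟨a + b, ha.add hb, ?_⟩
  rw [d_add', show φ + ψ + (d a + d b) = (φ + d a) + (ψ + d b) by abel]
  exact ha'.add hb'

lemma Van.cobd {k : ℕ} {Z : Set X} {φ : List X → ZMod 2} (h : Van k Z φ) : Cobd k Z φ :=
  ⟨0, CC.zero Z, by rwa [d_zero', add_zero]⟩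

lemma Cobd.zero (k : ℕ) (Z : Set X) : Cobd k Z 0 := (Van.zero k Z).cobd

lemma Cocyc.pull {f : X → Y} {Z : Set X} {Z' : Set Y} (hf : ProperOn f Z Z') {k : ℕ}
    {φ : List Y → ZMod 2} (h : Cocyc k Z' φ) : Cocyc k Z (fun l => φ (l.map f)) := by
  refine ⟨h.1.pull hf, ?_⟩
  have : d (fun l => φ (l.map f)) = fun l => d φ (l.map f) := funext fun l => d_map f φ l
  rw [this]
  exact h.2.pull hf h.1.d

lemma Cobd.pull {f : X → Y} {Z : Set X} {Z' : Set Y} (hf : ProperOn f Z Z') {k : ℕ}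
    {φ : List Y → ZMod 2} (hc : CC Z' φ) (h : Cobd k Z' φ) :
    Cobd k Z (fun l => φ (l.map f)) := by
  obtain ⟨ψ, hψ, hv⟩ := h
  refine ⟨_, hψ.pull hf, ?_⟩
  have : d (fun l => ψ (l.map f)) = fun l => d ψ (l.map f) := funext fun l => d_map f ψ l
  rw [this]
  exact hv.pull hf (hc.add hψ.d)

lemma Cocyc.cut {U Z : Set X} (hU : OpenIn U Z) {k : ℕ} {φ : List X → ZMod 2}
    (h : Cocyc k U φ) : Cocyc k Z (cut U φ) := by
  refine ⟨h.1.cut hU.subset, ?_⟩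
  have := (van_d_cut hU h.1 (k + 1)).add (h.2.cut (Z := Z))
  rwa [add_assoc, self_add, add_zero] at this

lemma Cobd.cut {U Z : Set X} (hU : OpenIn U Z) {k : ℕ} {φ : List X → ZMod 2}
    (h : Cobd k U φ) : Cobd k Z (cut U φ) := by
  obtain ⟨ψ, hψ, hv⟩ := h
  refine ⟨_, hψ.cut hU.subset, ?_⟩
  have := (van_d_cut hU hψ k).add (hv.cut (Z := Z))
  rw [cut_add] at this
  rwa [show d (CompactCohomology.cut U ψ) + CompactCohomology.cut U (d ψ)
    + (CompactCohomology.cut U φ + CompactCohomology.cut U (d ψ)) =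
    CompactCohomology.cut U φ + d (CompactCohomology.cut U ψ)
    + (CompactCohomology.cut U (d ψ) + CompactCohomology.cut U (d ψ)) by abel, self_add,
    add_zero] at this

lemma Cocyc.res {A Z : Set X} (h : ClosedIn A Z) {k : ℕ} {φ : List X → ZMod 2}
    (hφ : Cocyc k Z φ) : Cocyc k A φ := ⟨hφ.1.res h, hφ.2.mono h.subset⟩

end Cochains

section Extension

variable {X Y W : Type*} [MetricSpace X] [MetricSpace Y] [MetricSpace W]

lemma exists_near_retraction (A : Set X) {η : ℝ} (hη : 0 < η) :
    ∃ ρ : X → X, (∀ x ∈ thickening η A, ρ x ∈ A ∧ dist x (ρ x) < η) ∧ (∀ a ∈ A, ρ a = a) := by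
  classical
  have h : ∀ x, ∃ y, (x ∈ thickening η A → y ∈ A ∧ dist x y < η) ∧ (x ∈ A → y = x) := by
    intro x
    by_cases hx : x ∈ A
    · exact ⟨x, fun _ => ⟨hx, by simpa⟩, fun _ => rfl⟩
    · by_cases hx' : x ∈ thickening η A
      · obtain ⟨y, hy, hxy⟩ := mem_thickening_iff.1 hx'
        exact ⟨y, fun _ => ⟨hy, hxy⟩, fun h => absurd h hx⟩
      · exact ⟨x, fun h => absurd h hx', fun _ => rfl⟩
  choose ρ h1 h2 using h
  exact ⟨ρ, h1, h2⟩

lemma Inn.map_retr {A : Set X} {η : ℝ} {ρ : X → X}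
    (hρ : ∀ x ∈ thickening η A, ρ x ∈ A ∧ dist x (ρ x) < η) {l : List X}
    (hl : Inn (thickening η A) l) : Inn A (l.map ρ) := by
  intro y hy
  obtain ⟨x, hx, rfl⟩ := List.mem_map.1 hy
  exact (hρ x (hl x hx)).1

lemma exists_extension {A Z : Set X} (hZ : LC Z) (hA : A ⊆ Z) {φ : List X → ZMod 2}
    (hφ : CC A φ) {δ : ℝ} (hδ : 0 < δ) : ∃ η, 0 < η ∧ η ≤ δ ∧ ∃ (ρ : X → X) (Φ : List X → ZMod 2),
      (∀ x ∈ thickening η A, ρ x ∈ A ∧ dist x (ρ x) < η) ∧ (∀ a ∈ A, ρ a = a) ∧ CC Z Φ ∧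
      ∀ l, Inn (thickening η A) l → Φ l = φ (l.map ρ) := by
  obtain ⟨K, hKA, hK, hs⟩ := hφ
  obtain ⟨η₀, hη₀, K', hK'Z, hK', hn⟩ := hZ K (hKA.trans hA) hK
  have hη : 0 < min δ η₀ := by positivity
  obtain ⟨ρ, h1, h2⟩ := exists_near_retraction A hη
  refine ⟨min δ η₀, hη, min_le_left _ _, ρ, cut (thickening (min δ η₀) A) fun l => φ (l.map ρ),
    h1, h2, ⟨K', hK'Z, hK', fun l hl hl' => ?_⟩, fun l hl => cut_of_inn hl _⟩
  by_cases hN : Inn (thickening (min δ η₀) A) l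
  · rw [cut_of_inn hN]
    refine hs _ (hN.map_retr h1) fun y hy hyK => ?_
    obtain ⟨x, hx, rfl⟩ := List.mem_map.1 hy
    refine hl' x hx (hn _ hyK x (hl x hx) ?_)
    rw [dist_comm]
    exact (h1 x (hN x hx)).2.trans_le (min_le_right _ _)
  · exact cut_of_not hN _

lemma map_retr_of_inn {A : Set X} {ρ : X → X} (h : ∀ a ∈ A, ρ a = a) {l : List X}
    (hl : Inn A l) : l.map ρ = l := by
  conv_rhs => rw [← List.map_id l]
  exact List.map_congr_left fun x hx => h x (hl x hx)

lemma exists_extension' {A Z : Set X} (hZ : LC Z) (hA : A ⊆ Z) {φ : List X → ZMod 2}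
    (hφ : CC A φ) : ∃ Φ : List X → ZMod 2, CC Z Φ ∧ ∀ l, Inn A l → Φ l = φ l := by
  obtain ⟨η, hη, -, ρ, Φ, h1, h2, h3, h4⟩ := exists_extension hZ hA hφ one_pos
  refine ⟨Φ, h3, fun l hl => ?_⟩
  rw [h4 l (hl.mono (self_subset_thickening hη A)), map_retr_of_inn h2 hl]

/-- The relation defining the connecting homomorphism on cochains. -/
def ConnC (k : ℕ) (Z A B : Set X) (Φ χ : List X → ZMod 2) : Prop :=
  CC Z Φ ∧ Cocyc k A Φ ∧ Cocyc (k + 1) B χ ∧ Van (k + 1) Z (d Φ + cut B χ)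

lemma small_map_retr {A : Set X} {ε η : ℝ} {ρ : X → X}
    (hρ : ∀ x ∈ thickening η A, ρ x ∈ A ∧ dist x (ρ x) < η) {l : List X}
    (hl : Inn (thickening η A) l) (hs : Small ε l) : Small (ε + 2 * η) (l.map ρ) := by
  intro y hy y' hy'
  obtain ⟨x, hx, rfl⟩ := List.mem_map.1 hy
  obtain ⟨x', hx', rfl⟩ := List.mem_map.1 hy'
  have h1 := (hρ x (hl x hx)).2
  have h2 := (hρ x' (hl x' hx')).2
  have h3 := hs x hx x' hx'
  have := dist_triangle4 (ρ x) x x' (ρ x')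
  rw [dist_comm (ρ x) x] at this
  linarith

lemma not_inn_iff {Z : Set X} {l : List X} : ¬ Inn Z l ↔ ∃ x ∈ l, x ∉ Z := by
  simp [Inn]

lemma exists_connC {A Z B : Set X} (hZ : LC Z) (hA : ClosedIn A Z) (hB : B = Z \ A) {k : ℕ}
    {φ : List X → ZMod 2} (hφ : Cocyc k A φ) :
    ∃ Φ χ, ConnC k Z A B Φ χ ∧ ∀ l, Inn A l → Φ l = φ l := by
  classical
  obtain ⟨hc, ε, hε, hv⟩ := hφ
  obtain ⟨η, hη, hηε, ρ, Φ, h1, h2, hΦ, h4⟩ :=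
    exists_extension hZ hA.subset hc (δ := ε / 4) (by positivity)
  have hAN : A ⊆ thickening η A := self_subset_thickening hη A
  have hΦA : ∀ l, Inn A l → Φ l = φ l := fun l hl => by
    rw [h4 l (hl.mono hAN), map_retr_of_inn h2 hl]
  obtain ⟨K, hKZ, hK, hs⟩ := id hΦ
  obtain ⟨η₁, hη₁, K', hK'Z, hK', hn⟩ := hZ K hKZ hK
  set ε₂ := min η₁ η with hε₂
  have hε₂0 : 0 < ε₂ := by positivity
  set χ : List X → ZMod 2 := fun l =>
    if Small ε₂ l ∧ ¬ Inn (thickening η A) l then d Φ l else 0 with hχ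
  have hχs : Supp Z (K' \ thickening η A) χ := by
    intro l hl hl'
    by_contra hne
    have hne' : Small ε₂ l ∧ ¬ Inn (thickening η A) l := by
      by_contra hc; exact hne (if_neg hc)
    rw [hχ] at hne
    simp only [if_pos hne'] at hne
    have : ∃ x ∈ l, x ∈ K := by
      by_contra hcon
      push Not at hcon
      exact hne (hs.d l hl hcon)
    obtain ⟨x, hx, hxK⟩ := this
    obtain ⟨y, hy, hyN⟩ := not_inn_iff.1 hne'.2
    exact hl' y hy ⟨hn x hxK y (hl y hy) ((hne'.1 x hx y hy).trans_le (min_le_left _ _)), hyN⟩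
  have hχc : CC B χ := by
    refine ⟨K' \ thickening η A, ?_, hK'.diff isOpen_thickening, fun l hl hl' =>
      hχs l (hl.mono (by rw [hB]; exact sdiff_subset)) hl'⟩
    rw [hB]
    exact fun x hx => ⟨hK'Z hx.1, fun hxA => hx.2 (hAN hxA)⟩
  have hmain : ∀ l : List X, l.length = k + 1 → Inn Z l → Small ε₂ l →
      d Φ l + cut B χ l = 0 := by
    intro l hlk hl hsm
    by_cases hN : Inn (thickening η A) l
    · have e1 : cut B χ l = 0 := by
        by_cases hB' : Inn B l
        · rw [cut_of_inn hB']
          exact if_neg fun h => h.2 hN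
        · exact cut_of_not hB' _
      rw [e1, add_zero, d_congr (ψ := fun m => φ (m.map ρ)) fun m _ hm => h4 m (hN.sub hm), d_map]
      refine hv _ (by simpa using hlk) (hN.map_retr h1) ((small_map_retr h1 hN hsm).mono ?_)
      have : ε₂ ≤ η := min_le_right _ _
      linarith
    · have hB' : Inn B l := by
        rw [hB]
        refine fun x hx => ⟨hl x hx, fun hxA => hN fun y hy => ?_⟩
        exact mem_thickening_iff.2 ⟨x, hxA, (hsm y hy x hx).trans_le (min_le_right _ _)⟩
      rw [cut_of_inn hB', hχ]
      simp only [if_pos (And.intro hsm hN)]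
      exact add_self_zmod _
  refine ⟨Φ, χ, ⟨hΦ, ⟨hΦ.res hA, ?_⟩, ⟨hχc, ?_⟩, ⟨ε₂, hε₂0, hmain⟩⟩, hΦA⟩
  · refine Van.congr (φ := d φ) ⟨ε, hε, hv⟩ fun l _ hl => ?_
    exact d_congr fun m _ hm => (hΦA m (hl.sub hm)).symm
  · refine ⟨ε₂, hε₂0, fun l hlk hl hsm => ?_⟩
    have hBZ : B ⊆ Z := by rw [hB]; exact sdiff_subset
    have := d_congr (φ := d Φ + cut B χ) (ψ := 0) (l := l) fun m hm hml =>
      hmain m (by omega) ((hl.mono hBZ).sub hml) (hsm.sub hml)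
    rw [d_add, d_d, zero_add, d_congr (ψ := χ) fun m _ hm => cut_of_inn (hl.sub hm) χ, d_zero'] at this
    exact this

/-- A cochain vanishing near `A` whose coboundary comes from the complement of `A` comes, up to a
coboundary, from the complement of `A`. -/
lemma exists_compl_primitive {A Z B : Set X} (hZ : LC Z) (hA : ClosedIn A Z) (hB : B = Z \ A) {k : ℕ}
    {Φ χ : List X → ZMod 2} (hΦ : CC Z Φ) (hv : Van k A Φ) (hχ : CC B χ)
    (hd : Van (k + 1) Z (d Φ + cut B χ)) :
    ∃ ω θ, CC B ω ∧ CC Z θ ∧ Van k Z (Φ + cut B ω + d θ) := by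
  classical
  obtain ⟨K₁, hK₁Z, hK₁, hs₁⟩ := id hΦ
  obtain ⟨K₂, hK₂B, hK₂, hs₂⟩ := hχ
  have hBZ : B ⊆ Z := by rw [hB]; exact sdiff_subset
  have hBo : OpenIn B Z := by rw [hB]; exact hA.diff
  have hKZ : K₁ ∪ K₂ ⊆ Z := union_subset hK₁Z (hK₂B.trans hBZ)
  obtain ⟨η₁, hη₁, K', hK'Z, hK', hn⟩ := hZ _ hKZ (hK₁.union hK₂)
  obtain ⟨η₂, hη₂, K'', hK''Z, hK'', hn'⟩ := hZ K' hK'Z hK'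
  obtain ⟨δ, hδ, hδ'⟩ := hBo.exists_nhd hK₂ hK₂B
  obtain ⟨ε₀, hε₀, hv⟩ := hv
  obtain ⟨ε₁, hε₁, hd⟩ := hd
  obtain ⟨η, hη, hle1, hle2, hle3, hle4, hle5⟩ : ∃ η > 0, η ≤ η₁ ∧ η ≤ η₂ ∧ η ≤ δ ∧
      4 * η ≤ ε₀ ∧ 4 * η ≤ ε₁ := by
    refine ⟨min η₁ (min η₂ (min δ (min (ε₀ / 4) (ε₁ / 4)))), by positivity, ?_, ?_, ?_, ?_, ?_⟩
    · exact min_le_left _ _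
    · exact (min_le_right _ _).trans (min_le_left _ _)
    · exact (min_le_right _ _).trans ((min_le_right _ _).trans (min_le_left _ _))
    · have : min η₁ (min η₂ (min δ (min (ε₀ / 4) (ε₁ / 4)))) ≤ ε₀ / 4 :=
        (min_le_right _ _).trans ((min_le_right _ _).trans
          ((min_le_right _ _).trans (min_le_left _ _)))
      linarith
    · have : min η₁ (min η₂ (min δ (min (ε₀ / 4) (ε₁ / 4)))) ≤ ε₁ / 4 :=
        (min_le_right _ _).trans ((min_le_right _ _).trans
          ((min_le_right _ _).trans (min_le_right _ _)))
      linarith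
  obtain ⟨ρ, h1, h2⟩ := exists_near_retraction A hη
  have hAN : A ⊆ thickening η A := self_subset_thickening hη A
  set N := thickening η A with hN
  set r : X → X := fun x => if x ∈ N then ρ x else x with hr
  have hrd : ∀ x, dist x (r x) < η := by
    intro x
    by_cases hx : x ∈ N
    · simp only [hr, if_pos hx]; exact (h1 x hx).2
    · simpa only [hr, if_neg hx, dist_self]
  have hrN : ∀ x ∈ N, r x ∈ A := fun x hx => by
    simp only [hr, if_pos hx]; exact (h1 x hx).1
  have hrZ : ∀ x ∈ Z, r x ∈ Z := by
    intro x hx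
    by_cases hxN : x ∈ N
    · exact hA.subset (hrN x hxN)
    · simpa only [hr, if_neg hxN]
  have hrK : ∀ x ∈ Z, r x ∈ K₁ ∪ K₂ → x ∈ K' := fun x hx hK =>
    hn _ hK x hx (by rw [dist_comm]; exact (hrd x).trans_le hle1)
  have hidK : ∀ x ∈ Z, x ∈ K₁ ∪ K₂ → x ∈ K' := fun x hx hK =>
    hn _ hK x hx (by simpa using hη₁)
  have hprism : ∀ {φ : List X → ZMod 2}, Supp Z (K₁ ∪ K₂) φ → Supp Z K' (prism r id φ) := by
    intro φ hφ l hl hl'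
    refine prism_eq_zero fun m _ hm => hφ m (fun y hy => ?_) fun y hy hyK => ?_
    · obtain ⟨x, hx, rfl | rfl⟩ := hm y hy
      exacts [hrZ x (hl x hx), hl _ hx]
    · obtain ⟨x, hx, rfl | rfl⟩ := hm y hy
      exacts [hl' x hx (hrK x (hl x hx) hyK), hl' _ hx (hidK _ (hl _ hx) hyK)]
  have hs₁' : Supp Z (K₁ ∪ K₂) Φ := hs₁.mono subset_union_left
  have hs₂' : Supp Z (K₁ ∪ K₂) (cut B χ) := by
    intro l hl hl'
    by_cases hlB : Inn B l
    · rw [cut_of_inn hlB]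
      exact hs₂ l hlB fun x hx hxK => hl' x hx (Or.inr hxK)
    · exact cut_of_not hlB _
  set α : List X → ZMod 2 := (fun l => Φ (l.map r)) + prism r id (cut B χ) with hα
  have hαs : Supp Z K' α := by
    refine Supp.add (fun l hl hl' => hs₁' _ ?_ ?_) (hprism hs₂')
    · intro y hy
      obtain ⟨x, hx, rfl⟩ := List.mem_map.1 hy
      exact hrZ x (hl x hx)
    · intro y hy hyK
      obtain ⟨x, hx, rfl⟩ := List.mem_map.1 hy
      exact hl' x hx (hrK x (hl x hx) hyK)
  set ω : List X → ZMod 2 := fun l => if Small η l ∧ ¬ Inn N l then α l else 0 with hω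
  refine ⟨ω, prism r id Φ, ⟨K'' \ N, ?_, hK''.diff isOpen_thickening, fun l hl hl' => ?_⟩,
    ⟨K', hK'Z, hK', hprism hs₁'⟩, ⟨η, hη, fun l hlk hl hsm => ?_⟩⟩
  · rw [hB]; exact fun x hx => ⟨hK''Z hx.1, fun hxA => hx.2 (hAN hxA)⟩
  · by_contra hne
    have hne' : Small η l ∧ ¬ Inn N l := by
      by_contra hc; exact hne (if_neg hc)
    simp only [hω, if_pos hne'] at hne
    have : ∃ x ∈ l, x ∈ K' := by
      by_contra hcon
      push Not at hcon
      exact hne (hαs l (hl.mono hBZ) hcon)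
    obtain ⟨x, hx, hxK⟩ := this
    obtain ⟨y, hy, hyN⟩ := not_inn_iff.1 hne'.2
    exact hl' y hy ⟨hn' x hxK y (hBZ (hl y hy)) ((hne'.1 x hx y hy).trans_le hle2), hyN⟩
  · have hpr : prism r id (d Φ) l = prism r id (cut B χ) l := by
      have : prism r id (d Φ + cut B χ) l = 0 := by
        refine prism_eq_zero fun m hm hml => hd m (by omega) (fun y hy => ?_) ?_
        · obtain ⟨x, hx, rfl | rfl⟩ := hml y hy
          exacts [hrZ x (hl x hx), hl _ hx]
        · have hnear : ∀ y ∈ m, ∃ x ∈ l, dist x y < η := by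
            intro y hy
            obtain ⟨x, hx, rfl | rfl⟩ := hml y hy
            exacts [⟨x, hx, hrd x⟩, ⟨_, hx, by simpa using hη⟩]
          intro y hy y' hy'
          obtain ⟨x, hx, hxy⟩ := hnear y hy
          obtain ⟨x', hx', hxy'⟩ := hnear y' hy'
          have := dist_triangle4 y x x' y'
          rw [dist_comm y x] at this
          linarith [hsm x hx x' hx']
      rw [prism_add] at this
      have h3 := add_self_zmod (prism r id (cut B χ) l)
      exact add_right_cancel (this.trans h3.symm)
    have key : d (prism r id Φ) l = α l + Φ l := by
      have h3 := d_prism r id Φ l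
      rw [List.map_id] at h3
      have h4 : d (prism r id Φ) l = Φ (l.map r) + Φ l - prism r id (d Φ) l := by
        rw [← h3]; ring
      rw [h4, hpr, CharTwo.sub_eq_add, hα, Pi.add_apply]
      ring
    rw [Pi.add_apply, Pi.add_apply, key]
    have goal : cut B ω l = α l := by
      by_cases hlN : Inn N l
      · have e1 : cut B ω l = 0 := by
          by_cases hB' : Inn B l
          · rw [cut_of_inn hB']
            exact if_neg fun h => h.2 hlN
          · exact cut_of_not hB' _
        rw [e1, hα, Pi.add_apply]
        have e2 : Φ (l.map r) = 0 := by
          refine hv _ (by simpa using hlk) ?_ ?_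
          · intro y hy
            obtain ⟨x, hx, rfl⟩ := List.mem_map.1 hy
            exact hrN x (hlN x hx)
          · intro y hy y' hy'
            obtain ⟨x, hx, rfl⟩ := List.mem_map.1 hy
            obtain ⟨x', hx', rfl⟩ := List.mem_map.1 hy'
            have h3 := dist_triangle4 (r x) x x' (r x')
            rw [dist_comm (r x) x] at h3
            linarith [hrd x, hrd x', hsm x hx x' hx']
        have e3 : prism r id (cut B χ) l = 0 := by
          refine prism_eq_zero fun m _ hml => ?_
          by_cases hmB : Inn B m
          · rw [cut_of_inn hmB]
            refine hs₂ m hmB fun y hy hyK => ?_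
            obtain ⟨x, hx, rfl | rfl⟩ := hml y hy
            · have := hmB _ hy
              rw [hB] at this
              exact this.2 (hrN x (hlN x hx))
            · have h5 := hδ' _ hyK (r _) (hrZ _ (hl _ hx)) ((hrd _).trans_le hle3)
              rw [hB] at h5
              exact h5.2 (hrN _ (hlN _ hx))
          · exact cut_of_not hmB _
        rw [e2, e3, add_zero]
      · have hB' : Inn B l := by
          rw [hB]
          refine fun x hx => ⟨hl x hx, fun hxA => hlN fun y hy => ?_⟩
          exact mem_thickening_iff.2 ⟨x, hxA, hsm y hy x hx⟩
        rw [cut_of_inn hB', hω]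
        simp only [if_pos (And.intro hsm hlN)]
    rw [goal]
    have h3 := add_self_zmod (α l)
    have h4 := add_self_zmod (Φ l)
    linear_combination h3 + h4

/-- Uniqueness in the connecting relation. -/
lemma ConnC.cobd {A Z B : Set X} (hZ : LC Z) (hA : ClosedIn A Z) (hB : B = Z \ A) {k : ℕ}
    {Φ χ : List X → ZMod 2} (h : ConnC k Z A B Φ χ) (h0 : Cobd k A Φ) : Cobd (k + 1) B χ := by
  obtain ⟨hΦ, hΦA, hχ, hd⟩ := h
  obtain ⟨ψ, hψ, hv⟩ := h0
  have hBZ : B ⊆ Z := by rw [hB]; exact sdiff_subset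
  obtain ⟨Ψ, hΨ, hΨψ⟩ := exists_extension' hZ hA.subset hψ
  have hv' : Van k A (Φ + d Ψ) := hv.congr fun l _ hl => by
    rw [Pi.add_apply, Pi.add_apply, d_congr fun m _ hm => hΨψ m (hl.sub hm)]
  have hd' : Van (k + 1) Z (d (Φ + d Ψ) + cut B χ) := by rwa [d_add', d_d', add_zero]
  obtain ⟨ω, θ, hω, hθ, hv2⟩ := exists_compl_primitive hZ hA hB (hΦ.add hΨ.d) hv' hχ.1 hd'
  refine ⟨ω, hω, ?_⟩
  have h3 := (hv2.d.add hd').mono hBZ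
  refine h3.congr fun l _ hl => ?_
  simp only [d_add', d_d', Pi.add_apply, add_zero]
  rw [cut_of_inn hl, d_congr (φ := cut B ω) (ψ := ω) fun m _ hm => cut_of_inn (hl.sub hm) ω]
  linear_combination add_self_zmod (d Φ l)

lemma exists_cut_of_cobd_res {A Z B : Set X} (hZ : LC Z) (hA : ClosedIn A Z) (hB : B = Z \ A) {k : ℕ}
    {Φ : List X → ZMod 2} (h : Cocyc k Z Φ) (h0 : Cobd k A Φ) :
    ∃ ω, Cocyc k B ω ∧ Cobd k Z (Φ + cut B ω) := by
  obtain ⟨hΦ, hd⟩ := h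
  obtain ⟨ψ, hψ, hv⟩ := h0
  have hBZ : B ⊆ Z := by rw [hB]; exact sdiff_subset
  obtain ⟨Ψ, hΨ, hΨψ⟩ := exists_extension' hZ hA.subset hψ
  have hv' : Van k A (Φ + d Ψ) := hv.congr fun l _ hl => by
    rw [Pi.add_apply, Pi.add_apply, d_congr fun m _ hm => hΨψ m (hl.sub hm)]
  have hd' : Van (k + 1) Z (d (Φ + d Ψ) + cut B 0) := by
    have : cut B (0 : List X → ZMod 2) = 0 := by
      have := cut_add B (0 : List X → ZMod 2) 0
      simpa using this
    rwa [d_add', d_d', add_zero, this, add_zero]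
  obtain ⟨ω, θ, hω, hθ, hv2⟩ :=
    exists_compl_primitive hZ hA hB (hΦ.add hΨ.d) hv' (CC.zero B) hd'
  refine ⟨ω, ⟨hω, ?_⟩, ⟨Ψ + θ, hΨ.add hθ, ?_⟩⟩
  · have h3 := (hv2.d.add hd).mono hBZ
    refine h3.congr fun l _ hl => ?_
    simp only [d_add', d_d', Pi.add_apply, add_zero]
    rw [d_congr (φ := cut B ω) (ψ := ω) fun m _ hm => cut_of_inn (hl.sub hm) ω]
    linear_combination add_self_zmod (d Φ l)
  · rw [d_add']
    rwa [show Φ + cut B ω + (d Ψ + d θ) = Φ + d Ψ + cut B ω + d θ by abel]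

end Extension

section Proper

variable {X Y W : Type*} [MetricSpace X] [MetricSpace Y] [MetricSpace W]

lemma ProperOn.comp {f : X → Y} {g : Y → W} {Z : Set X} {Z' : Set Y} {Z'' : Set W}
    (hg : ProperOn g Z' Z'') (hf : ProperOn f Z Z') : ProperOn (g ∘ f) Z Z'' := by
  refine ⟨fun x hx => hg.mapsTo _ (hf.mapsTo x hx), hg.cont.comp hf.cont hf.mapsTo,
    fun K hK hc => ?_⟩
  have : Z ∩ g ∘ f ⁻¹' K = Z ∩ f ⁻¹' (Z' ∩ g ⁻¹' K) := by
    ext x; exact ⟨fun h => ⟨h.1, hf.mapsTo x h.1, h.2⟩, fun h => ⟨h.1, h.2.2⟩⟩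
  rw [this]
  exact hf.compact _ inter_subset_left (hg.compact K hK hc)

lemma ProperOn.restrict {f : X → Y} {Z U : Set X} {Z' U' : Set Y} (hf : ProperOn f Z Z')
    (hU' : U' ⊆ Z') (hU : U = Z ∩ f ⁻¹' U') : ProperOn f U U' := by
  subst hU
  refine ⟨fun x hx => hx.2, hf.cont.mono inter_subset_left, fun K hK hc => ?_⟩
  have : Z ∩ f ⁻¹' U' ∩ f ⁻¹' K = Z ∩ f ⁻¹' K := by
    ext x; exact ⟨fun h => ⟨h.1.1, h.2⟩, fun h => ⟨⟨h.1, hK h.2⟩, h.2⟩⟩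
  rw [this]
  exact hf.compact K (hK.trans hU') hc

lemma ClosedIn.properOn {A Z : Set X} (h : ClosedIn A Z) : ProperOn id A Z :=
  ⟨fun x hx => h.subset hx, continuousOn_id, fun K hK hc => h.isCompact hc hK⟩

lemma ProperOn.of_isCompact {f : X → Y} {Z : Set X} {Z' : Set Y} (hZ : IsCompact Z)
    (hf : ContinuousOn f Z) (h : ∀ x ∈ Z, f x ∈ Z') : ProperOn f Z Z' := by
  refine ⟨h, hf, fun K _ hc => ?_⟩
  have h1 : IsClosed (Z ∩ f ⁻¹' K) := hf.preimage_isClosed_of_isClosed hZ.isClosed hc.isClosed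
  exact hZ.of_isClosed_subset h1 inter_subset_left

lemma ProperOn.id (Z : Set X) : ProperOn id Z Z := (ClosedIn.refl Z).properOn

lemma ProperOn.openIn {f : X → Y} {Z : Set X} {Z' U : Set Y} (hf : ProperOn f Z Z')
    (hU : OpenIn U Z') : OpenIn (Z ∩ f ⁻¹' U) Z := by
  obtain ⟨O, hO, rfl⟩ := hU
  obtain ⟨O', hO', h⟩ := (_root_.continuousOn_iff'.1 hf.cont) O hO
  refine ⟨O', hO', ?_⟩
  rw [inter_comm Z O', ← h]
  ext x
  exact ⟨fun hx => ⟨hx.2.2, hx.1⟩, fun hx => ⟨hx.2, hf.mapsTo x hx.2, hx.1⟩⟩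

lemma ProperOn.closedIn_preimage {f : X → Y} {Z : Set X} {Z' A : Set Y} (hf : ProperOn f Z Z')
    (hA : ClosedIn A Z') : ClosedIn (Z ∩ f ⁻¹' A) Z := by
  have h := (hf.openIn hA.diff).diff
  convert h using 1
  ext x
  simp only [mem_inter_iff, mem_preimage, mem_sdiff, not_and, not_not]
  exact ⟨fun hx => ⟨hx.1, fun _ _ => hx.2⟩, fun hx => ⟨hx.1, hx.2 hx.1 (hf.mapsTo x hx.1)⟩⟩

end Proper

section Groups

variable {X Y W : Type*} [MetricSpace X] [MetricSpace Y] [MetricSpace W]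

/-- The group of cocycles. -/
def cocycles (k : ℕ) (Z : Set X) : AddSubgroup (List X → ZMod 2) where
  carrier := {φ | Cocyc k Z φ}
  add_mem' := Cocyc.add
  zero_mem' := Cocyc.zero k Z
  neg_mem' := fun {φ} h => by
    have : -φ = φ := funext fun l => CharTwo.neg_eq _
    rwa [this]

/-- The group of coboundaries. -/
def coboundaries (k : ℕ) (Z : Set X) : AddSubgroup (List X → ZMod 2) where
  carrier := {φ | Cobd k Z φ}
  add_mem' := Cobd.add
  zero_mem' := Cobd.zero k Z
  neg_mem' := fun {φ} h => by
    have : -φ = φ := funext fun l => CharTwo.neg_eq _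
    rwa [this]

/-- Compactly supported Alexander–Spanier cohomology with coefficients modulo two; the index is
one more than the degree. -/
def H (k : ℕ) (Z : Set X) : Type _ :=
  cocycles k Z ⧸ (coboundaries k Z).addSubgroupOf (cocycles k Z)

instance (k : ℕ) (Z : Set X) : AddCommGroup (H k Z) :=
  inferInstanceAs (AddCommGroup (cocycles k Z ⧸ (coboundaries k Z).addSubgroupOf (cocycles k Z)))

/-- The class of a cocycle. -/
def mk {k : ℕ} {Z : Set X} {φ : List X → ZMod 2} (h : Cocyc k Z φ) : H k Z :=
  QuotientAddGroup.mk' ((coboundaries k Z).addSubgroupOf (cocycles k Z)) ⟨φ, h⟩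

lemma mk_add {k : ℕ} {Z : Set X} {φ ψ : List X → ZMod 2} (h : Cocyc k Z φ) (h' : Cocyc k Z ψ) :
    mk (h.add h') = mk h + mk h' := rfl

lemma mk_eq_zero {k : ℕ} {Z : Set X} {φ : List X → ZMod 2} {h : Cocyc k Z φ} :
    mk h = 0 ↔ Cobd k Z φ := by
  unfold mk
  exact (QuotientAddGroup.eq_zero_iff _).trans AddSubgroup.mem_addSubgroupOf

lemma exists_mk {k : ℕ} {Z : Set X} (c : H k Z) : ∃ φ, ∃ h : Cocyc k Z φ, c = mk h := by
  obtain ⟨⟨φ, h⟩, hc⟩ := QuotientAddGroup.mk'_surjective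
    ((coboundaries k Z).addSubgroupOf (cocycles k Z)) c
  exact ⟨φ, h, hc.symm⟩

lemma H.add_self {k : ℕ} {Z : Set X} (c : H k Z) : c + c = 0 := by
  obtain ⟨φ, h, rfl⟩ := exists_mk c
  rw [← mk_add, mk_eq_zero, self_add]
  exact Cobd.zero k Z

lemma H.add_eq_zero {k : ℕ} {Z : Set X} {c c' : H k Z} : c + c' = 0 ↔ c = c' := by
  constructor
  · intro h; exact add_right_cancel (h.trans c'.add_self.symm)
  · rintro rfl; exact c.add_self

lemma mk_eq_mk {k : ℕ} {Z : Set X} {φ ψ : List X → ZMod 2} {h : Cocyc k Z φ} {h' : Cocyc k Z ψ} :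
    mk h = mk h' ↔ Cobd k Z (φ + ψ) := by
  rw [← H.add_eq_zero, ← mk_add, mk_eq_zero]

lemma mk_eq_of_inn {k : ℕ} {Z : Set X} {φ ψ : List X → ZMod 2} {h : Cocyc k Z φ}
    {h' : Cocyc k Z ψ} (H : ∀ l, Inn Z l → φ l = ψ l) : mk h = mk h' := by
  rw [mk_eq_mk]
  refine Van.cobd ((Van.zero k Z).congr fun l _ hl => ?_)
  rw [Pi.add_apply, H l hl, add_self_zmod]; rfl

/-- Induced maps from operators on cochains. -/
def liftHom {k : ℕ} {Z : Set X} {Z' : Set Y} (F : (List X → ZMod 2) →+ (List Y → ZMod 2))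
    (h1 : ∀ φ, Cocyc k Z φ → Cocyc k Z' (F φ))
    (h2 : ∀ φ, Cocyc k Z φ → Cobd k Z φ → Cobd k Z' (F φ)) : H k Z →+ H k Z' :=
  QuotientAddGroup.map _ _ ((F.comp (cocycles k Z).subtype).codRestrict (cocycles k Z')
    fun φ => h1 φ.1 φ.2) fun φ hφ => h2 φ.1 φ.2 hφ

/-- Pull-back along a proper map. -/
def pull {k : ℕ} {f : X → Y} {Z : Set X} {Z' : Set Y} (hf : ProperOn f Z Z') :
    H k Z' →+ H k Z :=
  liftHom ⟨⟨fun φ l => φ (l.map f), rfl⟩, fun _ _ => rfl⟩ (fun φ h => h.pull hf)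
    fun φ h h' => h'.pull hf h.1

lemma pull_mk {k : ℕ} {f : X → Y} {Z : Set X} {Z' : Set Y} (hf : ProperOn f Z Z')
    {φ : List Y → ZMod 2} (h : Cocyc k Z' φ) : pull hf (mk h) = mk (h.pull hf) := rfl

/-- Extension by zero from a relatively open subset. -/
noncomputable def ext {k : ℕ} {U Z : Set X} (hU : OpenIn U Z) : H k U →+ H k Z :=
  liftHom (AddMonoidHom.mk' (cut U) (cut_add U)) (fun φ h => h.cut hU) fun φ _ h => h.cut hU

lemma ext_mk {k : ℕ} {U Z : Set X} (hU : OpenIn U Z) {φ : List X → ZMod 2} (h : Cocyc k U φ) :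
    ext hU (mk h) = mk (h.cut hU) := rfl

/-- Restriction to a relatively closed subset. -/
def res {k : ℕ} {A Z : Set X} (hA : ClosedIn A Z) : H k Z →+ H k A := pull hA.properOn

lemma res_mk {k : ℕ} {A Z : Set X} (hA : ClosedIn A Z) {φ : List X → ZMod 2} (h : Cocyc k Z φ) :
    res hA (mk h) = mk (h.res hA) := by
  unfold res
  rw [pull_mk]
  exact mk_eq_of_inn fun l _ => by rw [List.map_id]

lemma pull_pull {k : ℕ} {f : X → Y} {g : Y → W} {Z : Set X} {Z' : Set Y} {Z'' : Set W}
    (hg : ProperOn g Z' Z'') (hf : ProperOn f Z Z') (hgf : ProperOn (g ∘ f) Z Z'')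
    (c : H k Z'') : pull hf (pull hg c) = pull hgf c := by
  obtain ⟨φ, h, rfl⟩ := exists_mk c
  rw [pull_mk, pull_mk, pull_mk]
  exact mk_eq_of_inn fun l _ => by rw [List.map_map]

lemma pull_congr {k : ℕ} {f g : X → Y} {Z : Set X} {Z' : Set Y} (hf : ProperOn f Z Z')
    (hg : ProperOn g Z Z') (h : ∀ x ∈ Z, f x = g x) (c : H k Z') : pull hf c = pull hg c := by
  obtain ⟨φ, h', rfl⟩ := exists_mk c
  rw [pull_mk, pull_mk]
  exact mk_eq_of_inn fun l hl => by rw [List.map_congr_left fun x hx => h x (hl x hx)]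

/-- Two factorizations of the same map give the same pull-back. -/
lemma pull_pull_eq {V : Type*} [MetricSpace V] {k : ℕ} {f : X → Y} {g : Y → W} {f' : X → V}
    {g' : V → W} {Z : Set X} {Z₁ : Set Y} {Z₂ : Set V} {Z' : Set W} (hg : ProperOn g Z₁ Z')
    (hf : ProperOn f Z Z₁) (hg' : ProperOn g' Z₂ Z') (hf' : ProperOn f' Z Z₂)
    (h : ∀ x ∈ Z, g (f x) = g' (f' x)) (c : H k Z') :
    pull hf (pull hg c) = pull hf' (pull hg' c) := by
  rw [pull_pull hg hf (hg.comp hf), pull_pull hg' hf' (hg'.comp hf')]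
  exact pull_congr _ _ h c

lemma pull_of_eq_id {k : ℕ} {f : X → X} {Z : Set X} (hf : ProperOn f Z Z) (h : ∀ x ∈ Z, f x = x)
    (c : H k Z) : pull hf c = c := by
  rw [pull_congr hf (ProperOn.id Z) h c]
  obtain ⟨φ, h', rfl⟩ := exists_mk c
  rw [pull_mk]
  exact mk_eq_of_inn fun l hl => by rw [List.map_id]

lemma pull_eq_of_comp_id {k : ℕ} {f : X → Y} {g : Y → X} {Z : Set X} {Z' : Set Y}
    (hf : ProperOn f Z Z') (hg : ProperOn g Z' Z) (h : ∀ x ∈ Z, g (f x) = x) (c : H k Z) :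
    pull hf (pull hg c) = c := by
  rw [pull_pull hg hf (hg.comp hf)]
  exact pull_of_eq_id _ h c

lemma ext_ext {k : ℕ} {U V Z : Set X} (h : OpenIn U V) (h' : OpenIn V Z) (h'' : OpenIn U Z)
    (c : H k U) : ext h' (ext h c) = ext h'' c := by
  obtain ⟨φ, hφ, rfl⟩ := exists_mk c
  rw [ext_mk, ext_mk, ext_mk]
  exact mk_eq_of_inn fun l _ => by rw [cut_cut h.subset]

lemma ext_refl {k : ℕ} {U : Set X} (h : OpenIn U U) (c : H k U) : ext h c = c := by
  obtain ⟨φ, hφ, rfl⟩ := exists_mk c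
  rw [ext_mk]
  exact mk_eq_of_inn fun l hl => cut_of_inn hl _

lemma res_refl {k : ℕ} {U : Set X} (h : ClosedIn U U) (c : H k U) : res h c = c :=
  pull_of_eq_id _ (fun _ _ => rfl) c

lemma res_res {k : ℕ} {A C Z : Set X} (h : ClosedIn A C) (h' : ClosedIn C Z) (h'' : ClosedIn A Z)
    (c : H k Z) : res h (res h' c) = res h'' c := pull_pull _ _ _ c

lemma pull_ext {k : ℕ} {f : X → Y} {Z U : Set X} {Z' U' : Set Y} (hf : ProperOn f Z Z')
    (hU' : OpenIn U' Z') (hU : OpenIn U Z) (hfU : ProperOn f U U') (h : U = Z ∩ f ⁻¹' U')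
    (c : H k U') : pull hf (ext hU' c) = ext hU (pull hfU c) := by
  obtain ⟨φ, hφ, rfl⟩ := exists_mk c
  rw [ext_mk, pull_mk, pull_mk, ext_mk]
  refine mk_eq_of_inn fun l hl => ?_
  by_cases hlU : Inn U l
  · rw [cut_of_inn hlU, cut_of_inn]
    intro y hy
    obtain ⟨x, hx, rfl⟩ := List.mem_map.1 hy
    exact hfU.mapsTo x (hlU x hx)
  · rw [cut_of_not hlU, cut_of_not]
    obtain ⟨x, hx, hxU⟩ := not_inn_iff.1 hlU
    refine not_inn_iff.2 ⟨f x, List.mem_map_of_mem hx, fun hfx => hxU ?_⟩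
    rw [h]; exact ⟨hl x hx, hfx⟩

lemma res_ext {k : ℕ} {A U Z V : Set X} (hA : ClosedIn A Z) (hU : OpenIn U Z) (hV : OpenIn V A)
    (hV' : ClosedIn V U) (h : V = U ∩ A) (c : H k U) :
    res hA (ext hU c) = ext hV (res hV' c) :=
  pull_ext _ hU hV _ (by rw [h, inter_comm]; rfl) c

lemma res_ext_of_disjoint {k : ℕ} {A U Z : Set X} (hA : ClosedIn A Z) (hU : OpenIn U Z)
    (h : Disjoint A U) (c : H k U) : res hA (ext hU c) = 0 := by
  obtain ⟨φ, hφ, rfl⟩ := exists_mk c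
  rw [ext_mk, res_mk, mk_eq_zero]
  refine Van.cobd ((Van.zero k A).congr fun l _ hl => ?_)
  rcases l with _ | ⟨x, l⟩
  · exact (hφ.cut hU).1.nil.symm
  · refine (cut_of_not (fun hU' => ?_) _).symm
    exact disjoint_left.1 h (hl x (by simp)) (hU' x (by simp))

lemma eq_ext_res_add {k : ℕ} {U V Z : Set X} (hU : OpenIn U Z) (hV : OpenIn V Z)
    (hU' : ClosedIn U Z) (hV' : ClosedIn V Z) (h : U ∪ V = Z) (hd : Disjoint U V) (c : H k Z) :
    c = ext hU (res hU' c) + ext hV (res hV' c) := by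
  obtain ⟨φ, hφ, rfl⟩ := exists_mk c
  rw [res_mk, res_mk, ext_mk, ext_mk, ← mk_add, mk_eq_mk]
  obtain ⟨⟨K, hKZ, hK, hs⟩, -⟩ := id hφ
  obtain ⟨δ₁, hδ₁, h₁⟩ := hU.exists_nhd (hU'.isCompact hK hKZ) inter_subset_left
  obtain ⟨δ₂, hδ₂, h₂⟩ := hV.exists_nhd (hV'.isCompact hK hKZ) inter_subset_left
  refine Van.cobd ⟨min δ₁ δ₂, by positivity, fun l _ hl hsm => ?_⟩
  by_cases hl' : ∃ x ∈ l, x ∈ K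
  · obtain ⟨x, hx, hxK⟩ := hl'
    have hxZ := hl x hx
    rw [← h] at hxZ
    simp only [Pi.add_apply]
    rcases hxZ with hxU | hxV
    · have hlU : Inn U l := fun y hy => h₁ x ⟨hxU, hxK⟩ y (hl y hy)
        ((hsm x hx y hy).trans_le (min_le_left _ _))
      have hlV : ¬ Inn V l := fun hV => disjoint_left.1 hd hxU (hV x hx)
      rw [cut_of_inn hlU, cut_of_not hlV, add_zero, add_self_zmod]
    · have hlV : Inn V l := fun y hy => h₂ x ⟨hxV, hxK⟩ y (hl y hy)
        ((hsm x hx y hy).trans_le (min_le_right _ _))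
      have hlU : ¬ Inn U l := fun hU => disjoint_left.1 hd (hU x hx) hxV
      rw [cut_of_inn hlV, cut_of_not hlU, zero_add, add_self_zmod]
  · push Not at hl'
    have h3 := hs l hl hl'
    simp only [Pi.add_apply, cut, h3, ite_self, add_zero]

/-! ### The connecting relation -/

/-- `b` is the image of `a` under the connecting homomorphism of the pair `A ⊆ Z`. -/
def Conn {k : ℕ} (Z : Set X) {A B : Set X} (a : H k A) (b : H (k + 1) B) : Prop :=
  ∃ Φ χ, ∃ h : ConnC k Z A B Φ χ, a = mk h.2.1 ∧ b = mk h.2.2.1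

variable {k : ℕ} {Z A B : Set X}

lemma exists_conn (hZ : LC Z) (hA : ClosedIn A Z) (hB : B = Z \ A) (a : H k A) :
    ∃ b : H (k + 1) B, Conn Z a b := by
  obtain ⟨φ, hφ, rfl⟩ := exists_mk a
  obtain ⟨Φ, χ, h, hΦ⟩ := exists_connC hZ hA hB hφ
  exact ⟨mk h.2.2.1, Φ, χ, h, (mk_eq_of_inn hΦ).symm, rfl⟩

lemma Conn.add {a a' : H k A} {b b' : H (k + 1) B} (h : Conn Z a b) (h' : Conn Z a' b') :
    Conn Z (a + a') (b + b') := by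
  obtain ⟨Φ, χ, h1, rfl, rfl⟩ := h
  obtain ⟨Φ', χ', h2, rfl, rfl⟩ := h'
  refine ⟨Φ + Φ', χ + χ', ⟨h1.1.add h2.1, h1.2.1.add h2.2.1, h1.2.2.1.add h2.2.2.1, ?_⟩,
    (mk_add _ _).symm, (mk_add _ _).symm⟩
  rw [d_add', cut_add, show d Φ + d Φ' + (cut B χ + cut B χ') =
    (d Φ + cut B χ) + (d Φ' + cut B χ') by abel]
  exact h1.2.2.2.add h2.2.2.2

lemma Conn.eq_zero (hZ : LC Z) (hA : ClosedIn A Z) (hB : B = Z \ A) {b : H (k + 1) B}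
    (h : Conn Z (0 : H k A) b) : b = 0 := by
  obtain ⟨Φ, χ, h1, ha, rfl⟩ := h
  exact mk_eq_zero.2 (h1.cobd hZ hA hB (mk_eq_zero.1 ha.symm))

lemma Conn.unique (hZ : LC Z) (hA : ClosedIn A Z) (hB : B = Z \ A) {a : H k A}
    {b b' : H (k + 1) B} (h : Conn Z a b) (h' : Conn Z a b') : b = b' := by
  have := h.add h'
  rw [a.add_self] at this
  exact H.add_eq_zero.1 (this.eq_zero hZ hA hB)

lemma van_cut_of_disjoint {φ : List X → ZMod 2} (hφ : CC B φ) (h : Disjoint A B) :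
    Van k A (cut B φ) := by
  refine (Van.zero k A).congr fun l _ hl => ?_
  rcases l with _ | ⟨x, l⟩
  · by_cases hB : Inn B ([] : List X)
    · rw [cut_of_inn hB, hφ.nil]; rfl
    · rw [cut_of_not hB]; rfl
  · refine (cut_of_not (fun hB' => ?_) _).symm
    exact disjoint_left.1 h (hl x (by simp)) (hB' x (by simp))

lemma exists_conn_of_ext_eq_zero (hA : ClosedIn A Z) (hB : B = Z \ A) (hB' : OpenIn B Z)
    {b : H (k + 1) B} (h : ext hB' b = 0) : ∃ a : H k A, Conn Z a b := by
  obtain ⟨χ, hχ, rfl⟩ := exists_mk b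
  rw [ext_mk, mk_eq_zero] at h
  obtain ⟨Φ, hΦ, hv⟩ := h
  rw [add_comm (cut B χ)] at hv
  have hd : Disjoint A B := by rw [hB]; exact disjoint_sdiff_right
  have hc : Cocyc k A Φ := by
    refine ⟨hΦ.res hA, ?_⟩
    have := (hv.mono hA.subset).add (van_cut_of_disjoint hχ.1 hd)
    rwa [add_assoc, self_add, add_zero] at this
  exact ⟨mk hc, Φ, χ, ⟨hΦ, hc, hχ, hv⟩, rfl, rfl⟩

lemma Conn.exists_res (hA : ClosedIn A Z) (hB : B = Z \ A) {a : H k A}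
    (h : Conn Z a (0 : H (k + 1) B)) : ∃ c : H k Z, res hA c = a := by
  obtain ⟨Φ, χ, h1, rfl, h0⟩ := h
  obtain ⟨ψ, hψ, hv⟩ := mk_eq_zero.1 h0.symm
  have hB' : OpenIn B Z := by rw [hB]; exact hA.diff
  have hd : Disjoint A B := by rw [hB]; exact disjoint_sdiff_right
  have hc : Cocyc k Z (Φ + cut B ψ) := by
    refine ⟨h1.1.add (hψ.cut hB'.subset), ?_⟩
    have h3 := (h1.2.2.2.add (hv.cut (Z := Z))).add (van_d_cut hB' hψ (k + 1))
    refine h3.congr fun l _ _ => ?_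
    simp only [d_add', cut_add, Pi.add_apply]
    linear_combination add_self_zmod (cut B χ l) + add_self_zmod (cut B (d ψ) l)
  refine ⟨mk hc, ?_⟩
  rw [res_mk, mk_eq_mk]
  refine Van.cobd ((van_cut_of_disjoint hψ hd).congr fun l _ _ => ?_)
  simp only [Pi.add_apply]
  linear_combination - add_self_zmod (Φ l)

lemma exists_ext_of_res_eq_zero (hZ : LC Z) (hA : ClosedIn A Z) (hB : B = Z \ A) (hB' : OpenIn B Z)
    {c : H k Z} (h : res hA c = 0) : ∃ b : H k B, ext hB' b = c := by
  obtain ⟨Φ, hΦ, rfl⟩ := exists_mk c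
  rw [res_mk, mk_eq_zero] at h
  obtain ⟨ω, hω, hc⟩ := exists_cut_of_cobd_res hZ hA hB hΦ h
  exact ⟨mk hω, by rw [ext_mk, eq_comm, mk_eq_mk]; exact hc⟩

lemma Conn.pull {f : X → Y} {Z' A' B' : Set Y} (hf : ProperOn f Z Z') (hA : ProperOn f A A')
    (hB : ProperOn f B B') (hBeq : B = Z ∩ f ⁻¹' B') {a : H k A'} {b : H (k + 1) B'}
    (h : Conn Z' a b) : Conn Z (pull hA a) (pull hB b) := by
  obtain ⟨Φ, χ, h1, rfl, rfl⟩ := h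
  obtain ⟨hΦ, hΦA, hχ, hd⟩ := h1
  refine ⟨_, _, ⟨hΦ.pull hf, hΦA.pull hA, hχ.pull hB, ?_⟩, rfl, rfl⟩
  have hB's : B' ⊆ Z' ∨ True := Or.inr trivial
  refine Van.congr (φ := fun l => (d Φ + cut B' χ) (l.map f)) ?_ fun l _ hl => ?_
  · obtain ⟨K, hKB, hK, hs⟩ := hχ.1.pull hB
    obtain ⟨K', hKZ', hK', hs'⟩ := hΦ.pull hf
    have hs2 : Supp Z (K ∪ K') (fun l => (d Φ + cut B' χ) (l.map f)) := by
      intro l hl hl'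
      have e1 : d Φ (l.map f) = 0 := by
        rw [← d_map]; exact hs'.d l hl fun x hx hxK => hl' x hx (Or.inr hxK)
      have e2 : cut B' χ (l.map f) = 0 := by
        by_cases hlB : Inn B' (l.map f)
        · rw [cut_of_inn hlB]
          refine hs l (fun x hx => ?_) fun x hx hxK => hl' x hx (Or.inl hxK)
          rw [hBeq]; exact ⟨hl x hx, hlB _ (List.mem_map_of_mem hx)⟩
        · exact cut_of_not hlB _
      simp only [Pi.add_apply, e1, e2, add_zero]
    obtain ⟨ε, hε, hv⟩ := hd
    have hKZ : K ∪ K' ⊆ Z :=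
      union_subset (hKB.trans (by rw [hBeq]; exact inter_subset_left)) hKZ'
    obtain ⟨δ, hδ, hd'⟩ := unif_cont hf.cont hKZ (hK.union hK') (half_pos hε)
    refine ⟨δ, hδ, fun l hl hZ hsm => ?_⟩
    by_cases hx : ∃ x ∈ l, x ∈ K ∪ K'
    · obtain ⟨x, hx, hxK⟩ := hx
      refine hv _ (by simpa using hl) ?_ ?_
      · intro y hy
        obtain ⟨x, hx, rfl⟩ := List.mem_map.1 hy
        exact hf.mapsTo x (hZ x hx)
      · intro y hy y' hy'
        obtain ⟨z, hz, rfl⟩ := List.mem_map.1 hy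
        obtain ⟨z', hz', rfl⟩ := List.mem_map.1 hy'
        have h1 := hd' x hxK z (hZ z hz) (hsm x hx z hz)
        have h2 := hd' x hxK z' (hZ z' hz') (hsm x hx z' hz')
        linarith [dist_triangle_left (f z) (f z') (f x)]
    · push Not at hx
      exact hs2 l hZ hx
  · simp only [Pi.add_apply, d_map]
    congr 1
    by_cases hlB : Inn B l
    · rw [cut_of_inn hlB, cut_of_inn]
      intro y hy
      obtain ⟨x, hx, rfl⟩ := List.mem_map.1 hy
      exact hB.mapsTo x (hlB x hx)
    · rw [cut_of_not hlB, cut_of_not]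
      obtain ⟨x, hx, hxU⟩ := not_inn_iff.1 hlB
      refine not_inn_iff.2 ⟨f x, List.mem_map_of_mem hx, fun hfx => hxU ?_⟩
      rw [hBeq]; exact ⟨hl x hx, hfx⟩

lemma Conn.ext {Z' A' B' : Set X} (hZ : OpenIn Z Z') (hA : OpenIn A A') (hB : OpenIn B B')
    (hBZ : B ⊆ Z) {a : H k A} {b : H (k + 1) B} (h : Conn Z a b)
    (hAZ : A = A' ∩ Z) : Conn Z' (ext hA a) (ext hB b) := by
  obtain ⟨Φ, χ, h1, rfl, rfl⟩ := h
  obtain ⟨hΦ, hΦA, hχ, hd⟩ := h1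
  have heq : ∀ l, Inn A' l → cut A Φ l = cut Z Φ l := by
    intro l hl
    by_cases hlZ : Inn Z l
    · rw [cut_of_inn hlZ, cut_of_inn]
      rw [hAZ]; exact fun x hx => ⟨hl x hx, hlZ x hx⟩
    · rw [cut_of_not hlZ, cut_of_not]
      exact fun hA' => hlZ (hA'.mono (by rw [hAZ]; exact inter_subset_right))
  have hc : Cocyc k A' (cut Z Φ) := by
    have h2 := hΦA.cut hA
    refine ⟨h2.1.congr heq, h2.2.congr fun l _ hl => d_congr fun m _ hm => heq m (hl.sub hm)⟩
  refine ⟨cut Z Φ, cut B χ, ⟨hΦ.cut hZ.subset, hc, hχ.cut hB, ?_⟩, ?_, rfl⟩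
  · have h3 := (van_d_cut hZ hΦ (k + 1)).add (hd.cut (Z := Z'))
    refine h3.congr fun l _ _ => ?_
    rw [cut_cut hB.subset, cut_add, cut_cut hBZ]
    simp only [Pi.add_apply]
    linear_combination add_self_zmod (cut Z (d Φ) l)
  · rw [ext_mk]; exact mk_eq_of_inn heq

lemma Conn.shrink {A' B' : Set X} (hA : ClosedIn A' A) (hB : OpenIn B B')
    {a : H k A} {b : H (k + 1) B} (h : Conn Z a b) :
    Conn Z (res hA a) (CompactCohomology.ext hB b) := by
  obtain ⟨Φ, χ, h1, rfl, rfl⟩ := h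
  obtain ⟨hΦ, hΦA, hχ, hd⟩ := h1
  refine ⟨Φ, cut B χ, ⟨hΦ, hΦA.res hA, hχ.cut hB, ?_⟩, res_mk _ _, ext_mk _ _⟩
  rwa [cut_cut hB.subset]

/-! ### Mayer–Vietoris arguments -/

lemma eq_zero_of_res_eq_zero {A' C : Set X} (hZ : LC Z) (hA : ClosedIn A Z) (hA' : ClosedIn A' Z)
    (hU : A ∪ A' = Z) (hC : C = A ∩ A') (h0 : ∀ a : H k C, a = 0) {c : H (k + 1) Z}
    (h : res hA c = 0) (h' : res hA' c = 0) : c = 0 := by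
  obtain ⟨b, rfl⟩ := exists_ext_of_res_eq_zero hZ hA rfl hA.diff h
  have hCA' : ClosedIn C A' := by
    rw [hC]
    have := hA.inter A'
    rwa [inter_eq_right.2 hA'.subset] at this
  have hsub : Z \ A ⊆ A' := by
    rw [← hU]; rintro x ⟨hx | hx, hxA⟩
    exacts [absurd hx hxA, hx]
  have hB : Z \ A = A' \ C := by
    rw [hC]; ext x
    exact ⟨fun hx => ⟨hsub hx, fun h => hx.2 h.1⟩,
      fun hx => ⟨hA'.subset hx.1, fun h => hx.2 ⟨h, hx.1⟩⟩⟩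
  have hBo : OpenIn (Z \ A) A' := by rw [hB]; exact hCA'.diff
  rw [res_ext hA' hA.diff hBo (ClosedIn.refl _) (inter_eq_left.2 hsub).symm, res_refl] at h'
  obtain ⟨a, ha⟩ := exists_conn_of_ext_eq_zero hCA' hB hBo h'
  rw [h0 a] at ha
  rw [ha.eq_zero (hZ.closedIn hA') hCA' hB, map_zero]

lemma exists_ext_add_ext {U V C : Set X} (hZ : LC Z) (hU : OpenIn U Z) (hV : OpenIn V Z)
    (hUV : U ∪ V = Z) (hC : C = U ∩ V) (h0 : ∀ a : H (k + 1) C, a = 0) (c : H k Z) :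
    ∃ (u : H k U) (v : H k V), c = ext hU u + ext hV v := by
  have hA : ClosedIn (Z \ U) Z := hU.diff
  have hsub : Z \ U ⊆ V := by
    rw [← hUV]; rintro x ⟨hx | hx, hxA⟩
    exacts [absurd hx hxA, hx]
  have hAV : ClosedIn (Z \ U) V := hA.restrict hsub hV.subset
  have hC' : C = V \ (Z \ U) := by
    rw [hC]; ext x
    exact ⟨fun h => ⟨h.2, fun h' => h'.2 h.1⟩,
      fun h => ⟨by_contra fun h' => h.2 ⟨hV.subset h.1, h'⟩, h.1⟩⟩
  obtain ⟨b, hb⟩ := exists_conn (hZ.openIn hV) hAV hC' (res hA c)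
  rw [h0 b] at hb
  obtain ⟨v, hv⟩ := hb.exists_res hAV hC'
  have h3 : res hA (c + ext hV v) = 0 := by
    rw [map_add, res_ext hA hV (OpenIn.refl _) hAV (inter_eq_right.2 hsub).symm, ext_refl, hv,
      H.add_self]
  obtain ⟨u, hu⟩ := exists_ext_of_res_eq_zero hZ hA (by
    rw [sdiff_sdiff_right_self]; exact (inter_eq_right.2 hU.subset).symm) hU h3
  exact ⟨u, v, by rw [hu, add_assoc, H.add_self, add_zero]⟩

end Groups

section Acyclic

variable {X Y W : Type*} [MetricSpace X] [MetricSpace Y] [MetricSpace W]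

/-- The group `H k Z` vanishes. -/
def Acyc (k : ℕ) (Z : Set X) : Prop := ∀ c : H k Z, c = 0

/-- The group `H k Z` has exactly two elements. -/
def Rank1 (k : ℕ) (Z : Set X) : Prop := ∃ e : H k Z, e ≠ 0 ∧ ∀ c : H k Z, c = 0 ∨ c = e

lemma Rank1.of_bijective {k k' : ℕ} {Z : Set X} {Z' : Set Y} (f : H k Z →+ H k' Z')
    (hf : Function.Bijective f) (h : Rank1 k Z) : Rank1 k' Z' := by
  obtain ⟨e, he, h⟩ := h
  refine ⟨f e, fun h0 => he (hf.1 (h0.trans (map_zero f).symm)), fun c => ?_⟩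
  obtain ⟨c, rfl⟩ := hf.2 c
  rcases h c with rfl | rfl
  exacts [Or.inl (map_zero f), Or.inr rfl]

lemma Acyc.of_surjective {k k' : ℕ} {Z : Set X} {Z' : Set Y} (f : H k Z →+ H k' Z')
    (hf : Function.Surjective f) (h : Acyc k Z) : Acyc k' Z' := by
  intro c
  obtain ⟨c, rfl⟩ := hf c
  rw [h c, map_zero]

lemma acyc_zero (Z : Set X) : Acyc 0 Z := by
  intro c
  obtain ⟨φ, h, rfl⟩ := exists_mk c
  refine mk_eq_zero.2 (Van.cobd ⟨1, one_pos, fun l hl _ _ => ?_⟩)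
  rw [List.length_eq_zero_iff.1 hl, h.1.nil]

lemma acyc_empty (k : ℕ) : Acyc k (∅ : Set X) := by
  intro c
  obtain ⟨φ, h, rfl⟩ := exists_mk c
  refine mk_eq_zero.2 (Van.cobd ⟨1, one_pos, fun l hl hl' _ => ?_⟩)
  rcases l with _ | ⟨x, l⟩
  · exact h.1.nil
  · exact absurd (hl' x (by simp)) (by simp)

lemma rank1_singleton (p : X) : Rank1 1 ({p} : Set X) := by
  classical
  have hlist : ∀ l : List X, Inn {p} l → l.length = 1 → l = [p] := by
    intro l hl h
    obtain ⟨x, rfl⟩ := List.length_eq_one_iff.1 h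
    rw [show x = p from hl x (by simp)]
  have hd : ∀ φ : List X → ZMod 2, φ [] = 0 → d φ [p] = 0 := fun φ h => by
    simp [d_cons, d_nil, h]
  have h1 : Cocyc 1 {p} (fun l : List X => if l = [] then 0 else (1 : ZMod 2)) := by
    refine ⟨⟨{p}, subset_rfl, isCompact_singleton, fun l hl hl' => ?_⟩, ⟨1, one_pos,
      fun l hl _ _ => ?_⟩⟩
    · rcases l with _ | ⟨x, l⟩
      · simp
      · exact absurd (hl x (by simp)) (hl' x (by simp))
    · obtain ⟨a, b, rfl⟩ := List.length_eq_two.1 hl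
      simp [d_cons, d_nil]
      decide
  refine ⟨mk h1, fun h0 => ?_, fun c => ?_⟩
  · obtain ⟨ψ, hψ, ε, hε, h⟩ := mk_eq_zero.1 h0
    have := h [p] rfl (by simp [Inn]) (by simpa [Small] using hε)
    simp [hd ψ hψ.nil] at this
  · obtain ⟨φ, h, rfl⟩ := exists_mk c
    have hz : φ [p] = 0 ∨ φ [p] = 1 := by
      generalize φ [p] = a; revert a; decide
    rcases hz with hz | hz
    · left
      refine mk_eq_zero.2 (Van.cobd ⟨1, one_pos, fun l hl hl' _ => ?_⟩)
      rw [hlist l hl' hl, hz]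
    · right
      refine mk_eq_mk.2 (Van.cobd ⟨1, one_pos, fun l hl hl' _ => ?_⟩)
      rw [hlist l hl' hl, Pi.add_apply, hz]
      simp
      decide

lemma acyc_singleton (p : X) (k : ℕ) : Acyc (k + 2) ({p} : Set X) := by
  classical
  intro c
  obtain ⟨φ, h, rfl⟩ := exists_mk c
  obtain ⟨ε, hε, hv⟩ := h.2
  refine mk_eq_zero.2 ⟨fun l => if l = [] then 0 else φ (p :: l),
    ⟨{p}, subset_rfl, isCompact_singleton, fun l hl hl' => ?_⟩, ⟨1, one_pos, fun l hl hl' _ => ?_⟩⟩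
  · rcases l with _ | ⟨x, l⟩
    · simp
    · exact absurd (hl x (by simp)) (hl' x (by simp))
  · have h1 := hv (p :: l) (by simp [hl]) (by
      intro x hx
      rcases List.mem_cons.1 hx with rfl | hx
      exacts [rfl, hl' x hx]) (by
      have : ∀ x ∈ p :: l, x = p := by
        intro x hx
        rcases List.mem_cons.1 hx with rfl | hx
        exacts [rfl, hl' x hx]
      intro x hx y hy
      rw [this x hx, this y hy, dist_self]; exact hε)
    rw [d_cons] at h1
    rw [Pi.add_apply, d_congr (ψ := fun l => φ (p :: l)), h1]
    intro m hm _
    rw [if_neg]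
    rintro rfl
    simp [hl] at hm

lemma exists_pull_eq {Z : Set X} (hZ : LC Z) {k : ℕ} (c : H k Z) :
    ∃ δ > 0, ∀ (g : X → X) (hg : ProperOn g Z Z), (∀ z ∈ Z, dist z (g z) < δ) →
      pull hg c = c := by
  obtain ⟨φ, h, rfl⟩ := exists_mk c
  obtain ⟨⟨K, hKZ, hK, hs⟩, ε, hε, hv⟩ := id h
  obtain ⟨η, hη, K', hK'Z, hK', hn⟩ := hZ K hKZ hK
  refine ⟨min η (ε / 4), by positivity, fun g hg hd => ?_⟩
  rw [pull_mk, mk_eq_mk]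
  have hgK : ∀ x ∈ Z, g x ∈ K → x ∈ K' := fun x hx hxK =>
    hn _ hxK x hx (by rw [dist_comm]; exact (hd x hx).trans_le (min_le_left _ _))
  have hidK : ∀ x ∈ Z, x ∈ K → x ∈ K' := fun x hx hxK => hn x hxK x hx (by simpa)
  refine ⟨prism g id φ, ⟨K', hK'Z, hK', fun l hl hl' => ?_⟩,
    ⟨ε / 4, by positivity, fun l hl hlZ hsm => ?_⟩⟩
  · refine prism_eq_zero fun m _ hm => hs m (fun y hy => ?_) fun y hy hyK => ?_
    · obtain ⟨x, hx, rfl | rfl⟩ := hm y hy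
      exacts [hg.mapsTo x (hl x hx), hl _ hx]
    · obtain ⟨x, hx, rfl | rfl⟩ := hm y hy
      exacts [hl' x hx (hgK x (hl x hx) hyK), hl' _ hx (hidK _ (hl _ hx) hyK)]
  · have h3 := d_prism g id φ l
    have h4 : prism g id (d φ) l = 0 := by
      refine prism_eq_zero fun m hm hml => hv m (by omega) (fun y hy => ?_) ?_
      · obtain ⟨x, hx, rfl | rfl⟩ := hml y hy
        exacts [hg.mapsTo x (hlZ x hx), hlZ _ hx]
      · have hnear : ∀ y ∈ m, ∃ x ∈ l, dist x y < ε / 4 := by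
          intro y hy
          obtain ⟨x, hx, rfl | rfl⟩ := hml y hy
          exacts [⟨x, hx, (hd x (hlZ x hx)).trans_le (min_le_right _ _)⟩,
            ⟨_, hx, by simpa using hε⟩]
        intro y hy y' hy'
        obtain ⟨x, hx, hxy⟩ := hnear y hy
        obtain ⟨x', hx', hxy'⟩ := hnear y' hy'
        have := dist_triangle4 y x x' y'
        rw [dist_comm y x] at this
        linarith [hsm x hx x' hx']
    rw [h4, add_zero, List.map_id] at h3
    simp only [Pi.add_apply, h3]
    exact add_self_zmod _

lemma acyc_of_push {Z : Set X} (hZ : LC Z)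
    (h : ∀ δ > 0, ∃ g, ProperOn g Z Z ∧ (∀ z ∈ Z, dist z (g z) < δ) ∧
      ∀ K ⊆ Z, IsCompact K → ∃ n : ℕ, ∀ z ∈ Z, g^[n] z ∉ K) (k : ℕ) : Acyc k Z := by
  intro c
  obtain ⟨δ, hδ, hc⟩ := exists_pull_eq hZ c
  obtain ⟨g, hg, hgd, hgK⟩ := h δ hδ
  have hgn : ∀ n : ℕ, ProperOn g^[n] Z Z := by
    intro n
    induction n with
    | zero => exact ProperOn.id Z
    | succ n ih => exact ih.comp hg
  have hcn : ∀ n : ℕ, pull (hgn n) c = c := by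
    intro n
    induction n with
    | zero => exact pull_of_eq_id _ (fun _ _ => rfl) c
    | succ n ih =>
      have := pull_pull (hgn n) hg (hgn (n + 1)) c
      exact this.symm.trans ((congrArg _ ih).trans (hc g hg hgd))
  obtain ⟨φ, h, rfl⟩ := exists_mk c
  obtain ⟨K, hKZ, hK, hs⟩ := h.1
  obtain ⟨n, hn⟩ := hgK K hKZ hK
  rw [← hcn n, pull_mk, mk_eq_zero]
  refine Van.cobd ⟨1, one_pos, fun l _ hl _ => hs _ ?_ ?_⟩
  · intro y hy
    obtain ⟨x, hx, rfl⟩ := List.mem_map.1 hy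
    exact (hgn n).mapsTo x (hl x hx)
  · intro y hy
    obtain ⟨x, hx, rfl⟩ := List.mem_map.1 hy
    exact hn x (hl x hx)

lemma properOn_of_dist_le [ProperSpace X] {Z : Set X} (hZ : IsClosed Z) {g : X → X}
    (hg : ContinuousOn g Z) (hm : ∀ z ∈ Z, g z ∈ Z) {C : ℝ} (hC : ∀ z ∈ Z, dist z (g z) ≤ C) :
    ProperOn g Z Z := by
  refine ⟨hm, hg, fun K _ hK => ?_⟩
  refine isCompact_of_isClosed_isBounded (hg.preimage_isClosed_of_isClosed hZ hK.isClosed) ?_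
  refine (hK.isBounded.cthickening (δ := C)).subset fun z hz => ?_
  exact mem_cthickening_of_dist_le z (g z) C K hz.2 (hC z hz.1)

lemma exists_compact_forall_res_eq_zero {k : ℕ} {B Z : Set X} (hB : OpenIn B Z) (c : H k B) :
    ∃ K ⊆ B, IsCompact K ∧ ∀ (C : Set X) (hC : ClosedIn C Z), Disjoint C K →
      res hC (ext hB c) = 0 := by
  obtain ⟨φ, h, rfl⟩ := exists_mk c
  obtain ⟨K, hKZ, hK, hs⟩ := h.1
  refine ⟨K, hKZ, hK, fun C hC hd => ?_⟩
  rw [ext_mk, res_mk, mk_eq_zero]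
  refine Van.cobd ⟨1, one_pos, fun l _ hl _ => ?_⟩
  by_cases hlB : Inn B l
  · rw [cut_of_inn hlB]
    exact hs l hlB fun x hx => disjoint_left.1 hd (hl x hx)
  · exact cut_of_not hlB _

section LongExact

variable {k : ℕ} {Z A B : Set X}

lemma rank1_of_conn (hZ : LC Z) (hA : ClosedIn A Z) (hB : B = Z \ A) (h0 : Acyc k Z)
    (h1 : Acyc (k + 1) Z) (h : Rank1 k A) : Rank1 (k + 1) B := by
  have hBo : OpenIn B Z := by rw [hB]; exact hA.diff
  obtain ⟨e, he, h⟩ := h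
  obtain ⟨b, hb⟩ := exists_conn hZ hA hB e
  refine ⟨b, fun hb0 => he ?_, fun b' => ?_⟩
  · rw [hb0] at hb
    obtain ⟨c, rfl⟩ := hb.exists_res hA hB
    rw [h0 c, map_zero]
  · obtain ⟨a, ha⟩ := exists_conn_of_ext_eq_zero hA hB hBo (h1 (ext hBo b'))
    rcases h a with rfl | rfl
    · exact Or.inl (ha.eq_zero hZ hA hB)
    · exact Or.inr (ha.unique hZ hA hB hb)

lemma acyc_of_conn (hZ : LC Z) (hA : ClosedIn A Z) (hB : B = Z \ A)
    (h1 : Acyc (k + 1) Z) (h : Acyc k A) : Acyc (k + 1) B := by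
  have hBo : OpenIn B Z := by rw [hB]; exact hA.diff
  intro b
  obtain ⟨a, ha⟩ := exists_conn_of_ext_eq_zero hA hB hBo (h1 (ext hBo b))
  rw [h a] at ha
  exact ha.eq_zero hZ hA hB

lemma ext_surjective (hZ : LC Z) (hA : ClosedIn A Z) (hB : B = Z \ A) (hBo : OpenIn B Z)
    (h : Acyc k A) : Function.Surjective (ext hBo : H k B →+ H k Z) := fun c =>
  exists_ext_of_res_eq_zero hZ hA hB hBo (h _)

lemma ext_injective (hZ : LC Z) (hA : ClosedIn A Z) (hB : B = Z \ A) (hBo : OpenIn B Z)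
    (h : Acyc k A) : Function.Injective (ext hBo : H (k + 1) B →+ H (k + 1) Z) := by
  rw [injective_iff_map_eq_zero]
  intro b hb
  obtain ⟨a, ha⟩ := exists_conn_of_ext_eq_zero hA hB hBo hb
  rw [h a] at ha
  exact ha.eq_zero hZ hA hB

lemma ext_bijective (hZ : LC Z) (hA : ClosedIn A Z) (hB : B = Z \ A) (hBo : OpenIn B Z)
    (h : ∀ k, Acyc k A) (k : ℕ) : Function.Bijective (ext hBo : H k B →+ H k Z) := by
  refine ⟨?_, ext_surjective hZ hA hB hBo (h k)⟩
  rcases k with _ | k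
  · exact fun a b _ => (acyc_zero B a).trans (acyc_zero B b).symm
  · exact ext_injective hZ hA hB hBo (h k)

end LongExact

end Acyclic

section Euclidean

variable {E : Type*} [NormedAddCommGroup E] [InnerProductSpace ℝ E] [FiniteDimensional ℝ E]

lemma acyc_of_translate {Z : Set E} (hZ : IsClosed Z) {v : E} (hv : ‖v‖ = 1)
    (h0 : ∀ z ∈ Z, 0 ≤ inner ℝ v z) (h1 : ∀ z ∈ Z, ∀ s : ℝ, 0 < s → z + s • v ∈ Z) (k : ℕ) :
    Acyc k Z := by
  have : ProperSpace E := FiniteDimensional.proper ℝ E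
  refine acyc_of_push ((LC.univ).closedIn (ClosedIn.of_isClosed hZ (subset_univ _)))
    (fun δ hδ => ?_) k
  have hd : ∀ z : E, dist z (z + (δ / 2) • v) = δ / 2 := fun z => by
    rw [dist_self_add_right, norm_smul, hv, mul_one, Real.norm_of_nonneg (by positivity)]
  refine ⟨fun z => z + (δ / 2) • v, properOn_of_dist_le hZ (by fun_prop)
    (fun z hz => h1 z hz _ (by positivity)) (C := δ / 2) fun z _ => (hd z).le,
    fun z _ => by rw [hd]; linarith, fun K hKZ hK => ?_⟩
  obtain ⟨R, hR⟩ := hK.isBounded.exists_norm_le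
  obtain ⟨n, hn⟩ := exists_nat_gt (R / (δ / 2))
  have hR' : R < n * (δ / 2) := by rwa [div_lt_iff₀ (by positivity)] at hn
  refine ⟨n, fun z hz hzK => ?_⟩
  have hit : (fun z : E => z + (δ / 2) • v)^[n] z = z + ((n : ℝ) * (δ / 2)) • v := by
    clear hn hzK hR'
    induction n with
    | zero => simp
    | succ n ih =>
      rw [Function.iterate_succ_apply', ih]
      push_cast
      rw [add_assoc, ← add_smul]
      congr 2
      ring
  have h3 := hR _ hzK
  rw [hit] at h3
  have h4 := real_inner_le_norm v (z + ((n : ℝ) * (δ / 2)) • v)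
  rw [inner_add_right, inner_smul_right, real_inner_self_eq_norm_sq, hv] at h4
  linarith [h0 z hz]

lemma acyc_compl_ball {r : ℝ} (hr : 0 < r) (k : ℕ) : Acyc k {x : E | r ≤ ‖x‖} := by
  have : ProperSpace E := FiniteDimensional.proper ℝ E
  have hZ : IsClosed {x : E | r ≤ ‖x‖} := isClosed_le continuous_const continuous_norm
  refine acyc_of_push ((LC.univ).closedIn (ClosedIn.of_isClosed hZ (subset_univ _)))
    (fun δ hδ => ?_) k
  set g : E → E := fun z => z + (δ / 2 * ‖z‖⁻¹) • z with hg
  have hne : ∀ z ∈ {x : E | r ≤ ‖x‖}, ‖z‖ ≠ 0 := fun z hz => (hr.trans_le hz).ne'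
  have hd : ∀ z ∈ {x : E | r ≤ ‖x‖}, dist z (g z) = δ / 2 := fun z hz => by
    rw [hg, dist_self_add_right, norm_smul, norm_mul, norm_inv, norm_norm, mul_assoc,
      inv_mul_cancel₀ (hne z hz), mul_one, Real.norm_of_nonneg (by positivity)]
  have hgn : ∀ z ∈ {x : E | r ≤ ‖x‖}, ‖g z‖ = ‖z‖ + δ / 2 := fun z hz => by
    have : g z = (1 + δ / 2 * ‖z‖⁻¹) • z := by rw [hg, add_smul, one_smul]
    rw [this, norm_smul, Real.norm_of_nonneg (by positivity), add_mul, one_mul, mul_assoc,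
      inv_mul_cancel₀ (hne z hz), mul_one]
  have hm : ∀ z ∈ {x : E | r ≤ ‖x‖}, g z ∈ {x : E | r ≤ ‖x‖} := fun z hz => by
    rw [mem_ofPred_eq, hgn z hz]
    have : r ≤ ‖z‖ := hz
    linarith
  refine ⟨g, properOn_of_dist_le hZ ?_ hm (C := δ / 2) fun z hz => (hd z hz).le,
    fun z hz => by rw [hd z hz]; linarith, fun K hKZ hK => ?_⟩
  · refine continuousOn_id.add (ContinuousOn.smul ?_ continuousOn_id)
    exact continuousOn_const.mul (continuous_norm.continuousOn.inv₀ hne)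
  obtain ⟨R, hR⟩ := hK.isBounded.exists_norm_le
  obtain ⟨n, hn⟩ := exists_nat_gt (R / (δ / 2))
  have hR' : R < n * (δ / 2) := by rwa [div_lt_iff₀ (by positivity)] at hn
  refine ⟨n, fun z hz hzK => ?_⟩
  have hit : g^[n] z ∈ {x : E | r ≤ ‖x‖} ∧ ‖g^[n] z‖ = ‖z‖ + n * (δ / 2) := by
    clear hn hzK hR'
    induction n with
    | zero => exact ⟨hz, by simp⟩
    | succ n ih =>
      rw [Function.iterate_succ_apply']
      refine ⟨hm _ ih.1, ?_⟩
      rw [hgn _ ih.1, ih.2]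
      push_cast
      ring
  have h3 := hR _ hzK
  rw [hit.2] at h3
  linarith [norm_nonneg z]

lemma ext_ball_bijective {r : ℝ} (hr : 0 < r) (k : ℕ) (h : OpenIn (ball (0 : E) r) univ) :
    Function.Bijective (ext h : H k (ball (0 : E) r) →+ H k univ) := by
  have : ProperSpace E := FiniteDimensional.proper ℝ E
  refine ext_bijective LC.univ (A := {x : E | r ≤ ‖x‖}) (ClosedIn.of_isClosed
    (isClosed_le continuous_const continuous_norm) (subset_univ _)) ?_ h
    (fun k => acyc_compl_ball hr k) k
  ext x; simp

end Euclidean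

section Coordinates

variable {n : ℕ}

/-- The coordinate subspace spanned by the first `j` coordinates. -/
def coordSub (n j : ℕ) : Set (EuclideanSpace ℝ (Fin n)) := {x | ∀ i : Fin n, j ≤ i.1 → x i = 0}

lemma isClosed_coordSub (n j : ℕ) : IsClosed (coordSub n j) := by
  have : coordSub n j = ⋂ i : Fin n, {x | j ≤ i.1 → x i = 0} := by ext; simp [coordSub]
  rw [this]
  refine isClosed_iInter fun i => ?_
  by_cases h : j ≤ i.1
  · simp only [h, true_imp_iff]
    exact isClosed_eq (by fun_prop) continuous_const
  · simp [h]

lemma rank1_coordSub (j : ℕ) (hj : j ≤ n) :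
    Rank1 (j + 1) (coordSub n j) ∧ ∀ k, k ≠ j + 1 → Acyc k (coordSub n j) := by
  induction j with
  | zero =>
    have : coordSub n 0 = {0} := by
      ext x; simp only [coordSub, zero_le, true_imp_iff, mem_ofPred_eq, mem_singleton_iff]
      exact ⟨fun h => by ext i; simpa using h i, fun h => by simp [h]⟩
    rw [this]
    refine ⟨rank1_singleton 0, fun k hk => ?_⟩
    rcases k with _ | _ | k
    · exact acyc_zero _
    · exact absurd rfl hk
    · exact acyc_singleton 0 k
  | succ j ih =>
    obtain ⟨ih1, ih2⟩ := ih (by omega)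
    set i : Fin n := ⟨j, by omega⟩ with hi
    set v : EuclideanSpace ℝ (Fin n) := EuclideanSpace.single i 1 with hv
    have hvn : ‖v‖ = 1 := by simp [hv]
    have hvi : ∀ z : EuclideanSpace ℝ (Fin n), inner ℝ v z = z i := fun z => by
      rw [hv, EuclideanSpace.inner_single_left]; simp
    set Z := coordSub n (j + 1) with hZ
    have hZc : IsClosed Z := isClosed_coordSub n (j + 1)
    have hadd : ∀ z ∈ Z, ∀ s : ℝ, z + s • v ∈ Z := by
      intro z hz s i' hi'
      have : i' ≠ i := by rintro rfl; simp [hi] at hi'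
      simp [hv, hz i' hi', this]
    have hci : Continuous fun x : EuclideanSpace ℝ (Fin n) => x i := by fun_prop
    set P := Z ∩ {x | 0 ≤ x i} with hP
    set Q := Z ∩ {x | x i ≤ 0} with hQ
    have hPc : IsClosed P := hZc.inter (isClosed_le continuous_const hci)
    have hQc : IsClosed Q := hZc.inter (isClosed_le hci continuous_const)
    have hPa : ∀ k, Acyc k P := acyc_of_translate hPc hvn (fun z hz => by rw [hvi]; exact hz.2)
      fun z hz s hs => ⟨hadd z hz.1 s, by
        have : 0 ≤ z i := hz.2
        simp [hv]; positivity⟩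
    have hQa : ∀ k, Acyc k Q := acyc_of_translate hQc (v := -v) (by rwa [norm_neg])
      (fun z hz => by rw [inner_neg_left, hvi]; exact neg_nonneg.2 hz.2)
      fun z hz s hs => ⟨by rw [smul_neg, ← neg_smul]; exact hadd z hz.1 _, by
        have : z i ≤ 0 := hz.2
        simp [hv]; linarith⟩
    have lcP : LC P := LC.univ.closedIn (ClosedIn.of_isClosed hPc (subset_univ _))
    have lcZ : LC Z := LC.univ.closedIn (ClosedIn.of_isClosed hZc (subset_univ _))
    have hA : ClosedIn (coordSub n j) P := by
      refine ClosedIn.of_isClosed (isClosed_coordSub n j) fun x hx => ⟨fun i' hi' => hx i' (by omega), ?_⟩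
      rw [mem_ofPred_eq, hx i le_rfl]
    have hPA : P \ coordSub n j = Z \ Q := by
      ext x
      constructor
      · rintro ⟨hx, hx'⟩
        refine ⟨hx.1, fun h => hx' fun i' hi' => ?_⟩
        rcases hi'.eq_or_lt with h1 | h1
        · have : i' = i := Fin.ext h1.symm
          rw [this]; exact le_antisymm h.2 hx.2
        · exact hx.1 i' h1
      · rintro ⟨hx, hx'⟩
        have : 0 < x i := by
          by_contra h; exact hx' ⟨hx, not_lt.1 h⟩
        exact ⟨⟨hx, this.le⟩, fun h => this.ne' (h i le_rfl)⟩
    have hQZ : ClosedIn Q Z := ClosedIn.of_isClosed hQc inter_subset_left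
    have hbij := ext_bijective lcZ hQZ rfl hQZ.diff hQa
    refine ⟨?_, fun k hk => ?_⟩
    · have := rank1_of_conn lcP hA hPA.symm (hPa _) (hPa _) ih1
      exact this.of_bijective _ (hbij _)
    · rcases k with _ | k
      · exact acyc_zero _
      · have := acyc_of_conn lcP hA hPA.symm (hPa _) (ih2 k (by omega))
        exact this.of_surjective _ (hbij _).2

lemma rank1_euclidean (n : ℕ) : Rank1 (n + 1) (univ : Set (EuclideanSpace ℝ (Fin n))) := by
  have := (rank1_coordSub n (le_refl n)).1
  rwa [show coordSub n n = univ by ext x; simp [coordSub]] at this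

lemma acyc_euclidean (n : ℕ) {k : ℕ} (hk : k ≠ n + 1) :
    Acyc k (univ : Set (EuclideanSpace ℝ (Fin n))) := by
  have := (rank1_coordSub n (le_refl n)).2 k hk
  rwa [show coordSub n n = univ by ext x; simp [coordSub]] at this

lemma acyc_of_coords (S : Finset (Fin n)) {Z : Set (EuclideanSpace ℝ (Fin n))} (hZ : LC Z)
    (h : ∀ i, i ∉ S → ∀ x ∈ Z, ∀ y ∈ Z, x i = y i) {k : ℕ} (hk : S.card + 1 < k) : Acyc k Z := by
  classical
  induction S using Finset.induction_on generalizing Z k with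
  | empty =>
    rcases Z.eq_empty_or_nonempty with rfl | ⟨p, hp⟩
    · exact acyc_empty k
    · have : Z = {p} := by
        ext x; refine ⟨fun hx => ?_, fun hx => by rw [hx]; exact hp⟩
        ext i; exact h i (by simp) x hx p hp
      rw [this]
      obtain ⟨k, rfl⟩ : ∃ k', k = k' + 2 := ⟨k - 2, by simp at hk; omega⟩
      exact acyc_singleton p k
  | insert i S hi ih =>
    rw [Finset.card_insert_of_notMem hi] at hk
    obtain ⟨k, rfl⟩ : ∃ k', k = k' + 1 := ⟨k - 1, by omega⟩
    have hci : Continuous fun x : EuclideanSpace ℝ (Fin n) => x i := by fun_prop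
    have hcl : ∀ C : Set ℝ, IsClosed C → ClosedIn (Z ∩ (fun x => x i) ⁻¹' C) Z :=
      fun C hC => ⟨_, hC.preimage hci, rfl⟩
    have hslice : ∀ t : ℝ, ∀ k, S.card + 1 < k → Acyc k (Z ∩ (fun x => x i) ⁻¹' {t}) := by
      intro t k hk
      refine ih (hZ.closedIn (hcl {t} isClosed_singleton)) (fun i' hi' x hx y hy => ?_) hk
      by_cases hii : i' = i
      · rw [hii, show x i = t from hx.2, show y i = t from hy.2]
      · exact h i' (by simp [hi', hii]) x hx.1 y hy.1
    -- gluing along a slice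
    have hglue : ∀ (C₁ C₂ : Set ℝ) (h₁ : IsClosed C₁) (h₂ : IsClosed C₂) (t : ℝ), C₁ ∩ C₂ = {t} →
        ∀ (h₁₂ : IsClosed (C₁ ∪ C₂)) (c : H (k + 1) Z), res (hcl C₁ h₁) c = 0 →
        res (hcl C₂ h₂) c = 0 → res (hcl (C₁ ∪ C₂) h₁₂) c = 0 := by
      intro C₁ C₂ h₁ h₂ t ht h₁₂ c hc₁ hc₂
      have hsub : ∀ C ⊆ C₁ ∪ C₂, IsClosed C → ClosedIn (Z ∩ (fun x => x i) ⁻¹' C)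
          (Z ∩ (fun x => x i) ⁻¹' (C₁ ∪ C₂)) := fun C hC hC' =>
        (hcl C hC').restrict (inter_subset_inter_right _ (preimage_mono hC)) inter_subset_left
      refine eq_zero_of_res_eq_zero (hZ.closedIn (hcl _ h₁₂)) (hsub C₁ subset_union_left h₁)
        (hsub C₂ subset_union_right h₂) ?_ (C := Z ∩ (fun x => x i) ⁻¹' {t}) ?_
        (hslice t k (by omega)) ?_ ?_
      · rw [preimage_union, inter_union_distrib_left]
      · rw [← ht]; ext x; simp; tauto
      · rw [res_res _ _ (hcl C₁ h₁)]; exact hc₁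
      · rw [res_res _ _ (hcl C₂ h₂)]; exact hc₂
    intro c
    have hmono : ∀ (C₁ C₂ : Set ℝ) (h₁ : IsClosed C₁) (h₂ : IsClosed C₂), C₁ ⊆ C₂ →
        res (hcl C₂ h₂) c = 0 → res (hcl C₁ h₁) c = 0 := by
      intro C₁ C₂ h₁ h₂ hsub hc
      have h3 : ClosedIn (Z ∩ (fun x => x i) ⁻¹' C₁) (Z ∩ (fun x => x i) ⁻¹' C₂) :=
        (hcl C₁ h₁).restrict (inter_subset_inter_right _ (preimage_mono hsub)) inter_subset_left
      rw [← res_res h3 (hcl C₂ h₂) (hcl C₁ h₁), hc, map_zero]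
    have hlocal : ∀ t : ℝ, ∃ δ > 0, res (hcl (Icc (t - δ) (t + δ)) isClosed_Icc) c = 0 := by
      intro t
      have hA := hcl {t} isClosed_singleton
      obtain ⟨b, hb⟩ := exists_ext_of_res_eq_zero hZ hA rfl hA.diff
        (hslice t (k + 1) (by omega) (res hA c))
      obtain ⟨K, hKB, hK, hKc⟩ := exists_compact_forall_res_eq_zero hA.diff b
      have him : IsClosed ((fun x : EuclideanSpace ℝ (Fin n) => x i) '' K) :=
        (hK.image hci).isClosed
      have ht : t ∉ (fun x : EuclideanSpace ℝ (Fin n) => x i) '' K := by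
        rintro ⟨x, hx, rfl⟩
        exact (hKB hx).2 ⟨(hKB hx).1, rfl⟩
      obtain ⟨δ, hδ, hball⟩ := Metric.isOpen_iff.1 him.isOpen_compl t ht
      refine ⟨δ / 2, by positivity, ?_⟩
      rw [← hb]
      refine hKc _ _ (disjoint_left.2 fun x hx hxK => ?_)
      refine hball (a := x i) ?_ ⟨x, hxK, rfl⟩
      rw [Metric.mem_ball, Real.dist_eq, abs_lt]
      have := hx.2
      simp only [mem_preimage, mem_Icc] at this
      constructor <;> linarith
    obtain ⟨K, hKZ, hK, hKc⟩ := exists_compact_forall_res_eq_zero (OpenIn.refl Z) c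
    rw [ext_refl] at hKc
    obtain ⟨R, hR⟩ := (hK.image hci).isBounded.exists_norm_le
    have hKc' : ∀ C (hC : IsClosed C), (∀ t ∈ C, R < |t|) → res (hcl C hC) c = 0 := by
      intro C hC h
      refine hKc _ _ (disjoint_left.2 fun x hx hxK => ?_)
      exact absurd (hR _ ⟨x, hxK, rfl⟩) (not_le.2 (h _ hx.2))
    have hall : ∀ t : ℝ, res (hcl (Iic t) isClosed_Iic) c = 0 := by
      by_contra! hcon
      obtain ⟨t₀, ht₀⟩ := hcon
      set T : Set ℝ := {t | res (hcl (Iic t) isClosed_Iic) c = 0} with hT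
      have hne : T.Nonempty := by
        refine ⟨-(|R| + 1), hKc' _ isClosed_Iic fun t ht => ?_⟩
        have h1 : t ≤ -(|R| + 1) := ht
        have h2 := neg_abs_le t
        linarith [le_abs_self R, abs_nonneg R]
      have hdown : ∀ s ∈ T, ∀ t ≤ s, t ∈ T := fun s hs t ht =>
        hmono _ _ isClosed_Iic isClosed_Iic (Iic_subset_Iic.2 ht) hs
      have hbdd : BddAbove T := ⟨t₀, fun s hs => by
        by_contra h; exact ht₀ (hdown s hs t₀ (not_le.1 h).le)⟩
      obtain ⟨δ, hδ, hδc⟩ := hlocal (sSup T)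
      obtain ⟨s, hs, hs'⟩ := exists_lt_of_lt_csSup hne (show sSup T - δ < sSup T by linarith)
      have hsle : s ≤ sSup T := le_csSup hbdd hs
      have hmem : sSup T + δ ∈ T := by
        have h1 := hmono (Icc s (sSup T + δ)) _ isClosed_Icc isClosed_Icc
          (Icc_subset_Icc hs'.le le_rfl) hδc
        have hu : Iic s ∪ Icc s (sSup T + δ) = Iic (sSup T + δ) :=
          Iic_union_Icc_eq_Iic (by linarith)
        have h2 := hglue (Iic s) (Icc s (sSup T + δ)) isClosed_Iic isClosed_Icc s
          (by ext x; simp only [mem_inter_iff, mem_Iic, mem_Icc, mem_singleton_iff]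
              exact ⟨fun h => le_antisymm h.1 h.2.1,
                fun h => by rw [h]; exact ⟨le_rfl, le_rfl, by linarith⟩⟩)
          (by rw [hu]; exact isClosed_Iic) c hs h1
        exact hmono _ _ isClosed_Iic (by rw [hu]; exact isClosed_Iic) hu.ge h2
      linarith [le_csSup hbdd hmem]
    have hfin := hglue (Iic (|R| + 1)) (Ici (|R| + 1)) isClosed_Iic isClosed_Ici (|R| + 1)
      (by ext x; simp only [mem_inter_iff, mem_Iic, mem_Ici, mem_singleton_iff]
          exact ⟨fun h => le_antisymm h.1 h.2, fun h => by rw [h]; exact ⟨le_rfl, le_rfl⟩⟩)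
      (by rw [Iic_union_Ici]; exact isClosed_univ) c (hall _)
      (hKc' _ isClosed_Ici fun t ht => by
        have h1 : |R| + 1 ≤ t := ht
        linarith [le_abs_self R, le_abs_self t])
    have : Z ∩ (fun x : EuclideanSpace ℝ (Fin n) => x i) ⁻¹' (Iic (|R| + 1) ∪ Ici (|R| + 1)) = Z := by
      rw [Iic_union_Ici]; simp
    have key : ∀ (Z' : Set (EuclideanSpace ℝ (Fin n))) (hZ' : ClosedIn Z' Z), Z' = Z →
        res hZ' c = 0 → c = 0 := by
      rintro Z' hZ' rfl h0
      rwa [res_refl] at h0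
    exact key _ _ this hfin

/-- Cohomological dimension of locally compact subsets of Euclidean space. -/
lemma acyc_of_lt {Z : Set (EuclideanSpace ℝ (Fin n))} (hZ : LC Z) {k : ℕ} (hk : n + 1 < k) :
    Acyc k Z :=
  acyc_of_coords Finset.univ hZ (by simp) (by simpa using hk)

end Coordinates

section Homeomorphisms

variable {X Y W : Type*} [MetricSpace X] [MetricSpace Y] [MetricSpace W]

/-- `f` and `g` restrict to mutually inverse homeomorphisms between `Z` and `Z'`. -/
structure HomOn (f : X → Y) (g : Y → X) (Z : Set X) (Z' : Set Y) : Prop where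
  mapsTo : ∀ x ∈ Z, f x ∈ Z'
  mapsTo' : ∀ y ∈ Z', g y ∈ Z
  cont : ContinuousOn f Z
  cont' : ContinuousOn g Z'
  left : ∀ x ∈ Z, g (f x) = x
  right : ∀ y ∈ Z', f (g y) = y

variable {f : X → Y} {g : Y → X} {Z : Set X} {Z' : Set Y}

lemma HomOn.symm (h : HomOn f g Z Z') : HomOn g f Z' Z :=
  ⟨h.mapsTo', h.mapsTo, h.cont', h.cont, h.right, h.left⟩

lemma HomOn.properOn (h : HomOn f g Z Z') : ProperOn f Z Z' := by
  refine ⟨h.mapsTo, h.cont, fun K hK hc => ?_⟩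
  have : Z ∩ f ⁻¹' K = g '' K := by
    ext x
    constructor
    · rintro ⟨hx, hx'⟩
      exact ⟨f x, hx', h.left x hx⟩
    · rintro ⟨y, hy, rfl⟩
      exact ⟨h.mapsTo' y (hK hy), by rw [mem_preimage, h.right y (hK hy)]; exact hy⟩
  rw [this]
  exact hc.image_of_continuousOn (h.cont'.mono hK)

lemma HomOn.restrict (h : HomOn f g Z Z') {U : Set X} {U' : Set Y} (hU' : U' ⊆ Z')
    (hU : U = Z ∩ f ⁻¹' U') : HomOn f g U U' := by
  subst hU
  refine ⟨fun x hx => hx.2, fun y hy => ⟨h.mapsTo' y (hU' hy), ?_⟩, h.cont.mono inter_subset_left,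
    h.cont'.mono hU', fun x hx => h.left x hx.1, fun y hy => h.right y (hU' hy)⟩
  rw [mem_preimage, h.right y (hU' hy)]; exact hy

lemma HomOn.image (h : HomOn f g Z Z') {U : Set X} (hU : U ⊆ Z) : HomOn f g U (f '' U) := by
  refine h.restrict (by rintro _ ⟨x, hx, rfl⟩; exact h.mapsTo x (hU hx)) ?_
  ext x
  constructor
  · exact fun hx => ⟨hU hx, x, hx, rfl⟩
  · rintro ⟨hx, x', hx', hxx⟩
    rw [← h.left x hx, ← hxx, h.left x' (hU hx')]; exact hx'

lemma HomOn.pull_bijective (h : HomOn f g Z Z') (k : ℕ) :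
    Function.Bijective (pull h.properOn : H k Z' →+ H k Z) :=
  Function.bijective_iff_has_inverse.2 ⟨pull h.symm.properOn,
    fun c => pull_eq_of_comp_id _ _ h.right c, fun c => pull_eq_of_comp_id _ _ h.left c⟩

lemma HomOn.acyc (h : HomOn f g Z Z') {k : ℕ} (hk : Acyc k Z') : Acyc k Z :=
  hk.of_surjective _ (h.pull_bijective k).2

lemma HomOn.lc (h : HomOn f g Z Z') (hZ : LC Z') : LC Z := by
  intro K hKZ hK
  obtain ⟨η, hη, K', hK'Z, hK', hn⟩ := hZ (f '' K)
    (by rintro _ ⟨x, hx, rfl⟩; exact h.mapsTo x (hKZ hx)) (hK.image_of_continuousOn (h.cont.mono hKZ))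
  obtain ⟨δ, hδ, hd⟩ := unif_cont h.cont hKZ hK hη
  refine ⟨δ, hδ, g '' K', ?_, hK'.image_of_continuousOn (h.cont'.mono hK'Z), ?_⟩
  · rintro _ ⟨y, hy, rfl⟩; exact h.mapsTo' y (hK'Z hy)
  · intro x hx z hz hxz
    exact ⟨f z, hn (f x) ⟨x, hx, rfl⟩ (f z) (h.mapsTo z hz) (hd x hx z hz hxz), h.left z hz⟩

lemma HomOn.of_properOn [Nonempty X] (hf : ProperOn f Z Z') (hinj : InjOn f Z)
    (hsurj : ∀ y ∈ Z', ∃ x ∈ Z, f x = y) : ∃ g, HomOn f g Z Z' := by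
  choose! g hg hfg using hsurj
  have hl : ∀ x ∈ Z, g (f x) = x := fun x hx =>
    hinj (hg _ (hf.mapsTo x hx)) hx (hfg _ (hf.mapsTo x hx))
  refine ⟨g, hf.mapsTo, hg, hf.cont, ?_, hl, hfg⟩
  intro y hy
  rw [Metric.continuousWithinAt_iff]
  by_contra! hcon
  obtain ⟨ε, hε, hcon⟩ := hcon
  choose u hu huy hgu using fun n : ℕ => hcon (1 / ((n : ℝ) + 1)) (by positivity)
  have hlim : Filter.Tendsto u Filter.atTop (nhds y) := by
    rw [tendsto_iff_dist_tendsto_zero]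
    exact squeeze_zero (fun _ => dist_nonneg) (fun n => (huy n).le)
      tendsto_one_div_add_atTop_nhds_zero_nat
  have hK := hf.compact (insert y (range u))
    (by rintro _ (rfl | ⟨n, rfl⟩); exacts [hy, hu n]) hlim.isCompact_insert_range
  obtain ⟨x, hx, φ, hφ, hxl⟩ := hK.tendsto_subseq (x := fun n => g (u n))
    fun n => ⟨hg _ (hu n), by rw [mem_preimage, hfg _ (hu n)]; exact Or.inr ⟨n, rfl⟩⟩
  have h1 : Filter.Tendsto (fun n => f (g (u (φ n)))) Filter.atTop (nhds (f x)) :=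
    (hf.cont x hx.1).tendsto.comp (tendsto_nhdsWithin_iff.2
      ⟨hxl, Filter.Eventually.of_forall fun n => hg _ (hu _)⟩)
  have h2 : (fun n => f (g (u (φ n)))) = u ∘ φ := by
    ext n; exact hfg _ (hu _)
  rw [h2] at h1
  have h3 : f x = y := tendsto_nhds_unique h1 (hlim.comp hφ.tendsto_atTop)
  have h4 : x = g y := by rw [← h3, hl x hx.1]
  obtain ⟨n, hn⟩ := ((tendsto_iff_dist_tendsto_zero.1 hxl).eventually (gt_mem_nhds hε)).exists
  exact absurd hn (not_lt.2 (by rw [h4]; exact hgu (φ n)))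

lemma HomOn.of_isCompact [Nonempty X] (hZ : IsCompact Z) (hf : ContinuousOn f Z) (hinj : InjOn f Z) :
    ∃ g, HomOn f g Z (f '' Z) :=
  HomOn.of_properOn (ProperOn.of_isCompact hZ hf fun x hx => ⟨x, hx, rfl⟩) hinj
    (by rintro _ ⟨x, hx, rfl⟩; exact ⟨x, hx, rfl⟩)

end Homeomorphisms

/-- The standard sphere. -/
abbrev Sph (n : ℕ) : Type := sphere (0 : EuclideanSpace ℝ (Fin (n + 1))) 1

section Spheres

variable {n : ℕ}

instance (n : ℕ) : Nonempty (Sph n) :=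
  (NormedSpace.sphere_nonempty.2 zero_le_one).to_subtype

lemma exists_chart (v : Sph n) : ∃ (f : Sph n → EuclideanSpace ℝ (Fin n))
    (g : EuclideanSpace ℝ (Fin n) → Sph n), HomOn f g {v}ᶜ univ := by
  have := Fact.mk (finrank_euclideanSpace_fin (𝕜 := ℝ) (n := n + 1))
  let φ := stereographic' n v
  have hs : φ.source = {v}ᶜ := stereographic'_source v
  have ht : φ.target = univ := stereographic'_target v
  refine ⟨φ, φ.symm, fun x _ => mem_univ _, fun y _ => ?_, ?_, ?_, ?_, ?_⟩
  · rw [← hs]; exact φ.map_target (by rw [ht]; exact mem_univ _)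
  · rw [← hs]; exact φ.continuousOn
  · rw [← ht]; exact φ.continuousOn_symm
  · rw [← hs]; exact fun x hx => φ.left_inv hx
  · rw [← ht]; exact fun x hx => φ.right_inv hx

lemma exists_chart_zero (p : Sph n) : ∃ (v : Sph n) (f : Sph n → EuclideanSpace ℝ (Fin n))
    (g : EuclideanSpace ℝ (Fin n) → Sph n), HomOn f g {v}ᶜ univ ∧ p ≠ v ∧ f p = 0 := by
  obtain ⟨f, g, h⟩ := exists_chart (-p)
  have hp : p ≠ -p := ne_neg_of_mem_unit_sphere ℝ p
  refine ⟨-p, fun x => f x - f p, fun e => g (e + f p), ⟨fun x _ => mem_univ _,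
    fun y _ => h.mapsTo' _ (mem_univ _), h.cont.sub continuousOn_const, ?_, fun x hx => ?_,
    fun y hy => ?_⟩, hp, sub_self _⟩
  · exact h.cont'.comp (by fun_prop) (fun _ _ => mem_univ _)
  · simpa using h.left x hx
  · simp [h.right _ (mem_univ _)]

/-- Cohomological dimension of locally compact subsets of the sphere. -/
lemma acyc_sphere_of_lt {Z : Set (Sph n)} (hZ : LC Z) {k : ℕ} (hk : n + 1 < k) : Acyc k Z := by
  obtain ⟨v⟩ : Nonempty (Sph n) := inferInstance
  obtain ⟨f, g, h⟩ := exists_chart v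
  have hA : ClosedIn (Z ∩ {v}) Z := ⟨{v}, isClosed_singleton, rfl⟩
  have hB : Z \ (Z ∩ {v}) ⊆ {v}ᶜ := fun x hx hxv => hx.2 ⟨hx.1, hxv⟩
  intro c
  obtain ⟨k, rfl⟩ : ∃ k', k = k' + 2 := ⟨k - 2, by omega⟩
  have hAc : Acyc (k + 2) (Z ∩ {v}) := by
    rcases (subset_singleton_iff_eq.1 (inter_subset_right : Z ∩ {v} ⊆ {v})) with h0 | h0
    · rw [h0]; exact acyc_empty _
    · rw [h0]; exact acyc_singleton _ _
  obtain ⟨b, rfl⟩ := exists_ext_of_res_eq_zero hZ hA rfl hA.diff (hAc (res hA c))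
  have h' := h.image hB
  have : Acyc (k + 2) (Z \ (Z ∩ {v})) :=
    h'.acyc (acyc_of_lt (h'.symm.lc (hZ.openIn hA.diff)) hk)
  rw [this b, map_zero]

end Spheres

section Cells

variable {n : ℕ}

/-- Total class of a compactly supported top-dimensional class on an open subset of the sphere. -/
noncomputable def eps {k : ℕ} {U : Set (Sph n)} (hU : IsOpen U) :
    H k U →+ H k (univ : Set (Sph n)) := ext (OpenIn.of_isOpen hU (subset_univ U))

lemma eps_ext {k : ℕ} {U V : Set (Sph n)} (hU : IsOpen U) (hV : IsOpen V) (h : OpenIn U V)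
    (c : H k U) : eps hV (ext h c) = eps hU c := ext_ext _ _ _ c

/-- An open set that looks like an open ball. -/
structure IsCell (b : Set (Sph n)) : Prop where
  isOpen : IsOpen b
  preconn : IsPreconnected b
  acyc : Acyc n b
  bij : Function.Bijective (eps isOpen : H (n + 1) b →+ H (n + 1) (univ : Set (Sph n)))

variable [hn : Fact (2 ≤ n)]

lemma ext_compl_point (v : Sph n) :
    Function.Bijective (eps isOpen_compl_singleton : H (n + 1) ({v}ᶜ : Set (Sph n)) →+ _) := by
  have h2 := hn.out
  obtain ⟨k, rfl⟩ : ∃ k, n = k + 2 := ⟨n - 2, by omega⟩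
  have hA : ClosedIn {v} (univ : Set (Sph (k + 2))) :=
    ClosedIn.of_isClosed isClosed_singleton (subset_univ _)
  have hB : ({v}ᶜ : Set (Sph (k + 2))) = univ \ {v} := compl_eq_univ_sdiff _
  have hZ : LC (univ : Set (Sph (k + 2))) := LC.of_isCompact isCompact_univ
  exact ⟨ext_injective hZ hA hB _ (acyc_singleton v k),
    ext_surjective hZ hA hB _ (acyc_singleton v (k + 1))⟩

lemma rank1_sphere : Rank1 (n + 1) (univ : Set (Sph n)) := by
  obtain ⟨v⟩ : Nonempty (Sph n) := inferInstance
  obtain ⟨f, g, h⟩ := exists_chart v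
  exact ((rank1_euclidean n).of_bijective _ (h.pull_bijective _)).of_bijective _ (ext_compl_point v)

lemma acyc_two_sphere : Acyc 2 (univ : Set (Sph n)) := by
  have h2 := hn.out
  obtain ⟨v⟩ : Nonempty (Sph n) := inferInstance
  obtain ⟨f, g, h⟩ := exists_chart v
  have h3 : Acyc 2 ({v}ᶜ : Set (Sph n)) := h.acyc (acyc_euclidean n (by omega))
  have hA : ClosedIn {v} (univ : Set (Sph n)) :=
    ClosedIn.of_isClosed isClosed_singleton (subset_univ _)
  have hB : ({v}ᶜ : Set (Sph n)) = univ \ {v} := compl_eq_univ_sdiff _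
  exact h3.of_surjective _ (ext_surjective (LC.of_isCompact isCompact_univ) hA hB
    (OpenIn.of_isOpen isOpen_compl_singleton (subset_univ _)) (acyc_singleton v 0))

lemma exists_cell {p : Sph n} {U : Set (Sph n)} (hU : IsOpen U) (hp : p ∈ U) :
    ∃ b, IsCell b ∧ p ∈ b ∧ b ⊆ U := by
  have h2 := hn.out
  obtain ⟨v, f, g, h, hpv, hp0⟩ := exists_chart_zero p
  have hg : Continuous g := continuousOn_univ.1 h.cont'
  have hg0 : g 0 = p := by rw [← hp0]; exact h.left p hpv
  obtain ⟨r, hr, hrU⟩ := Metric.isOpen_iff.1 (hU.preimage hg) 0 (by rw [mem_preimage, hg0]; exact hp)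
  set b : Set (Sph n) := {v}ᶜ ∩ f ⁻¹' ball 0 r with hb
  have hbo : IsOpen b := h.cont.isOpen_inter_preimage isOpen_compl_singleton isOpen_ball
  have hbh : HomOn f g b (ball 0 r) := h.restrict (subset_univ _) rfl
  have hbg : b = g '' ball 0 r := by
    ext x
    constructor
    · exact fun hx => ⟨f x, hx.2, hbh.left x hx⟩
    · rintro ⟨y, hy, rfl⟩; exact hbh.mapsTo' y hy
  have hballo : OpenIn (ball (0 : EuclideanSpace ℝ (Fin n)) r) univ :=
    OpenIn.of_isOpen isOpen_ball (subset_univ _)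
  have hacyc : Acyc n (ball (0 : EuclideanSpace ℝ (Fin n)) r) := by
    intro c
    exact (ext_ball_bijective hr n hballo).1
      ((acyc_euclidean n (by omega) _).trans (acyc_euclidean n (by omega) _).symm)
  refine ⟨b, ⟨hbo, ?_, hbh.acyc hacyc, ?_⟩, ⟨hpv, ?_⟩, ?_⟩
  · rw [hbg]; exact (convex_ball _ _).isPreconnected.image _ hg.continuousOn
  · have hbv : OpenIn b {v}ᶜ := OpenIn.of_isOpen hbo inter_subset_left
    have h1 : Function.Bijective (ext hbv : H (n + 1) b →+ _) := by
      rw [← Function.Bijective.of_comp_iff _ (hbh.pull_bijective (n + 1))]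
      have : (ext hbv : H (n + 1) b →+ _) ∘ (pull hbh.properOn) =
          (pull h.properOn) ∘ (ext hballo) := by
        funext c
        exact (pull_ext h.properOn hballo hbv hbh.properOn rfl c).symm
      rw [this]
      exact (h.pull_bijective _).comp (ext_ball_bijective hr _ hballo)
    have : (eps hbo : H (n + 1) b →+ H (n + 1) univ) =
        (eps isOpen_compl_singleton : H (n + 1) ({v}ᶜ : Set (Sph n)) →+ _).comp (ext hbv) := by
      ext c; exact (eps_ext hbo isOpen_compl_singleton hbv c).symm
    rw [this]
    exact (ext_compl_point v).comp h1
  · rw [mem_preimage, hp0]; exact mem_ball_self hr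
  · rw [hbg]; rintro _ ⟨y, hy, rfl⟩; exact hrU hy

/-- The generator of top-dimensional cohomology. -/
noncomputable def gen (n : ℕ) [Fact (2 ≤ n)] : H (n + 1) (univ : Set (Sph n)) :=
  rank1_sphere.choose

lemma gen_ne_zero : gen n ≠ 0 := rank1_sphere.choose_spec.1

lemma eq_zero_or_gen (c : H (n + 1) (univ : Set (Sph n))) : c = 0 ∨ c = gen n :=
  rank1_sphere.choose_spec.2 c

open Classical in
/-- The class of a point in an open subset of the sphere. -/
noncomputable def cls (U : Set (Sph n)) (z : Sph n) : H (n + 1) U :=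
  if h : IsOpen U ∧ z ∈ U then
    ext (OpenIn.of_isOpen (exists_cell h.1 h.2).choose_spec.1.isOpen
      (exists_cell h.1 h.2).choose_spec.2.2)
      ((exists_cell h.1 h.2).choose_spec.1.bij.2 (gen n)).choose
  else 0

variable {U V b : Set (Sph n)} {z w : Sph n}

lemma exists_cls (hU : IsOpen U) (hz : z ∈ U) : ∃ b, ∃ hb : IsCell b, ∃ hbU : b ⊆ U, z ∈ b ∧
    ∃ c : H (n + 1) b, eps hb.isOpen c = gen n ∧ ext (OpenIn.of_isOpen hb.isOpen hbU) c = cls U z := by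
  refine ⟨_, (exists_cell hU hz).choose_spec.1, (exists_cell hU hz).choose_spec.2.2,
    (exists_cell hU hz).choose_spec.2.1, _,
    ((exists_cell hU hz).choose_spec.1.bij.2 (gen n)).choose_spec, ?_⟩
  rw [cls, dif_pos ⟨hU, hz⟩]

lemma ext_eq_cls (hU : IsOpen U) (hb : IsCell b) (hbU : OpenIn b U) (hz : z ∈ b) {c : H (n + 1) b}
    (hc : eps hb.isOpen c = gen n) : ext hbU c = cls U z := by
  obtain ⟨b', hb', hbU', hz', c', hc', h⟩ := exists_cls hU (hbU.subset hz)
  obtain ⟨b₀, hb₀, hz₀, hs⟩ := exists_cell (hb.isOpen.inter hb'.isOpen) ⟨hz, hz'⟩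
  obtain ⟨c₀, hc₀⟩ := hb₀.bij.2 (gen n)
  have h1 : OpenIn b₀ b := OpenIn.of_isOpen hb₀.isOpen fun x hx => (hs hx).1
  have h2 : OpenIn b₀ b' := OpenIn.of_isOpen hb₀.isOpen fun x hx => (hs hx).2
  have e1 : ext h1 c₀ = c := hb.bij.1 (by rw [eps_ext hb₀.isOpen, hc₀, hc])
  have e2 : ext h2 c₀ = c' := hb'.bij.1 (by rw [eps_ext hb₀.isOpen, hc₀, hc'])
  rw [← h, ← e1, ← e2, ext_ext h1 _ (h1.trans hbU), ext_ext h2 _ (h1.trans hbU)]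

lemma eps_cls (hU : IsOpen U) (hz : z ∈ U) : eps hU (cls U z) = gen n := by
  obtain ⟨b', hb', hbU', hz', c', hc', h⟩ := exists_cls hU hz
  rw [← h, eps_ext hb'.isOpen, hc']

lemma cls_ne_zero (hU : IsOpen U) (hz : z ∈ U) : cls U z ≠ 0 := fun h => by
  have := eps_cls hU hz
  rw [h, map_zero] at this
  exact gen_ne_zero this.symm

lemma ext_cls (hU : IsOpen U) (hV : IsOpen V) (h : OpenIn U V) (hz : z ∈ U) :
    ext h (cls U z) = cls V z := by
  obtain ⟨b', hb', hbU', hz', c', hc', h'⟩ := exists_cls hU hz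
  rw [← h', ext_ext _ h (OpenIn.of_isOpen hb'.isOpen (hbU'.trans h.subset))]
  exact ext_eq_cls hV hb' _ hz' hc'

lemma cls_eq_of_mem_cell (hU : IsOpen U) (hb : IsCell b) (hbU : b ⊆ U) (hz : z ∈ b) (hw : w ∈ b) :
    cls U z = cls U w := by
  obtain ⟨c, hc⟩ := hb.bij.2 (gen n)
  rw [← ext_eq_cls hU hb (OpenIn.of_isOpen hb.isOpen hbU) hz hc,
    ← ext_eq_cls hU hb (OpenIn.of_isOpen hb.isOpen hbU) hw hc]

lemma IsCell.eq_zero_or_cls (hb : IsCell b) (hz : z ∈ b) (c : H (n + 1) b) : c = 0 ∨ c = cls b z := by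
  rcases eq_zero_or_gen (eps hb.isOpen c) with h | h
  · exact Or.inl (hb.bij.1 (by rw [h, map_zero]))
  · exact Or.inr (hb.bij.1 (by rw [h, eps_cls hb.isOpen hz]))

lemma IsCell.eq_cls (hb : IsCell b) (hz : z ∈ b) {c : H (n + 1) b} (hc : c ≠ 0) : c = cls b z :=
  (hb.eq_zero_or_cls hz c).resolve_left hc

lemma isOpen_lc (hU : IsOpen U) : LC U :=
  (LC.of_isCompact isCompact_univ).openIn (OpenIn.of_isOpen hU (subset_univ _))

/-- Top-dimensional cohomology of an open set is generated by point classes. -/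
lemma mem_closure_cls (hU : IsOpen U) (c : H (n + 1) U) :
    c ∈ AddSubgroup.closure {c | ∃ z ∈ U, c = cls U z} := by
  have key : ∀ s : Finset (Sph n), ∀ b : Sph n → Set (Sph n), (∀ z ∈ s, IsCell (b z) ∧ z ∈ b z) →
      ∀ W : Set (Sph n), W = ⋃ z ∈ s, b z → ∀ c : H (n + 1) W,
      c ∈ AddSubgroup.closure {c | ∃ z ∈ W, c = cls W z} := by
    classical
    intro s b
    induction s using Finset.induction_on with
    | empty =>
      intro _ W hW c
      simp only [Finset.notMem_empty, iUnion_false, iUnion_empty] at hW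
      subst hW
      rw [acyc_empty _ c]; exact zero_mem _
    | insert p s hp ih =>
      intro hb W hW c
      rw [Finset.set_biUnion_insert] at hW
      set W' := ⋃ z ∈ s, b z with hW'
      have hbp := hb p (by simp)
      have hW'o : IsOpen W' := isOpen_biUnion fun z hz => (hb z (Finset.mem_insert_of_mem (by simpa using hz))).1.isOpen
      have hWo : IsOpen W := by rw [hW]; exact hbp.1.isOpen.union hW'o
      have h1 : OpenIn (b p) W := OpenIn.of_isOpen hbp.1.isOpen (by rw [hW]; exact subset_union_left)
      have h2 : OpenIn W' W := OpenIn.of_isOpen hW'o (by rw [hW]; exact subset_union_right)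
      obtain ⟨u, v, rfl⟩ := exists_ext_add_ext (isOpen_lc hWo) h1 h2 hW.symm rfl
        (acyc_sphere_of_lt (isOpen_lc (hbp.1.isOpen.inter hW'o)) (by omega)) c
      refine add_mem ?_ ?_
      · rcases hbp.1.eq_zero_or_cls hbp.2 u with rfl | rfl
        · rw [map_zero]; exact zero_mem _
        · exact AddSubgroup.subset_closure ⟨p, h1.subset hbp.2, ext_cls hbp.1.isOpen hWo h1 hbp.2⟩
      · have hv := ih (fun z hz => hb z (by simp [hz])) W' rfl v
        have := AddSubgroup.mem_map_of_mem (ext h2) hv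
        rw [AddMonoidHom.map_closure] at this
        refine AddSubgroup.closure_mono ?_ this
        rintro _ ⟨_, ⟨z, hz, rfl⟩, rfl⟩
        exact ⟨z, h2.subset hz, ext_cls hW'o hWo h2 hz⟩
  obtain ⟨K, hKU, hK, hc⟩ := exists_compact_forall_res_eq_zero (OpenIn.refl U) c
  rw [ext_refl] at hc
  choose! b hb using fun z (hz : z ∈ U) => exists_cell hU hz
  obtain ⟨t, htK, ht⟩ := hK.elim_nhds_subcover b fun z hz =>
    (hb z (hKU hz)).1.isOpen.mem_nhds (hb z (hKU hz)).2.1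
  set W := ⋃ z ∈ t, b z with hW
  have hWo : IsOpen W := isOpen_biUnion fun z hz => (hb z (hKU (htK z hz))).1.isOpen
  have hWU : OpenIn W U := OpenIn.of_isOpen hWo
    (iUnion₂_subset fun z hz => (hb z (hKU (htK z hz))).2.2)
  obtain ⟨c', rfl⟩ := exists_ext_of_res_eq_zero (isOpen_lc hU) hWU.diff
    (sdiff_sdiff_cancel_left hWU.subset).symm hWU
    (hc _ hWU.diff (disjoint_left.2 fun x hx hxK => hx.2 (ht hxK)))
  have hv := key t b (fun z hz => ⟨(hb z (hKU (htK z hz))).1, (hb z (hKU (htK z hz))).2.1⟩) W rfl c'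
  have := AddSubgroup.mem_map_of_mem (ext hWU) hv
  rw [AddMonoidHom.map_closure] at this
  refine AddSubgroup.closure_mono ?_ this
  rintro _ ⟨_, ⟨z, hz, rfl⟩, rfl⟩
  exact ⟨z, hWU.subset hz, ext_cls hWo hU hWU hz⟩

/-- Cohomology of closed sets with empty interior vanishes in the top dimension. -/
lemma acyc_of_nowhere_dense {A : Set (Sph n)} (hU : IsOpen U) (hA : ClosedIn A U)
    (h : ∀ W ⊆ U, IsOpen W → W.Nonempty → (W \ A).Nonempty) : Acyc (n + 1) A := by
  intro a
  have hBo : IsOpen (U \ A) := by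
    obtain ⟨O, hO, h⟩ := hA.diff
    rw [h]; exact hU.inter hO
  obtain ⟨b, hb⟩ := exists_conn (isOpen_lc hU) hA rfl a
  rw [acyc_sphere_of_lt (isOpen_lc hBo) (by omega) b] at hb
  obtain ⟨c, rfl⟩ := hb.exists_res hA rfl
  have : AddSubgroup.closure {c | ∃ z ∈ U, c = cls U z} ≤ (res hA : H (n + 1) U →+ _).ker := by
    rw [AddSubgroup.closure_le]
    rintro _ ⟨z, hz, rfl⟩
    obtain ⟨b, hb, hzb, hbU⟩ := exists_cell hU hz
    obtain ⟨w, hw, hwA⟩ := h b hbU hb.isOpen ⟨z, hzb⟩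
    show res hA (cls U z) = 0
    rw [cls_eq_of_mem_cell hU hb hbU hzb hw, ← ext_cls hBo hU hA.diff ⟨hbU hw, hwA⟩]
    exact res_ext_of_disjoint _ _ disjoint_sdiff_right _
  exact this (mem_closure_cls hU c)

lemma res_cls_of_mem {R : Set (Sph n)} (hU : IsOpen U) (hR : IsOpen R) (hRU : ClosedIn R U)
    (hz : z ∈ R) : res hRU (cls U z) = cls R z := by
  have h : OpenIn R U := OpenIn.of_isOpen hR hRU.subset
  rw [← ext_cls hR hU h hz, res_ext hRU h (OpenIn.refl R) (ClosedIn.refl R) (inter_self R).symm,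
    res_refl, ext_refl]

lemma res_cls_of_notMem {R : Set (Sph n)} (hU : IsOpen U) (hRU : ClosedIn R U)
    (hz : z ∈ U) (hzR : z ∉ R) : res hRU (cls U z) = 0 := by
  have h : IsOpen (U \ R) := by
    obtain ⟨O, hO, h⟩ := hRU.diff
    rw [h]; exact hU.inter hO
  rw [← ext_cls h hU hRU.diff ⟨hz, hzR⟩]
  exact res_ext_of_disjoint _ _ disjoint_sdiff_right _

/-- Homeomorphisms of open sets preserve point classes. -/
lemma HomOn.pull_cls {f g : Sph n → Sph n} (h : HomOn f g U V) (hU : IsOpen U) (hV : IsOpen V)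
    (hz : z ∈ U) : pull h.properOn (cls V (f z)) = cls U z := by
  obtain ⟨b, hb, hzb, hbU⟩ := exists_cell hU hz
  have hfb : V ∩ g ⁻¹' b = f '' b := by
    ext y
    constructor
    · rintro ⟨hy, hy'⟩; exact ⟨g y, hy', h.right y hy⟩
    · rintro ⟨x, hx, rfl⟩; exact ⟨h.mapsTo x (hbU hx), by rw [mem_preimage, h.left x (hbU hx)]; exact hx⟩
  have hfo : IsOpen (f '' b) := by
    rw [← hfb]; exact h.cont'.isOpen_inter_preimage hV hb.isOpen
  have hfz : f z ∈ f '' b := ⟨z, hzb, rfl⟩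
  obtain ⟨b', hb', hzb', hbV'⟩ := exists_cell hfo hfz
  have hbV : b' ⊆ V := fun y hy => by
    obtain ⟨x, hx, rfl⟩ := hbV' hy; exact h.mapsTo x (hbU hx)
  set b₀ := U ∩ f ⁻¹' b' with hb₀
  have hb₀o : IsOpen b₀ := h.cont.isOpen_inter_preimage hU hb'.isOpen
  have hb₀b : b₀ ⊆ b := by
    rintro x ⟨hx, hx'⟩
    obtain ⟨x', hx'b, hxx⟩ := hbV' hx'
    rw [← h.left x hx, ← hxx, h.left x' (hbU hx'b)]; exact hx'b
  have h0 : HomOn f g b₀ b' := h.restrict hbV rfl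
  have hz₀ : z ∈ b₀ := ⟨hz, hzb'⟩
  have e1 : pull h0.properOn (cls b' (f z)) = cls b₀ z := by
    obtain ⟨c, hc⟩ := (h0.pull_bijective (n + 1)).2 (cls b₀ z)
    have hc0 : c ≠ 0 := by
      rintro rfl; rw [map_zero] at hc; exact cls_ne_zero hb₀o hz₀ hc.symm
    rw [← hb'.eq_cls hzb' hc0, hc]
  rw [← ext_cls hb'.isOpen hV (OpenIn.of_isOpen hb'.isOpen hbV) hzb',
    pull_ext h.properOn _ (OpenIn.of_isOpen hb₀o inter_subset_left) h0.properOn rfl, e1,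
    ext_cls hb₀o hU _ hz₀]

end Cells

section TwoToOne

variable {n m : ℕ}

/-- `f` is exactly two-to-one and `σ` exchanges the two points of each fibre. -/
structure IsTwo (f : Sph n → Sph m) (σ : Sph n → Sph n) : Prop where
  cont : Continuous f
  surj : Function.Surjective f
  ne : ∀ x, σ x ≠ x
  map : ∀ x, f (σ x) = f x
  fib : ∀ x x', f x' = f x → x' = x ∨ x' = σ x

lemma exists_isTwo {f : Sph n → Sph m} (hf : Continuous f) (hs : Function.Surjective f)
    (h : ∀ y, Nat.card (f ⁻¹' {y}) = 2) : ∃ σ, IsTwo f σ := by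
  have key : ∀ x, ∃ x', x' ≠ x ∧ f x' = f x ∧ ∀ x'', f x'' = f x → x'' = x ∨ x'' = x' := by
    intro x
    obtain ⟨a, b, hab, hu⟩ := Set.ncard_eq_two.1 (h (f x))
    have ha : f a = f x := by have : a ∈ f ⁻¹' {f x} := by rw [hu]; simp
                              exact this
    have hb : f b = f x := by have : b ∈ f ⁻¹' {f x} := by rw [hu]; simp
                              exact this
    have hall : ∀ x'', f x'' = f x → x'' = a ∨ x'' = b := fun x'' hx => by
      have : x'' ∈ f ⁻¹' {f x} := hx
      rw [hu] at this; simpa using this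
    rcases hall x rfl with rfl | rfl
    · exact ⟨b, hab.symm, hb, hall⟩
    · exact ⟨a, hab, ha, fun x'' hx => (hall x'' hx).symm⟩
  choose σ h1 h2 h3 using key
  exact ⟨σ, hf, hs, h1, h2, h3⟩

/-- The set of points at which `f` is not locally injective. -/
def fold (f : Sph n → Sph m) : Set (Sph n) := {x | ∀ W, IsOpen W → x ∈ W → ¬ InjOn f W}

lemma isClosed_fold (f : Sph n → Sph m) : IsClosed (fold f) := by
  rw [← isOpen_compl_iff, isOpen_iff_forall_mem_open]
  intro x hx
  have : ∃ W, IsOpen W ∧ x ∈ W ∧ InjOn f W := by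
    by_contra! hcon; exact hx hcon
  obtain ⟨W, hW, hxW, hi⟩ := this
  exact ⟨W, fun y hy h => h W hW hy hi, hW, hxW⟩

variable {f : Sph n → Sph m} {σ : Sph n → Sph n}

namespace IsTwo

lemma invol (h : IsTwo f σ) (x : Sph n) : σ (σ x) = x := by
  rcases h.fib (σ x) x (h.map x).symm with h1 | h1
  · exact absurd h1.symm (h.ne x)
  · exact h1.symm

lemma eq_of_ne (h : IsTwo f σ) {x x' : Sph n} (hf : f x' = f x) (hne : x' ≠ x) : x' = σ x :=
  (h.fib x x' hf).resolve_left hne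

lemma exists_closed (h : IsTwo f σ) : ∃ F : ℕ → Set (Sph n), (∀ k, IsClosed (F k)) ∧
    (⋃ k, F k = univ) ∧ ∀ k x, x ∈ F k → 1 / ((k : ℝ) + 1) ≤ dist x (σ x) := by
  refine ⟨fun k => Prod.fst '' {p : Sph n × Sph n | 1 / ((k : ℝ) + 1) ≤ dist p.1 p.2 ∧ f p.1 = f p.2},
    fun k => ?_, ?_, ?_⟩
  · refine (IsCompact.image (IsClosed.isCompact ?_) continuous_fst).isClosed
    have hf := h.cont
    have h1 : IsClosed {p : Sph n × Sph n | 1 / ((k : ℝ) + 1) ≤ dist p.1 p.2} :=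
      isClosed_le (by fun_prop) (by fun_prop)
    have h2 : IsClosed {p : Sph n × Sph n | f p.1 = f p.2} :=
      isClosed_eq (hf.comp continuous_fst) (hf.comp continuous_snd)
    exact h1.inter h2
  · rw [eq_univ_iff_forall]
    intro x
    obtain ⟨k, hk⟩ := exists_nat_one_div_lt (dist_pos.2 (h.ne x).symm)
    exact mem_iUnion.2 ⟨k, (x, σ x), ⟨hk.le, (h.map x).symm⟩, rfl⟩
  · rintro k _ ⟨⟨x, y⟩, ⟨h1, h2⟩, rfl⟩
    have h1 : 1 / ((k : ℝ) + 1) ≤ dist x y := h1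
    have hne : y ≠ x := by
      rintro rfl
      rw [dist_self] at h1
      exact absurd h1 (not_le.2 (by positivity))
    rw [← h.eq_of_ne h2.symm hne]; exact h1

lemma injOn_of_dist (h : IsTwo f σ) {S : Set (Sph n)} {r : ℝ} (h1 : ∀ x ∈ S, r ≤ dist x (σ x))
    (h2 : ∀ x ∈ S, ∀ y ∈ S, dist x y < r) : InjOn f S := by
  intro x hx y hy hxy
  by_contra hne
  have := h.eq_of_ne hxy.symm (Ne.symm hne)
  have h3 := h2 x hx y hy
  rw [this] at h3
  exact absurd (h1 x hx) (not_le.2 h3)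

lemma exists_notMem_fold (h : IsTwo f σ) {W : Set (Sph n)} (hW : IsOpen W) (hne : W.Nonempty) :
    (W \ fold f).Nonempty := by
  obtain ⟨F, hF, hU, hd⟩ := h.exists_closed
  obtain ⟨x, hxW, hx⟩ := (dense_iUnion_interior_of_closed hF hU).inter_open_nonempty W hW hne
  obtain ⟨k, hk⟩ := mem_iUnion.1 hx
  refine ⟨x, hxW, fun hfold => ?_⟩
  have hpos : (0 : ℝ) < 1 / ((k : ℝ) + 1) := by positivity
  refine hfold (interior (F k) ∩ ball x (1 / ((k : ℝ) + 1) / 2)) (isOpen_interior.inter isOpen_ball)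
    ⟨hk, mem_ball_self (by positivity)⟩ (h.injOn_of_dist (r := 1 / ((k : ℝ) + 1))
      (fun y hy => hd k y (interior_subset hy.1)) fun y hy z hz => ?_)
  have h1 := mem_ball.1 hy.2
  have h2 := mem_ball'.1 hz.2
  linarith [dist_triangle y x z]

lemma exists_injOn (h : IsTwo f σ) {x : Sph n} (hx : x ∉ fold f) :
    ∃ W, IsOpen W ∧ x ∈ W ∧ InjOn f W := by
  by_contra! hcon; exact hx hcon

lemma le_dim (h : IsTwo f σ) [hn : Fact (2 ≤ n)] : n ≤ m := by
  by_contra! hlt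
  obtain ⟨x, -, hx⟩ := h.exists_notMem_fold isOpen_univ univ_nonempty
  obtain ⟨W, hW, hxW, hi⟩ := h.exists_injOn hx
  obtain ⟨r, hr, hrW⟩ := Metric.nhds_basis_closedBall.mem_iff.1 (hW.mem_nhds hxW)
  obtain ⟨b, hb, hxb, hbr⟩ := exists_cell (isOpen_ball (x := x) (ε := r)) (mem_ball_self hr)
  obtain ⟨g, hg⟩ := HomOn.of_isCompact (isCompact_closedBall x r) h.cont.continuousOn (hi.mono hrW)
  have hb' := hg.image (hbr.trans ball_subset_closedBall)
  exact cls_ne_zero hb.isOpen hxb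
    (hb'.acyc (acyc_sphere_of_lt (hb'.symm.lc (isOpen_lc hb.isOpen)) (by omega)) _)

lemma dim_le (h : IsTwo f σ) [hn : Fact (2 ≤ n)] : m ≤ n := by
  by_contra! hlt
  have : Fact (2 ≤ m) := ⟨by have := hn.out; omega⟩
  obtain ⟨F, hF, hU, hd⟩ := h.exists_closed
  set C : ℕ × ℕ → Set (Sph n) := fun i =>
    F i.1 ∩ closedBall (TopologicalSpace.denseSeq (Sph n) i.2) (1 / ((i.1 : ℝ) + 1) / 3) with hC
  have hCc : ∀ i, IsCompact (C i) := fun i => ((hF _).inter isClosed_closedBall).isCompact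
  have hinj : ∀ i, InjOn f (C i) := by
    intro i
    refine h.injOn_of_dist (r := 1 / ((i.1 : ℝ) + 1)) (fun y hy => hd _ y hy.1) fun y hy z hz => ?_
    have h1 := mem_closedBall.1 hy.2
    have h2 := mem_closedBall'.1 hz.2
    have hpos : (0 : ℝ) < 1 / ((i.1 : ℝ) + 1) := by positivity
    linarith [dist_triangle y (TopologicalSpace.denseSeq (Sph n) i.2) z]
  have hcov : ⋃ i, f '' C i = univ := by
    rw [eq_univ_iff_forall]
    intro y
    obtain ⟨x, rfl⟩ := h.surj y
    obtain ⟨k, hk⟩ := mem_iUnion.1 (hU.ge (mem_univ x))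
    obtain ⟨_, hp, ⟨j, rfl⟩⟩ := (TopologicalSpace.denseRange_denseSeq (Sph n)).inter_open_nonempty
      (ball x (1 / ((k : ℝ) + 1) / 3)) isOpen_ball ⟨x, mem_ball_self (by positivity)⟩
    exact mem_iUnion.2 ⟨(k, j), x, ⟨hk, mem_closedBall.2 (mem_ball'.1 hp).le⟩, rfl⟩
  obtain ⟨i, hi⟩ := nonempty_interior_of_iUnion_of_closed
    (fun i => ((hCc i).image h.cont).isClosed) hcov
  obtain ⟨y, hy⟩ := hi
  obtain ⟨b, hb, hyb, hbs⟩ := exists_cell isOpen_interior hy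
  obtain ⟨g, hg⟩ := HomOn.of_isCompact (hCc i) h.cont.continuousOn (hinj i)
  have hb' := hg.restrict (hbs.trans interior_subset) rfl
  exact cls_ne_zero hb.isOpen hyb
    (hb'.symm.acyc (acyc_sphere_of_lt (hb'.lc (isOpen_lc hb.isOpen)) (by omega)) _)

end IsTwo

end TwoToOne

section Folds

variable {n : ℕ} [hn : Fact (2 ≤ n)]

/-- Invariance of domain. -/
lemma isOpen_image_of_injOn {f : Sph n → Sph n} (hf : Continuous f) {W : Set (Sph n)}
    (hW : IsOpen W) (hi : InjOn f W) : IsOpen (f '' W) := by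
  rw [isOpen_iff_mem_nhds]
  rintro _ ⟨x, hx, rfl⟩
  obtain ⟨r, hr, hrW⟩ := Metric.nhds_basis_closedBall.mem_iff.1 (hW.mem_nhds hx)
  set β := ball x r with hβ
  have hxβ : x ∈ β := mem_ball_self hr
  have hβc : β ⊆ closedBall x r := ball_subset_closedBall
  by_contra hcon
  have hcon : f '' β ∉ nhds (f x) := fun h =>
    hcon (Filter.mem_of_superset h (image_mono (hβc.trans hrW)))
  have hP : IsClosed (f '' (closedBall x r \ β)) :=
    (((isCompact_closedBall x r).diff isOpen_ball).image hf).isClosed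
  have hxP : f x ∉ f '' (closedBall x r \ β) := by
    rintro ⟨y, hy, hxy⟩
    rw [hi (hrW hy.1) hx hxy] at hy
    exact hy.2 hxβ
  obtain ⟨W', hW', hxW', hWP⟩ := exists_cell hP.isOpen_compl hxP
  obtain ⟨z, hz, hzA⟩ : ∃ z ∈ W', z ∉ f '' β := by
    by_contra! h
    exact hcon (Filter.mem_of_superset (hW'.isOpen.mem_nhds hxW') h)
  have hA : ClosedIn (W' ∩ f '' β) W' := by
    refine ⟨f '' closedBall x r, ((isCompact_closedBall x r).image hf).isClosed, ?_⟩
    ext y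
    refine ⟨fun hy => ⟨hy.1, image_mono hβc hy.2⟩, ?_⟩
    rintro ⟨hy, u, hu, rfl⟩
    refine ⟨hy, u, ?_, rfl⟩
    by_contra huβ
    exact hWP hy ⟨u, ⟨hu, huβ⟩, rfl⟩
  have hacyc : Acyc (n + 1) (W' ∩ f '' β) := by
    intro a
    obtain ⟨b, hb⟩ := exists_conn (isOpen_lc hW'.isOpen) hA rfl a
    have hBo : OpenIn (W' \ (W' ∩ f '' β)) W' := hA.diff
    rw [acyc_sphere_of_lt ((isOpen_lc hW'.isOpen).openIn hBo) (by omega) b] at hb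
    obtain ⟨c, rfl⟩ := hb.exists_res hA rfl
    rcases hW'.eq_zero_or_cls hz c with rfl | rfl
    · exact map_zero _
    · exact res_cls_of_notMem hW'.isOpen hA hz fun h => hzA h.2
  obtain ⟨g, hg⟩ := HomOn.of_isCompact (isCompact_closedBall x r) hf.continuousOn (hi.mono hrW)
  have hb := (hg.image hβc).restrict (U' := W' ∩ f '' β) inter_subset_right rfl
  have ho : IsOpen (β ∩ f ⁻¹' (W' ∩ f '' β)) := by
    have : β ∩ f ⁻¹' (W' ∩ f '' β) = β ∩ f ⁻¹' W' := by
      ext y; exact ⟨fun h => ⟨h.1, h.2.1⟩, fun h => ⟨h.1, h.2, y, h.1, rfl⟩⟩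
    rw [this]; exact isOpen_ball.inter (hW'.isOpen.preimage hf)
  exact cls_ne_zero ho ⟨hxβ, hxW', x, hxβ, rfl⟩ (hb.acyc hacyc _)

variable {f : Sph n → Sph n} {σ : Sph n → Sph n}

namespace IsTwo

lemma sigma_mem_fold (h : IsTwo f σ) {x : Sph n} (hx : x ∈ fold f) : σ x ∈ fold f := by
  by_contra hs
  obtain ⟨W, hW, hxW, hi⟩ := h.exists_injOn hs
  obtain ⟨P, P', hP, hP', hxP, hxP', hd⟩ := t2_separation (h.ne x)
  have hi' : InjOn f (W ∩ P) := hi.mono inter_subset_left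
  have ho := isOpen_image_of_injOn h.cont (hW.inter hP) hi'
  refine hx (P' ∩ f ⁻¹' (f '' (W ∩ P))) (hP'.inter (ho.preimage h.cont))
    ⟨hxP', σ x, ⟨hxW, hxP⟩, h.map x⟩ fun w hw w' hw' hww => ?_
  by_contra hne
  obtain ⟨u, hu, huw⟩ := hw.2
  have huP' : u ∉ P' := fun hu' => disjoint_left.1 hd hu.2 hu'
  have h1 : w' = σ w := h.eq_of_ne hww.symm (Ne.symm hne)
  have h2 : u = σ w := h.eq_of_ne huw (by rintro rfl; exact huP' hw.1)
  exact huP' (by rw [h2, ← h1]; exact hw'.1)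

lemma sigma_mem_fold_iff (h : IsTwo f σ) {x : Sph n} : σ x ∈ fold f ↔ x ∈ fold f :=
  ⟨fun hx => by have := h.sigma_mem_fold hx; rwa [h.invol] at this, h.sigma_mem_fold⟩

lemma mem_fold_of_eq (h : IsTwo f σ) {x x' : Sph n} (hf : f x' = f x) (hx : x ∈ fold f) :
    x' ∈ fold f := by
  rcases h.fib x x' hf with rfl | rfl
  exacts [hx, h.sigma_mem_fold hx]

/-- Over a neighbourhood of a point off the fold, `f` is a trivial double covering. -/
lemma exists_sheets (h : IsTwo f σ) {w : Sph n} (hw : w ∉ fold f) {P P' : Set (Sph n)}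
    (hP : IsOpen P) (hP' : IsOpen P') (hwP : w ∈ P) (hwP' : σ w ∈ P') :
    ∃ Q S S' g g', IsOpen Q ∧ IsOpen S ∧ IsOpen S' ∧ f w ∈ Q ∧ w ∈ S ∧ σ w ∈ S' ∧ S ⊆ P ∧ S' ⊆ P' ∧
      Disjoint S S' ∧ f ⁻¹' Q = S ∪ S' ∧ HomOn f g S Q ∧ HomOn f g' S' Q := by
  have hw' : σ w ∉ fold f := fun hc => hw (h.sigma_mem_fold_iff.1 hc)
  obtain ⟨W, hW, hwW, hi⟩ := h.exists_injOn hw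
  obtain ⟨W', hW', hwW', hi'⟩ := h.exists_injOn hw'
  obtain ⟨T, T', hT, hT', hwT, hwT', hd⟩ := t2_separation (h.ne w).symm
  obtain ⟨r, hr, hrs⟩ := Metric.nhds_basis_closedBall.mem_iff.1
    (((hP.inter hW).inter hT).mem_nhds ⟨⟨hwP, hwW⟩, hwT⟩)
  obtain ⟨r', hr', hrs'⟩ := Metric.nhds_basis_closedBall.mem_iff.1
    (((hP'.inter hW').inter hT').mem_nhds ⟨⟨hwP', hwW'⟩, hwT'⟩)
  have hic : InjOn f (closedBall w r) := hi.mono fun x hx => (hrs hx).1.2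
  have hic' : InjOn f (closedBall (σ w) r') := hi'.mono fun x hx => (hrs' hx).1.2
  obtain ⟨g, hg⟩ := HomOn.of_isCompact (isCompact_closedBall w r) h.cont.continuousOn hic
  obtain ⟨g', hg'⟩ := HomOn.of_isCompact (isCompact_closedBall (σ w) r') h.cont.continuousOn hic'
  set b := ball w r
  set b' := ball (σ w) r'
  have hb : b ⊆ closedBall w r := ball_subset_closedBall
  have hb' : b' ⊆ closedBall (σ w) r' := ball_subset_closedBall
  have hbb : ∀ x ∈ closedBall w r, ∀ y ∈ closedBall (σ w) r', x ≠ y := by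
    rintro x hx _ hy rfl
    exact disjoint_left.1 hd (hrs hx).2 (hrs' hy).2
  set Q := f '' b ∩ f '' b' with hQ
  have hQo : IsOpen Q := (isOpen_image_of_injOn h.cont isOpen_ball (hic.mono hb)).inter
    (isOpen_image_of_injOn h.cont isOpen_ball (hic'.mono hb'))
  have hS : b ∩ f ⁻¹' Q = closedBall w r ∩ f ⁻¹' Q := by
    ext x
    refine ⟨fun hx => ⟨hb hx.1, hx.2⟩, fun hx => ⟨?_, hx.2⟩⟩
    obtain ⟨u, hu, hux⟩ := hx.2.1
    rwa [← hic (hb hu) hx.1 hux]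
  have hS' : b' ∩ f ⁻¹' Q = closedBall (σ w) r' ∩ f ⁻¹' Q := by
    ext x
    refine ⟨fun hx => ⟨hb' hx.1, hx.2⟩, fun hx => ⟨?_, hx.2⟩⟩
    obtain ⟨u, hu, hux⟩ := hx.2.2
    rwa [← hic' (hb' hu) hx.1 hux]
  have hwQ : f w ∈ Q := ⟨⟨w, mem_ball_self hr, rfl⟩, σ w, mem_ball_self hr', h.map w⟩
  refine ⟨Q, b ∩ f ⁻¹' Q, b' ∩ f ⁻¹' Q, g, g', hQo, isOpen_ball.inter (hQo.preimage h.cont),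
    isOpen_ball.inter (hQo.preimage h.cont), hwQ, ⟨mem_ball_self hr, hwQ⟩,
    ⟨mem_ball_self hr', by rw [mem_preimage, h.map]; exact hwQ⟩, fun x hx => (hrs (hb hx.1)).1.1,
    fun x hx => (hrs' (hb' hx.1)).1.1, ?_, ?_, ?_, ?_⟩
  · exact disjoint_left.2 fun x hx hx' => hbb x (hb hx.1) x (hb' hx'.1) rfl
  · ext x
    refine ⟨fun hx => ?_, fun hx => hx.elim (fun h => h.2) fun h => h.2⟩
    obtain ⟨⟨u, hu, hux⟩, u', hu', hux'⟩ := id hx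
    have huu : u' = σ u := h.eq_of_ne (hux'.trans hux.symm) (hbb u (hb hu) u' (hb' hu')).symm
    rcases h.fib u x hux.symm with rfl | hxu
    · exact Or.inl ⟨hu, hx⟩
    · rw [← huu] at hxu; exact Or.inr ⟨hxu ▸ hu', hx⟩
  · exact hg.restrict (fun y hy => image_mono hb hy.1) hS
  · exact hg'.restrict (fun y hy => image_mono hb' hy.2) hS'

end IsTwo

/-- An open set whose preimage splits into two disjoint open pieces. -/
structure IsSplit (f : Sph n → Sph n) (U U' B : Set (Sph n)) : Prop where
  isOpen : IsOpen U
  isOpen' : IsOpen U'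
  openB : IsOpen B
  disj : Disjoint U U'
  eq : f ⁻¹' B = U ∪ U'

namespace IsSplit

variable {U U' B : Set (Sph n)}

lemma symm (hl : IsSplit f U U' B) : IsSplit f U' U B :=
  ⟨hl.isOpen', hl.isOpen, hl.openB, hl.disj.symm, hl.eq.trans (union_comm _ _)⟩

lemma map_mem (hl : IsSplit f U U' B) {x : Sph n} (hx : x ∈ U) : f x ∈ B :=
  hl.eq.ge (Or.inl hx)

lemma properOn (hl : IsSplit f U U' B) (hf : Continuous f) : ProperOn f U B := by
  refine ⟨fun x hx => hl.map_mem hx, hf.continuousOn, fun K hK hc => ?_⟩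
  have : U ∩ f ⁻¹' K = f ⁻¹' K \ U' := by
    ext x
    refine ⟨fun hx => ⟨hx.2, fun h => disjoint_left.1 hl.disj hx.1 h⟩, fun hx => ⟨?_, hx.1⟩⟩
    exact (hl.eq.le (hK hx.1)).resolve_right hx.2
  rw [this]
  exact (hc.isClosed.preimage hf).isCompact.diff hl.isOpen'

variable (hl : IsSplit f U U' B) (h : IsTwo f σ)

lemma pull_one {w : Sph n} (hw : w ∉ fold f) (hwU : w ∈ U) (hwU' : σ w ∈ U') :
    pull (hl.properOn h.cont) (cls B (f w)) = cls U w := by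
  obtain ⟨Q, S, S', g, g', hQ, hS, hS', hwQ, hwS, hwS', hSU, hSU', hd, hQS, hg, hg'⟩ :=
    h.exists_sheets hw hl.isOpen hl.isOpen' hwU hwU'
  have hQB : Q ⊆ B := fun y hy => by
    rw [← hg.right y hy]; exact hl.map_mem (hSU (hg.mapsTo' y hy))
  have hSeq : S = U ∩ f ⁻¹' Q := by
    rw [hQS]
    ext x
    exact ⟨fun hx => ⟨hSU hx, Or.inl hx⟩, fun hx => hx.2.resolve_right fun hx' =>
      disjoint_left.1 hl.disj hx.1 (hSU' hx')⟩
  rw [← ext_cls hQ hl.openB (OpenIn.of_isOpen hQ hQB) hwQ,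
    pull_ext _ _ (OpenIn.of_isOpen hS hSU) hg.properOn hSeq, hg.pull_cls hS hQ hwS,
    ext_cls hS hl.isOpen _ hwS]

lemma pull_two {w : Sph n} (hw : w ∉ fold f) (hwU : w ∈ U) (hwU' : σ w ∈ U) :
    pull (hl.properOn h.cont) (cls B (f w)) = cls U w + cls U (σ w) := by
  obtain ⟨Q, S, S', g, g', hQ, hS, hS', hwQ, hwS, hwS', hSU, hSU', hd, hQS, hg, hg'⟩ :=
    h.exists_sheets hw hl.isOpen hl.isOpen hwU hwU'
  have hQB : Q ⊆ B := fun y hy => by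
    rw [← hg.right y hy]; exact hl.map_mem (hSU (hg.mapsTo' y hy))
  have hTeq : S ∪ S' = U ∩ f ⁻¹' Q := by
    rw [hQS]; exact (inter_eq_right.2 (union_subset hSU hSU')).symm
  have hT : IsOpen (S ∪ S') := hS.union hS'
  have hTU : OpenIn (S ∪ S') U := OpenIn.of_isOpen hT (union_subset hSU hSU')
  have hTp : ProperOn f (S ∪ S') Q := (hl.properOn h.cont).restrict hQB hTeq
  have hST : OpenIn S (S ∪ S') := OpenIn.of_isOpen hS subset_union_left
  have hST' : OpenIn S' (S ∪ S') := OpenIn.of_isOpen hS' subset_union_right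
  have hSc : ClosedIn S (S ∪ S') := by
    have := hST'.diff; rwa [union_sdiff_cancel_right hd.inter_eq.le] at this
  have hSc' : ClosedIn S' (S ∪ S') := by
    have := hST.diff; rwa [union_sdiff_cancel_left hd.inter_eq.le] at this
  have e1 : res hSc (pull hTp (cls Q (f w))) = cls S w := by
    rw [← hg.pull_cls hS hQ hwS]
    exact pull_pull _ _ _ _
  have e2 : res hSc' (pull hTp (cls Q (f w))) = cls S' (σ w) := by
    rw [← hg'.pull_cls hS' hQ hwS', h.map]
    exact pull_pull _ _ _ _
  rw [← ext_cls hQ hl.openB (OpenIn.of_isOpen hQ hQB) hwQ, pull_ext _ _ hTU hTp hTeq,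
    eq_ext_res_add hST hST' hSc hSc' rfl hd (pull hTp (cls Q (f w))), e1, e2,
    ext_cls hS hT _ hwS, ext_cls hS' hT _ hwS', map_add, ext_cls hT hl.isOpen _ (Or.inl hwS),
    ext_cls hT hl.isOpen _ (Or.inr hwS')]

include hl h in
/-- Near the fold, the two points of a fibre off the fold lie on the same side. -/
lemma sigma_mem (hB : IsCell B) (hne : (U ∩ fold f).Nonempty) {u : Sph n} (hu : u ∈ U) (huD : u ∉ fold f) :
    σ u ∈ U := by
  obtain ⟨x, hxU, hx⟩ := hne
  obtain ⟨w, hw, w', hw', hww, hne⟩ : ∃ w ∈ U, ∃ w' ∈ U, f w = f w' ∧ w ≠ w' := by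
    have := hx U hl.isOpen hxU
    unfold InjOn at this; push Not at this
    obtain ⟨w, hw, w', hw', h1, h2⟩ := this
    exact ⟨w, hw, w', hw', h1, h2⟩
  have hw's : w' = σ w := h.eq_of_ne hww.symm (Ne.symm hne)
  have hcl : IsClosed (f '' Uᶜ) := (hl.isOpen.isClosed_compl.isCompact.image h.cont).isClosed
  obtain ⟨v, ⟨hvU, hv⟩, hvD⟩ := h.exists_notMem_fold
    (hl.isOpen.inter (hcl.isOpen_compl.preimage h.cont)) ⟨w, hw, by
      rintro ⟨y, hy, hyw⟩
      rcases h.fib w y hyw with rfl | rfl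
      · exact hy hw
      · rw [← hw's] at hy; exact hy hw'⟩
  have hvU' : σ v ∈ U := by
    by_contra hc; exact hv ⟨σ v, hc, h.map v⟩
  by_contra hc
  have hsu : σ u ∈ U' := (hl.eq.le (show f (σ u) ∈ B by rw [h.map]; exact hl.map_mem hu)).resolve_left hc
  have e := hl.pull_one h huD hu hsu
  rw [cls_eq_of_mem_cell hl.openB hB subset_rfl (hl.map_mem hu) (hl.map_mem hvU),
    hl.pull_two h hvD hvU hvU'] at e
  have e' := congrArg (eps hl.isOpen) e
  rw [map_add, eps_cls _ hvU, eps_cls _ hvU', H.add_self, eps_cls _ hu] at e'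
  exact gen_ne_zero e'.symm

end IsSplit

lemma IsTwo.exists_level (h : IsTwo f σ) {x : Sph n} {V V' O : Set (Sph n)} (hV : IsOpen V)
    (hV' : IsOpen V') (hxV : x ∈ V) (hxV' : σ x ∈ V') (hd : Disjoint V V') (hO : IsOpen O)
    (hxO : f x ∈ O) : ∃ U U' B, IsSplit f U U' B ∧ IsCell B ∧ x ∈ U ∧ σ x ∈ U' ∧ B ⊆ O ∧
      U = V ∩ f ⁻¹' B ∧ U' = V' ∩ f ⁻¹' B := by
  have hcl : IsClosed (f '' (V ∪ V')ᶜ) :=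
    ((hV.union hV').isClosed_compl.isCompact.image h.cont).isClosed
  have hx : f x ∉ f '' (V ∪ V')ᶜ := by
    rintro ⟨y, hy, hyw⟩
    rcases h.fib x y hyw with rfl | rfl
    · exact hy (Or.inl hxV)
    · exact hy (Or.inr hxV')
  obtain ⟨B, hB, hxB, hBs⟩ := exists_cell (hcl.isOpen_compl.inter hO) ⟨hx, hxO⟩
  refine ⟨V ∩ f ⁻¹' B, V' ∩ f ⁻¹' B, B, ⟨hV.inter (hB.isOpen.preimage h.cont),
    hV'.inter (hB.isOpen.preimage h.cont), hB.isOpen, hd.mono inter_subset_left inter_subset_left,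
    ?_⟩, hB, ⟨hxV, hxB⟩, ⟨hxV', by rw [mem_preimage, h.map]; exact hxB⟩, fun y hy => (hBs hy).2, rfl, rfl⟩
  rw [← union_inter_distrib_right]
  refine (inter_eq_right.2 fun y hy => ?_).symm
  by_contra hc
  exact (hBs hy).1 ⟨y, hc, rfl⟩

open Classical in
/-- The involution exchanging the points of fibres off the fold, and fixing the fold. -/
noncomputable def flip (f : Sph n → Sph n) (σ : Sph n → Sph n) (x : Sph n) : Sph n :=
  if x ∈ fold f then x else σ x

lemma flip_of_mem {x : Sph n} (hx : x ∈ fold f) : flip f σ x = x := if_pos hx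

lemma flip_of_notMem {x : Sph n} (hx : x ∉ fold f) : flip f σ x = σ x := if_neg hx

namespace IsTwo

lemma map_flip (h : IsTwo f σ) (x : Sph n) : f (flip f σ x) = f x := by
  by_cases hx : x ∈ fold f
  · rw [flip_of_mem hx]
  · rw [flip_of_notMem hx, h.map]

lemma flip_flip (h : IsTwo f σ) (x : Sph n) : flip f σ (flip f σ x) = x := by
  by_cases hx : x ∈ fold f
  · rw [flip_of_mem hx, flip_of_mem hx]
  · rw [flip_of_notMem hx, flip_of_notMem (fun h' => hx (h.sigma_mem_fold_iff.1 h')), h.invol]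

lemma continuous_flip (h : IsTwo f σ) : Continuous (flip f σ) := by
  rw [continuous_iff_continuousAt]
  intro x
  by_cases hx : x ∈ fold f
  · intro N hN
    rw [flip_of_mem hx] at hN
    obtain ⟨V, V', hV, hV', hxV, hxV', hd⟩ := t2_separation (h.ne x).symm
    obtain ⟨O, hON, hO, hxO⟩ := _root_.mem_nhds_iff.1 hN
    obtain ⟨U, U', B, hl, hB, hxU, hxU', -, hU, -⟩ := h.exists_level (hV.inter hO) hV' ⟨hxV, hxO⟩ hxV'
      (hd.mono_left inter_subset_left) isOpen_univ (mem_univ (f x))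
    refine Filter.mem_map.2 (Filter.mem_of_superset (hl.isOpen.mem_nhds hxU) fun u hu => ?_)
    have hUN : U ⊆ N := fun y hy => by rw [hU] at hy; exact hON hy.1.2
    by_cases huD : u ∈ fold f
    · rw [mem_preimage, flip_of_mem huD]; exact hUN hu
    · rw [mem_preimage, flip_of_notMem huD]; exact hUN (hl.sigma_mem h hB ⟨x, hxU, hx⟩ hu huD)
  · obtain ⟨Q, S, S', g, g', hQ, hS, hS', hwQ, hwS, hwS', hSU, hSU', hd, hQS, hg, hg'⟩ :=
      h.exists_sheets hx (isClosed_fold f).isOpen_compl isOpen_univ hx (mem_univ _)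
    have : ContinuousAt (fun y => g' (f y)) x :=
      (ContinuousOn.comp hg'.cont' hg.cont hg.mapsTo).continuousAt (hS.mem_nhds hwS)
    refine this.congr (Filter.mem_of_superset (hS.mem_nhds hwS) fun y hy => ?_)
    show g' (f y) = flip f σ y
    rw [flip_of_notMem (hSU hy)]
    have h1 : g' (f y) ∈ S' := hg'.mapsTo' _ (hg.mapsTo y hy)
    refine h.eq_of_ne (hg'.right _ (hg.mapsTo y hy)) fun hc => ?_
    rw [hc] at h1
    exact disjoint_left.1 hd hy h1

end IsTwo

end Folds

section Quotient

lemma HomOn.openIn_image {X Y : Type*} [MetricSpace X] [MetricSpace Y] {f : X → Y} {g : Y → X}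
    {Z : Set X} {Z' : Set Y} (h : HomOn f g Z Z') {A : Set X} (hA : OpenIn A Z) :
    OpenIn (f '' A) Z' := by
  have : f '' A = Z' ∩ g ⁻¹' A := by
    ext y
    refine ⟨?_, fun hy => ⟨g y, hy.2, h.right y hy.1⟩⟩
    rintro ⟨x, hx, rfl⟩
    exact ⟨h.mapsTo x (hA.subset hx), by rw [mem_preimage, h.left x (hA.subset hx)]; exact hx⟩
  rw [this]; exact h.symm.properOn.openIn hA

lemma HomOn.closedIn_image {X Y : Type*} [MetricSpace X] [MetricSpace Y] {f : X → Y} {g : Y → X}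
    {Z : Set X} {Z' : Set Y} (h : HomOn f g Z Z') {A : Set X} (hA : ClosedIn A Z) :
    ClosedIn (f '' A) Z' := by
  have : f '' A = Z' ∩ g ⁻¹' A := by
    ext y
    refine ⟨?_, fun hy => ⟨g y, hy.2, h.right y hy.1⟩⟩
    rintro ⟨x, hx, rfl⟩
    exact ⟨h.mapsTo x (hA.subset hx), by rw [mem_preimage, h.left x (hA.subset hx)]; exact hx⟩
  rw [this]; exact h.symm.properOn.closedIn_preimage hA

variable {n : ℕ} [hn : Fact (2 ≤ n)] {f : Sph n → Sph n} {σ : Sph n → Sph n}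

/-- `g` is the quotient map by the involution `flip f σ` and `h` is the map induced by `f`. -/
structure IsQuot {Q : Type*} [MetricSpace Q] (f : Sph n → Sph n) (σ : Sph n → Sph n)
    (g : Sph n → Q) (h : Q → Sph n) : Prop where
  cont : Continuous g
  eq : ∀ x x', g x' = g x → x' = x ∨ x' = flip f σ x
  flip : ∀ x, g (flip f σ x) = g x
  map : ∀ x, h (g x) = f x
  conth : ContinuousOn h (range g)

lemma IsTwo.exists_isQuot (ht : IsTwo f σ) :
    ∃ (g : Sph n → C(Sph n, ℝ)) (h : C(Sph n, ℝ) → Sph n), IsQuot f σ g h := by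
  have hτ := ht.continuous_flip
  have hc : Continuous fun p : Sph n × Sph n => dist p.1 p.2 * dist (flip f σ p.1) p.2 := by fun_prop
  set g : C(Sph n, C(Sph n, ℝ)) := ContinuousMap.curry ⟨_, hc⟩ with hg
  have hgx : ∀ x z, g x z = dist x z * dist (flip f σ x) z := fun x z => rfl
  have heq : ∀ x x', g x' = g x → x' = x ∨ x' = flip f σ x := by
    intro x x' hxx
    have h1 := hgx x x'
    rw [← hxx, hgx, dist_self, zero_mul] at h1
    rcases mul_eq_zero.1 h1.symm with h2 | h2
    · exact Or.inl (dist_eq_zero.1 h2).symm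
    · exact Or.inr (dist_eq_zero.1 h2).symm
  have hf : ∀ x x', g x' = g x → f x' = f x := by
    intro x x' hxx
    rcases heq x x' hxx with rfl | rfl
    · rfl
    · exact ht.map_flip x
  set h : C(Sph n, ℝ) → Sph n := fun q => f (Function.invFun g q) with hh
  have hm : ∀ x, h (g x) = f x := fun x => hf _ _ (Function.invFun_eq ⟨x, rfl⟩)
  refine ⟨g, h, g.continuous, heq, fun x => ?_, hm, ?_⟩
  · ext z
    rw [hgx, hgx, ht.flip_flip, mul_comm]
  · rw [continuousOn_iff_isClosed]
    intro t htc
    refine ⟨g '' (f ⁻¹' t), ((htc.preimage ht.cont).isCompact.image g.continuous).isClosed, ?_⟩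
    ext q
    constructor
    · rintro ⟨hq, x, rfl⟩
      exact ⟨⟨x, by rw [mem_preimage, ← hm]; exact hq, rfl⟩, x, rfl⟩
    · rintro ⟨⟨x, hx, rfl⟩, -⟩
      exact ⟨by rw [mem_preimage, hm]; exact hx, x, rfl⟩

/-- Invariance under `flip f σ`. -/
def Sat (f : Sph n → Sph n) (σ : Sph n → Sph n) (S : Set (Sph n)) : Prop := ∀ x ∈ S, flip f σ x ∈ S

lemma Sat.of_subset_fold {S : Set (Sph n)} (h : S ⊆ fold f) : Sat f σ S := fun x hx => by
  rw [flip_of_mem (h hx)]; exact hx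

variable {Q : Type*} [MetricSpace Q] {g : Sph n → Q} {h : Q → Sph n}

namespace IsQuot

lemma preimage_image (hq : IsQuot f σ g h) {S : Set (Sph n)} (hS : Sat f σ S) :
    g ⁻¹' (g '' S) = S := by
  refine Subset.antisymm ?_ (subset_preimage_image g S)
  rintro x ⟨y, hy, hxy⟩
  rcases hq.eq y x hxy.symm with rfl | rfl
  exacts [hy, hS y hy]

lemma properOn (hq : IsQuot f σ g h) {S : Set (Sph n)} (hS : Sat f σ S) : ProperOn g S (g '' S) :=
  (ProperOn.of_isCompact isCompact_univ hq.cont.continuousOn fun x _ => mem_range_self x).restrict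
    (image_subset_range g S) (by rw [hq.preimage_image hS, univ_inter])

lemma properOn_map (hq : IsQuot f σ g h) {S S' : Set (Sph n)} (hf : ProperOn f S S') :
    ProperOn h (g '' S) S' := by
  refine ⟨?_, hq.conth.mono (image_subset_range g S), fun C hC hc => ?_⟩
  · rintro _ ⟨x, hx, rfl⟩
    rw [hq.map]; exact hf.mapsTo x hx
  · have : g '' S ∩ h ⁻¹' C = g '' (S ∩ f ⁻¹' C) := by
      ext q
      constructor
      · rintro ⟨⟨x, hx, rfl⟩, h2⟩
        rw [mem_preimage, hq.map] at h2
        exact ⟨x, ⟨hx, h2⟩, rfl⟩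
      · rintro ⟨x, ⟨hx, h2⟩, rfl⟩
        exact ⟨⟨x, hx, rfl⟩, by rw [mem_preimage, hq.map]; exact h2⟩
    rw [this]
    exact (hf.compact C hC hc).image hq.cont

lemma image_eq (hq : IsQuot f σ g h) {S Z Y : Set (Sph n)} (hS : S = Z ∩ f ⁻¹' Y) :
    g '' S = g '' Z ∩ h ⁻¹' Y := by
  subst hS
  ext q
  constructor
  · rintro ⟨x, ⟨hx, h2⟩, rfl⟩
    exact ⟨⟨x, hx, rfl⟩, by rw [mem_preimage, hq.map]; exact h2⟩
  · rintro ⟨⟨x, hx, rfl⟩, h2⟩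
    rw [mem_preimage, hq.map] at h2
    exact ⟨x, ⟨hx, h2⟩, rfl⟩

lemma openIn_range (hq : IsQuot f σ g h) {U : Set (Sph n)} (hU : IsOpen U) (hS : Sat f σ U) :
    OpenIn (g '' U) (range g) := by
  refine ⟨(g '' Uᶜ)ᶜ, (hU.isClosed_compl.isCompact.image hq.cont).isClosed.isOpen_compl, ?_⟩
  ext q
  constructor
  · rintro ⟨x, hx, rfl⟩
    refine ⟨⟨x, rfl⟩, ?_⟩
    rintro ⟨y, hy, hxy⟩
    exact hy ((hq.preimage_image hS).le ⟨x, hx, hxy.symm⟩)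
  · rintro ⟨⟨x, rfl⟩, h2⟩
    by_contra hc
    exact h2 ⟨x, fun hx => hc ⟨x, hx, rfl⟩, rfl⟩

lemma openIn (hq : IsQuot f σ g h) {U Z : Set (Sph n)} (hU : IsOpen U) (hS : Sat f σ U)
    (hUZ : U ⊆ Z) : OpenIn (g '' U) (g '' Z) :=
  (hq.openIn_range hU hS).restrict (image_mono hUZ) (image_subset_range g Z)

lemma lc (hq : IsQuot f σ g h) {U : Set (Sph n)} (hU : IsOpen U) (hS : Sat f σ U) :
    LC (g '' U) :=
  (LC.of_isCompact (isCompact_range hq.cont)).openIn (hq.openIn_range hU hS)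

lemma exists_homOn (hq : IsQuot f σ g h) : ∃ gi, HomOn g gi (fold f) (g '' fold f) := by
  refine HomOn.of_isCompact (isClosed_fold f).isCompact hq.cont.continuousOn fun x hx y hy hxy => ?_
  rcases hq.eq y x hxy with h1 | h1
  · exact h1
  · rw [h1, flip_of_mem hy]

lemma openIn_fold (hq : IsQuot f σ g h) {A Z : Set (Sph n)} (hA : OpenIn A Z) (hZ : Z ⊆ fold f) :
    OpenIn (g '' A) (g '' Z) := by
  obtain ⟨gi, hgi⟩ := hq.exists_homOn
  exact (hgi.image hZ).openIn_image hA

lemma closedIn_fold (hq : IsQuot f σ g h) {A Z : Set (Sph n)} (hA : ClosedIn A Z)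
    (hZ : Z ⊆ fold f) : ClosedIn (g '' A) (g '' Z) := by
  obtain ⟨gi, hgi⟩ := hq.exists_homOn
  exact (hgi.image hZ).closedIn_image hA

lemma image_inter (hq : IsQuot f σ g h) {A Z : Set (Sph n)} (hZ : Sat f σ Z) :
    g '' (A ∩ Z) = g '' A ∩ g '' Z := by
  refine Subset.antisymm (image_inter_subset g A Z) ?_
  rintro _ ⟨⟨x, hx, rfl⟩, h2⟩
  exact ⟨x, ⟨hx, (hq.preimage_image hZ).le h2⟩, rfl⟩

lemma pull_bijective (hq : IsQuot f σ g h) {S : Set (Sph n)} (hS : S ⊆ fold f) (k : ℕ) :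
    Function.Bijective (pull (hq.properOn (Sat.of_subset_fold hS)) : H k (g '' S) →+ H k S) := by
  obtain ⟨gi, hgi⟩ := hq.exists_homOn
  exact (hgi.image hS).pull_bijective k

lemma pull_pull (hq : IsQuot f σ g h) {S S' : Set (Sph n)} (hS : Sat f σ S) (hf : ProperOn f S S')
    {k : ℕ} (c : H k S') : pull (hq.properOn hS) (pull (hq.properOn_map hf) c) = pull hf c := by
  rw [CompactCohomology.pull_pull _ _ ((hq.properOn_map hf).comp (hq.properOn hS))]
  exact pull_congr _ _ (fun x _ => hq.map x) c

end IsQuot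

lemma pull_cls_eq_zero {X : Type*} [MetricSpace X] {φ : X → Sph n} {Z : Set X} {B O : Set (Sph n)}
    (hφ : ProperOn φ Z B) (hB : IsOpen B) (hO : IsOpen O) (hOB : O ⊆ B) {z : Sph n} (hz : z ∈ O)
    (hd : ∀ x ∈ Z, φ x ∉ O) : pull hφ (cls B z) = 0 := by
  have he : (∅ : Set X) = Z ∩ φ ⁻¹' O := by
    refine (eq_empty_of_forall_notMem fun x hx => hd x hx.1 hx.2).symm
  rw [← ext_cls hO hB (OpenIn.of_isOpen hO hOB) hz,
    pull_ext hφ _ (OpenIn.of_isOpen isOpen_empty (empty_subset Z)) (hφ.restrict hOB he) he,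
    acyc_empty _ (pull _ _), map_zero]

/-- A cell in the target over which two neighbourhoods of opposite points of the fold lie. -/
structure IsFoldCell (f : Sph n → Sph n) (σ : Sph n → Sph n) (U U' B : Set (Sph n)) : Prop
    extends IsSplit f U U' B where
  cell : IsCell B
  stab : ∀ w ∈ U, w ∉ fold f → σ w ∈ U
  stab' : ∀ w ∈ U', w ∉ fold f → σ w ∈ U'

lemma IsTwo.exists_foldCell (ht : IsTwo f σ) {x : Sph n} (hx : x ∈ fold f) {V V' O : Set (Sph n)}
    (hV : IsOpen V) (hV' : IsOpen V') (hxV : x ∈ V) (hxV' : σ x ∈ V') (hd : Disjoint V V')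
    (hO : IsOpen O) (hxO : f x ∈ O) : ∃ U U' B, IsFoldCell f σ U U' B ∧ x ∈ U ∧ σ x ∈ U' ∧ B ⊆ O ∧
      U ⊆ V ∧ U' ⊆ V' := by
  obtain ⟨U, U', B, hl, hB, hxU, hxU', hBO, hU, hU'⟩ := ht.exists_level hV hV' hxV hxV' hd hO hxO
  refine ⟨U, U', B, ⟨hl, hB, fun w hw => hl.sigma_mem ht hB ⟨x, hxU, hx⟩ hw, fun w hw =>
    hl.symm.sigma_mem ht hB ⟨σ x, hxU', ht.sigma_mem_fold hx⟩ hw⟩, hxU, hxU', hBO, ?_, ?_⟩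
  · rw [hU]; exact inter_subset_left
  · rw [hU']; exact inter_subset_left

lemma IsTwo.isOpen_image_off (ht : IsTwo f σ) {U : Set (Sph n)} (hU : IsOpen U) :
    IsOpen (f '' (U \ fold f)) := by
  rw [isOpen_iff_mem_nhds]
  rintro _ ⟨x, ⟨hxU, hx⟩, rfl⟩
  obtain ⟨W, hW, hxW, hi⟩ := ht.exists_injOn hx
  refine Filter.mem_of_superset ((isOpen_image_of_injOn ht.cont
    ((hW.inter hU).inter (isClosed_fold f).isOpen_compl) (hi.mono fun y hy => hy.1.1)).mem_nhds
    ⟨x, ⟨⟨hxW, hxU⟩, hx⟩, rfl⟩) (image_mono fun y hy => ⟨hy.1.2, hy.2⟩)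

namespace IsFoldCell

variable {U U' B : Set (Sph n)} (hc : IsFoldCell f σ U U' B) (ht : IsTwo f σ)
  (hq : IsQuot f σ g h)

include hc in
lemma symm : IsFoldCell f σ U' U B := ⟨hc.toIsSplit.symm, hc.cell, hc.stab', hc.stab⟩

include hc in
lemma sat : Sat f σ U := fun x hx => by
  by_cases hD : x ∈ fold f
  · rw [flip_of_mem hD]; exact hx
  · rw [flip_of_notMem hD]; exact hc.stab x hx hD

include ht in
lemma isClosed_image_fold : IsClosed (f '' fold f) :=
  ((isClosed_fold f).isCompact.image ht.cont).isClosed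

include ht in
lemma preimage_image_fold : f ⁻¹' (f '' fold f) = fold f :=
  Subset.antisymm (fun x ⟨_, hy, hxy⟩ => ht.mem_fold_of_eq hxy.symm hy) (subset_preimage_image f _)

include hc ht in
lemma sat_off : Sat f σ (U \ fold f) := fun x hx => by
  rw [flip_of_notMem hx.2]
  exact ⟨hc.stab x hx.1 hx.2, fun h => hx.2 (ht.sigma_mem_fold_iff.1 h)⟩

include hc ht in
lemma off : IsSplit f (U \ fold f) (U' \ fold f) (B \ f '' fold f) := by
  refine ⟨hc.isOpen.sdiff (isClosed_fold f), hc.isOpen'.sdiff (isClosed_fold f),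
    hc.openB.sdiff (isClosed_image_fold ht), hc.disj.mono sdiff_subset sdiff_subset, ?_⟩
  rw [preimage_sdiff, preimage_image_fold ht, hc.eq, union_sdiff_distrib]

include hc ht in
lemma off_eq : U \ fold f = U ∩ f ⁻¹' (B \ f '' fold f) := by
  rw [(hc.off ht).eq]
  ext x
  exact ⟨fun hx => ⟨hx.1, Or.inl hx⟩, fun hx => hx.2.elim id fun h => ⟨hx.1, h.2⟩⟩

include hc ht in
lemma on_eq : U ∩ fold f = U ∩ f ⁻¹' (B ∩ f '' fold f) := by
  rw [preimage_inter, preimage_image_fold ht]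
  ext x
  exact ⟨fun hx => ⟨hx.1, hc.map_mem hx.1, hx.2⟩, fun hx => ⟨hx.1, hx.2.2⟩⟩

include hc ht in
lemma properOn_on : ProperOn f (U ∩ fold f) (B ∩ f '' fold f) :=
  (hc.properOn ht.cont).restrict inter_subset_left (hc.on_eq ht)

/-- The class at the image of `w` on the quotient of the complement of the fold. -/
noncomputable def qcls (w : Sph n) : H (n + 1) (g '' (U \ fold f)) :=
  pull (hq.properOn_map ((hc.off ht).properOn ht.cont)) (cls (B \ f '' fold f) (f w))

include hc ht in
lemma exists_conn {w w' : Sph n} (hw : w ∈ U \ fold f) (hw' : w' ∈ U' \ fold f) :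
    ∃ u : H n (B ∩ f '' fold f),
      Conn B u (cls (B \ f '' fold f) (f w) + cls (B \ f '' fold f) (f w')) := by
  have ho : OpenIn (B \ f '' fold f) B := .of_isOpen (hc.off ht).openB sdiff_subset
  refine exists_conn_of_ext_eq_zero ⟨f '' fold f, isClosed_image_fold ht, rfl⟩
    sdiff_self_inter.symm ho ?_
  rw [map_add, ext_cls (hc.off ht).openB hc.openB ho ((hc.off ht).map_mem hw),
    ext_cls (hc.off ht).openB hc.openB ho ((hc.off ht).symm.map_mem hw'),
    cls_eq_of_mem_cell hc.openB hc.cell subset_rfl (hc.map_mem hw.1) (hc.symm.map_mem hw'.1),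
    H.add_self]

include ht in
lemma pull_eq_zero {X : Type*} [MetricSpace X] {φ : X → Sph n} {Z : Set X}
    (hφ : ProperOn φ Z (B \ f '' fold f)) (hm : ∀ x ∈ Z, φ x ∈ f '' U) {w' : Sph n}
    (hw' : w' ∈ U' \ fold f) (hc : IsFoldCell f σ U U' B) :
    pull hφ (cls (B \ f '' fold f) (f w')) = 0 := by
  refine pull_cls_eq_zero hφ (hc.off ht).openB (ht.isOpen_image_off hc.isOpen') ?_ ⟨w', hw', rfl⟩
    fun x hx => ?_
  · rintro _ ⟨y, hy, rfl⟩; exact (hc.off ht).symm.map_mem hy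
  · rintro ⟨y, hy, hxy⟩
    obtain ⟨u, hu, hux⟩ := hm x hx
    rw [← hux] at hxy
    refine disjoint_left.1 hc.disj hu ?_
    rcases ht.fib y u hxy.symm with rfl | rfl
    exacts [hy.1, hc.stab' y hy.1 hy.2]

lemma conn_quot {w w' : Sph n} (hw : w ∈ U \ fold f) (hw' : w' ∈ U' \ fold f)
    {u : H n (B ∩ f '' fold f)}
    (hu : Conn B u (cls (B \ f '' fold f) (f w) + cls (B \ f '' fold f) (f w'))) :
    Conn (g '' U) (pull (hq.properOn_map (hc.properOn_on ht)) u) (hc.qcls ht hq w) := by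
  have := hu.pull (hq.properOn_map (hc.properOn ht.cont)) (hq.properOn_map (hc.properOn_on ht))
    (hq.properOn_map ((hc.off ht).properOn ht.cont)) (hq.image_eq (hc.off_eq ht))
  rw [map_add, pull_eq_zero ht _ _ hw' hc, add_zero] at this
  · exact this
  · rintro _ ⟨x, hx, rfl⟩
    rw [hq.map]; exact ⟨x, hx.1, rfl⟩

include hc ht in
lemma off_eq_preimage {W : Set (Sph n)} (hWU : W ⊆ U) (hW : ∀ w ∈ W, w ∉ fold f → σ w ∈ W) :
    W \ fold f = (U \ fold f) ∩ f ⁻¹' (f '' (W \ fold f)) := by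
  ext x
  refine ⟨fun hx => ⟨⟨hWU hx.1, hx.2⟩, x, hx, rfl⟩, ?_⟩
  rintro ⟨hx, y, hy, hxy⟩
  refine ⟨?_, hx.2⟩
  rcases ht.fib y x hxy.symm with rfl | rfl
  exacts [hy.1, hW y hy.1 hy.2]

include hc ht in
lemma image_off_subset {W : Set (Sph n)} (hWU : W ⊆ U) : f '' (W \ fold f) ⊆ B \ f '' fold f := by
  rintro _ ⟨y, hy, rfl⟩; exact (hc.off ht).map_mem ⟨hWU hy.1, hy.2⟩

include hc ht in
lemma properOn_image {W : Set (Sph n)} (hWU : W ⊆ U) (hW : ∀ w ∈ W, w ∉ fold f → σ w ∈ W) :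
    ProperOn f (W \ fold f) (f '' (W \ fold f)) :=
  ((hc.off ht).properOn ht.cont).restrict (hc.image_off_subset ht hWU)
    (hc.off_eq_preimage ht hWU hW)

lemma qcls_eq {W : Set (Sph n)} (hWo : IsOpen W) (hWU : W ⊆ U)
    (hW : ∀ w ∈ W, w ∉ fold f → σ w ∈ W)
    (ho : OpenIn (g '' (W \ fold f)) (g '' (U \ fold f)))
    (hp : ProperOn h (g '' (W \ fold f)) (f '' (W \ fold f))) {w : Sph n} (hw : w ∈ W \ fold f) :
    hc.qcls ht hq w = ext ho (pull hp (cls (f '' (W \ fold f)) (f w))) := by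
  unfold qcls
  rw [← ext_cls (ht.isOpen_image_off hWo) (hc.off ht).openB
    (OpenIn.of_isOpen (ht.isOpen_image_off hWo) (hc.image_off_subset ht hWU)) ⟨w, hw, rfl⟩,
    pull_ext _ _ ho hp (hq.image_eq (hc.off_eq_preimage ht hWU hW))]

lemma ext_qcls {V V' C : Set (Sph n)} (hv : IsFoldCell f σ V V' C) (hVU : V ⊆ U)
    (ho : OpenIn (g '' (V \ fold f)) (g '' (U \ fold f))) {w : Sph n} (hw : w ∈ V \ fold f) :
    ext ho (hv.qcls ht hq w) = hc.qcls ht hq w := by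
  have hp := hq.properOn_map (hc.properOn_image ht hVU hv.stab)
  rw [hc.qcls_eq ht hq hv.isOpen hVU hv.stab ho hp hw,
    hv.qcls_eq ht hq hv.isOpen subset_rfl hv.stab (OpenIn.refl _) hp hw, ext_refl]

/-- Classes of the quotient off the fold pull back to classes with total class zero. -/
lemma pull_mem_closure (t : H (n + 1) (g '' (U \ fold f))) :
    pull (hq.properOn (hc.sat_off ht)) t ∈ AddSubgroup.closure
      {c | ∃ w ∈ U \ fold f, c = cls (U \ fold f) w + cls (U \ fold f) (σ w)} := by
  have hp := hc.properOn_image ht subset_rfl hc.stab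
  have hp' := hq.properOn_map hp
  have : Nonempty Q := ⟨g (Classical.arbitrary _)⟩
  obtain ⟨hi, hhi⟩ := HomOn.of_properOn (X := Q) hp' (by
      rintro _ ⟨x, hx, rfl⟩ _ ⟨y, hy, rfl⟩ hxy
      rw [hq.map, hq.map] at hxy
      rcases ht.fib y x hxy with rfl | rfl
      · rfl
      · rw [← flip_of_notMem (σ := σ) hy.2, hq.flip]) (by
      rintro _ ⟨x, hx, rfl⟩
      exact ⟨g x, ⟨x, hx, rfl⟩, hq.map x⟩)
  obtain ⟨t', rfl⟩ := (hhi.pull_bijective (n + 1)).2 t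
  have e : pull (hq.properOn (hc.sat_off ht)) (pull hhi.properOn t') = pull hp t' :=
    hq.pull_pull (hc.sat_off ht) hp t'
  rw [e]
  refine AddSubgroup.closure_induction ?_ ?_ ?_ ?_ (mem_closure_cls (ht.isOpen_image_off hc.isOpen) t')
  · rintro _ ⟨_, ⟨w, hw, rfl⟩, rfl⟩
    refine AddSubgroup.subset_closure ⟨w, hw, ?_⟩
    rw [← (hc.off ht).pull_two ht hw.2 hw ?_]
    · rw [← ext_cls (ht.isOpen_image_off hc.isOpen) (hc.off ht).openB
        (OpenIn.of_isOpen (ht.isOpen_image_off hc.isOpen) (hc.image_off_subset ht subset_rfl))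
        ⟨w, hw, rfl⟩, pull_ext _ _ (OpenIn.refl _) hp (hc.off_eq_preimage ht subset_rfl hc.stab),
        ext_refl]
    · have := hc.sat_off ht w hw
      rwa [flip_of_notMem hw.2] at this
  · rw [map_zero]; exact zero_mem _
  · intro a b _ _ ha hb
    rw [map_add]; exact add_mem ha hb
  · intro a _ ha
    rw [map_neg]; exact neg_mem ha

end IsFoldCell

end Quotient

section Gap

variable {n : ℕ} [hn : Fact (2 ≤ n)] {f : Sph n → Sph n} {σ : Sph n → Sph n}

/-- Points of the fold in `U` whose opposite point lies in `U` as well. -/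
def same (f : Sph n → Sph n) (σ : Sph n → Sph n) (U : Set (Sph n)) : Set (Sph n) :=
  {w | w ∈ U ∩ fold f ∧ σ w ∈ U}

/-- Points of the fold in `U` whose opposite point lies outside `U`. -/
def opp (f : Sph n → Sph n) (σ : Sph n → Sph n) (U : Set (Sph n)) : Set (Sph n) :=
  {w | w ∈ U ∩ fold f ∧ σ w ∉ U}

lemma same_eq (U : Set (Sph n)) : same f σ U = (U ∩ fold f) \ opp f σ U := by
  ext w
  exact ⟨fun h => ⟨h.1, fun h' => h'.2 h.2⟩, fun h => ⟨h.1, by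
    by_contra hc; exact h.2 ⟨h.1, hc⟩⟩⟩

lemma opp_subset (U : Set (Sph n)) : opp f σ U ⊆ U ∩ fold f := fun _ hw => hw.1

lemma same_subset (U : Set (Sph n)) : same f σ U ⊆ U ∩ fold f := fun _ hw => hw.1

lemma closedIn_opp (ht : IsTwo f σ) {U : Set (Sph n)} (hU : IsOpen U) :
    ClosedIn (opp f σ U) U := by
  refine ⟨fold f ∩ f ⁻¹' (f '' Uᶜ), (isClosed_fold f).inter
    ((hU.isClosed_compl.isCompact.image ht.cont).isClosed.preimage ht.cont), ?_⟩
  ext w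
  constructor
  · rintro ⟨⟨h1, h2⟩, h3⟩
    exact ⟨h1, h2, σ w, h3, ht.map w⟩
  · rintro ⟨h1, h2, v, hv, hvw⟩
    refine ⟨⟨h1, h2⟩, ?_⟩
    rcases ht.fib w v hvw with rfl | rfl
    exacts [absurd h1 hv, hv]

lemma closedIn_opp_fold (ht : IsTwo f σ) {U : Set (Sph n)} (hU : IsOpen U) :
    ClosedIn (opp f σ U) (U ∩ fold f) :=
  (closedIn_opp ht hU).restrict (opp_subset U) inter_subset_left

lemma openIn_same_fold (ht : IsTwo f σ) {U : Set (Sph n)} (hU : IsOpen U) :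
    OpenIn (same f σ U) (U ∩ fold f) := by
  rw [same_eq]; exact (closedIn_opp_fold ht hU).diff

lemma isOpen_diff_opp (ht : IsTwo f σ) {U : Set (Sph n)} (hU : IsOpen U) :
    IsOpen (U \ opp f σ U) := by
  obtain ⟨O, hO, h⟩ := (closedIn_opp ht hU).diff
  rw [h]; exact hU.inter hO

variable {Q : Type*} [MetricSpace Q] {g : Sph n → Q} {h : Q → Sph n}

namespace IsFoldCell

variable {U U' B : Set (Sph n)} (hc : IsFoldCell f σ U U' B) (ht : IsTwo f σ)
  (hq : IsQuot f σ g h)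

include hc ht hq in
lemma openIn_off : OpenIn (g '' (U \ fold f)) (g '' U) :=
  hq.openIn (hc.off ht).isOpen (hc.sat_off ht) sdiff_subset

include hc ht hq in
lemma quot_off : g '' (U \ fold f) = g '' U \ g '' (U ∩ fold f) := by
  ext q
  constructor
  · rintro ⟨x, hx, rfl⟩
    refine ⟨⟨x, hx.1, rfl⟩, ?_⟩
    rintro ⟨y, hy, hxy⟩
    rcases hq.eq y x hxy.symm with rfl | rfl
    · exact hx.2 hy.2
    · rw [flip_of_mem hy.2] at hx; exact hx.2 hy.2
  · rintro ⟨⟨x, hx, rfl⟩, h2⟩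
    exact ⟨x, ⟨hx, fun hD => h2 ⟨x, ⟨hx, hD⟩, rfl⟩⟩, rfl⟩

include hc ht hq in
lemma closedIn_on : ClosedIn (g '' (U ∩ fold f)) (g '' U) := by
  have := (hc.openIn_off ht hq).diff
  rwa [hc.quot_off ht hq, sdiff_sdiff_right_self,
    inter_eq_right.2 (image_mono inter_subset_left)] at this

/-- The class at the image of `w` is the coboundary of a class carried by `same f σ U`. -/
def Bdd (w : Sph n) : Prop := ∃ v : H n (g '' same f σ U),
  Conn (g '' U) (ext (hq.openIn_fold (openIn_same_fold ht hc.isOpen) inter_subset_right) v)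
    (hc.qcls ht hq w)

lemma bdd_sigma {w : Sph n} : hc.Bdd ht hq (σ w) ↔ hc.Bdd ht hq w := by
  unfold Bdd qcls; rw [ht.map]

lemma exists_nhds_qcls {w : Sph n} (hw : w ∈ U \ fold f) : ∃ N, IsOpen N ∧ w ∈ N ∧
    N ⊆ U \ fold f ∧ ∀ w' ∈ N, hc.qcls ht hq w' = hc.qcls ht hq w := by
  obtain ⟨b, hb, hwb, hbB⟩ := exists_cell (hc.off ht).openB ((hc.off ht).map_mem hw)
  refine ⟨(U \ fold f) ∩ f ⁻¹' b, (hc.off ht).isOpen.inter (hb.isOpen.preimage ht.cont), ⟨hw, hwb⟩,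
    inter_subset_left, fun w' hw' => ?_⟩
  unfold qcls
  rw [cls_eq_of_mem_cell (hc.off ht).openB hb hbB hw'.2 hwb]

lemma exists_nhds_bdd {k : Sph n} (hk : k ∈ same f σ U) : ∃ N, IsOpen N ∧ k ∈ N ∧ N ⊆ U ∧
    ∀ w ∈ N, (w ∈ fold f → w ∈ same f σ U) ∧ (w ∉ fold f → hc.Bdd ht hq w) := by
  obtain ⟨P, P', hP, hP', hkP, hkP', hd⟩ := t2_separation (ht.ne k).symm
  obtain ⟨W, W', C, hw, hkW, hkW', -, hWU, hWU'⟩ := ht.exists_foldCell hk.1.2 (hP.inter hc.isOpen)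
    (hP'.inter hc.isOpen) ⟨hkP, hk.1.1⟩ ⟨hkP', hk.2⟩
    (hd.mono inter_subset_left inter_subset_left) isOpen_univ (mem_univ _)
  have hWU : W ⊆ U := fun x hx => (hWU hx).2
  have hWU' : W' ⊆ U := fun x hx => (hWU' hx).2
  have hsame : ∀ w ∈ W ∩ fold f, w ∈ same f σ U := fun w hwW => by
    refine ⟨⟨hWU hwW.1, hwW.2⟩, ?_⟩
    have : σ w ∈ f ⁻¹' C := by rw [mem_preimage, ht.map]; exact hw.map_mem hwW.1
    rw [hw.eq] at this
    exact this.elim (fun h => hWU h) fun h => hWU' h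
  refine ⟨W, hw.isOpen, hkW, hWU, fun w hwW => ⟨fun hD => hsame w ⟨hwW, hD⟩, fun hD => ?_⟩⟩
  obtain ⟨w', hw'⟩ := ht.exists_notMem_fold hw.isOpen' ⟨_, hkW'⟩
  obtain ⟨u, hu⟩ := hw.exists_conn ht ⟨hwW, hD⟩ hw'
  have hon : OpenIn (W ∩ fold f) (U ∩ fold f) := (OpenIn.of_isOpen hw.isOpen hWU).inter _
  have hon' : OpenIn (W ∩ fold f) (same f σ U) := hon.restrict hsame (same_subset U)
  have ho : OpenIn (g '' (W \ fold f)) (g '' (U \ fold f)) :=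
    hq.openIn (hw.off ht).isOpen (hw.sat_off ht) (sdiff_subset_sdiff_left hWU)
  have key := (hw.conn_quot ht hq ⟨hwW, hD⟩ hw' hu).ext (hq.openIn hw.isOpen hw.sat hWU)
    (hq.openIn_fold hon inter_subset_right) ho (image_mono sdiff_subset) (by
      rw [← hq.image_inter hw.sat]
      congr 1
      ext x; exact ⟨fun hx => ⟨⟨hWU hx.1, hx.2⟩, hx.1⟩, fun hx => ⟨hx.2, hx.1.2⟩⟩)
  rw [hc.ext_qcls ht hq hw hWU ho ⟨hwW, hD⟩] at key
  exact ⟨ext (hq.openIn_fold hon' ((same_subset U).trans inter_subset_right)) _, by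
    rw [ext_ext _ _ (hq.openIn_fold hon inter_subset_right)]; exact key⟩

/-- If points of `U` and its opposite lie in a small cell, all nearby classes bound. -/
lemma bdd_of_cell {β S : Set (Sph n)} (hβ : IsCell β) (hβU : β ⊆ U) (hS : IsOpen S) (hSβ : S ⊆ β)
    {k b : Sph n} (hkS : k ∈ S) (hk : k ∈ same f σ U) (hbS : b ∈ S) (hb : b ∉ fold f) :
    hc.Bdd ht hq b := by
  by_contra hbad
  set Z := U \ opp f σ U with hZ
  have hZo : IsOpen Z := isOpen_diff_opp ht hc.isOpen
  have hoffZ : U \ fold f ⊆ Z := fun x hx => ⟨hx.1, fun h => hx.2 h.1.2⟩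
  have hZfold : ∀ w ∈ Z, w ∈ fold f → w ∈ same f σ U := fun w hw hD => by
    rw [same_eq]; exact ⟨⟨hw.1, hD⟩, hw.2⟩
  set R := {w | w ∈ Z ∧ (w ∈ fold f ∨ hc.Bdd ht hq w)} with hR
  have hRZ : R ⊆ Z := fun w hw => hw.1
  have hRo : IsOpen R := by
    rw [isOpen_iff_forall_mem_open]
    intro w hw
    by_cases hD : w ∈ fold f
    · obtain ⟨N, hN, hwN, hNU, hN'⟩ := hc.exists_nhds_bdd ht hq (hZfold w hw.1 hD)
      refine ⟨N ∩ Z, fun x hx => ⟨hx.2, ?_⟩, hN.inter hZo, hwN, hw.1⟩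
      by_cases hxD : x ∈ fold f
      · exact Or.inl hxD
      · exact Or.inr ((hN' x hx.1).2 hxD)
    · obtain ⟨N, hN, hwN, hNU, hN'⟩ := hc.exists_nhds_qcls ht hq ⟨hw.1.1, hD⟩
      refine ⟨N, fun x hx => ⟨hoffZ (hNU hx), Or.inr ?_⟩, hN, hwN⟩
      have := hw.2.resolve_left hD
      unfold Bdd at this ⊢
      rwa [hN' x hx]
  have hRc : ClosedIn R Z := by
    have ho : IsOpen (Z \ R) := by
      rw [isOpen_iff_forall_mem_open]
      intro w hw
      have hD : w ∉ fold f := fun hD => hw.2 ⟨hw.1, Or.inl hD⟩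
      obtain ⟨N, hN, hwN, hNU, hN'⟩ := hc.exists_nhds_qcls ht hq ⟨hw.1.1, hD⟩
      refine ⟨N, fun x hx => ⟨hoffZ (hNU hx), fun hxR => hw.2 ⟨hw.1, Or.inr ?_⟩⟩, hN, hwN⟩
      have := hxR.2.resolve_left (hNU hx).2
      unfold Bdd at this ⊢
      rwa [hN' x hx] at this
    have := (OpenIn.of_isOpen ho sdiff_subset).diff
    rwa [sdiff_sdiff_right_self, inter_eq_right.2 hRZ] at this
  have hRσ : ∀ w ∈ U \ fold f, σ w ∈ R ↔ w ∈ R := fun w hw => by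
    have h1 : σ w ∉ fold f := fun h => hw.2 (ht.sigma_mem_fold_iff.1 h)
    constructor
    · intro h2
      exact ⟨hoffZ hw, Or.inr ((hc.bdd_sigma ht hq).1 (h2.2.resolve_left h1))⟩
    · intro h2
      exact ⟨hoffZ ⟨hc.stab w hw.1 hw.2, h1⟩, Or.inr ((hc.bdd_sigma ht hq).2 (h2.2.resolve_left hw.2))⟩
  obtain ⟨a, haS, haD, haR⟩ : ∃ a ∈ S, a ∉ fold f ∧ a ∈ R := by
    obtain ⟨a, ha, haD⟩ := ht.exists_notMem_fold (hS.inter hRo)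
      ⟨k, hkS, ⟨hk.1.1, fun h => h.2 hk.2⟩, Or.inl hk.1.2⟩
    exact ⟨a, ha.1, haD, ha.2⟩
  have haZ : a ∈ Z := hRZ haR
  have hbZ : b ∈ Z := hoffZ ⟨hβU (hSβ hbS), hb⟩
  have hbR : b ∉ R := fun h => hbad (h.2.resolve_left hb)
  have hoZ : OpenIn Z U := OpenIn.of_isOpen hZo sdiff_subset
  obtain ⟨ξ, hξ⟩ := exists_conn_of_ext_eq_zero (closedIn_opp ht hc.isOpen) hZ hoZ
    (b := cls Z a + cls Z b) (by
      rw [map_add, ext_cls hZo hc.isOpen hoZ haZ, ext_cls hZo hc.isOpen hoZ hbZ,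
        cls_eq_of_mem_cell hc.isOpen hβ hβU (hSβ haS) (hSβ hbS), H.add_self])
  have hlc : LC (U ∩ fold f) := (isOpen_lc hc.isOpen).closedIn ⟨_, isClosed_fold f, rfl⟩
  obtain ⟨e, he⟩ := CompactCohomology.exists_conn hlc (closedIn_opp_fold ht hc.isOpen) (same_eq U) ξ
  have hsame : same f σ U = Z ∩ fold f := by
    ext w; exact ⟨fun h => ⟨⟨h.1.1, fun h' => h'.2 h.2⟩, h.1.2⟩, fun h => hZfold w h.1 h.2⟩
  have hacyc : Acyc (n + 1) (same f σ U) := by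
    refine acyc_of_nowhere_dense hZo ⟨_, isClosed_fold f, hsame⟩ fun W hWZ hW hne => ?_
    obtain ⟨x, hx, hxD⟩ := ht.exists_notMem_fold hW hne
    exact ⟨x, hx, fun h => hxD h.1.2⟩
  rw [hacyc e] at he
  obtain ⟨s, rfl⟩ := he.exists_res (closedIn_opp_fold ht hc.isOpen) (same_eq U)
  obtain ⟨s', rfl⟩ := (hq.pull_bijective inter_subset_right n).2 s
  obtain ⟨t, hst⟩ := CompactCohomology.exists_conn (hq.lc hc.isOpen hc.sat) (hc.closedIn_on ht hq) (hc.quot_off ht hq) s'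
  have hpull := hst.pull (hq.properOn hc.sat)
    (hq.properOn (Sat.of_subset_fold inter_subset_right)) (hq.properOn (hc.sat_off ht)) (by
      rw [hq.preimage_image (hc.sat_off ht)]; exact (inter_eq_right.2 sdiff_subset).symm)
  have hoffo : OpenIn (U \ fold f) Z := OpenIn.of_isOpen (hc.off ht).isOpen hoffZ
  have hsh := hpull.shrink (closedIn_opp_fold ht hc.isOpen) hoffo
  have heq := Conn.unique (isOpen_lc hc.isOpen) (closedIn_opp ht hc.isOpen) hZ hsh hξ
  set φ : H (n + 1) (U \ fold f) →+ H (n + 1) (univ : Set (Sph n)) :=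
    (eps hRo).comp ((res hRc).comp (ext hoffo)) with hφ
  have hcls : ∀ w ∈ Z, eps hRo (res hRc (cls Z w)) = open Classical in if w ∈ R then gen n else 0 := by
    intro w hw
    split_ifs with hwR
    · rw [res_cls_of_mem hZo hRo hRc hwR, eps_cls hRo hwR]
    · rw [res_cls_of_notMem hZo hRc hw hwR, map_zero]
  have hφc : ∀ w ∈ U \ fold f, φ (cls (U \ fold f) w) = open Classical in if w ∈ R then gen n else 0 := by
    intro w hw
    rw [← hcls w (hoffZ hw), ← ext_cls (hc.off ht).isOpen hZo hoffo hw]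
    rfl
  have hker : pull (hq.properOn (hc.sat_off ht)) t ∈ φ.ker := by
    refine (AddSubgroup.closure_le φ.ker).2 ?_ (hc.pull_mem_closure ht hq t)
    rintro _ ⟨w, hw, rfl⟩
    have hσw : σ w ∈ U \ fold f := ⟨hc.stab w hw.1 hw.2, fun h => hw.2 (ht.sigma_mem_fold_iff.1 h)⟩
    show φ _ = 0
    rw [map_add, hφc w hw, hφc _ hσw]
    by_cases hwR : w ∈ R
    · rw [if_pos hwR, if_pos ((hRσ w hw).2 hwR), H.add_self]
    · rw [if_neg hwR, if_neg fun h => hwR ((hRσ w hw).1 h), add_zero]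
  have h1 : eps hRo (res hRc (ext hoffo (pull (hq.properOn (hc.sat_off ht)) t))) = 0 := hker
  rw [heq, map_add, map_add, hcls a haZ, hcls b hbZ, if_pos haR, if_neg hbR, add_zero] at h1
  exact gen_ne_zero h1

include hc ht in
lemma image_opp : f '' opp f σ U = B ∩ (f '' Uᶜ ∩ f '' U'ᶜ ∩ f '' fold f) := by
  ext y
  constructor
  · rintro ⟨w, hw, rfl⟩
    exact ⟨hc.map_mem hw.1.1, ⟨⟨σ w, hw.2, ht.map w⟩, w, fun h => disjoint_left.1 hc.disj hw.1.1 h,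
      rfl⟩, w, hw.1.2, rfl⟩
  · rintro ⟨hy, ⟨⟨u, hu, rfl⟩, v, hv, hvu⟩, x, hx, hxu⟩
    have hvB : v ∈ U ∪ U' := by rw [← hc.eq, mem_preimage, hvu]; exact hy
    have hvU := hvB.resolve_right hv
    refine ⟨v, ⟨⟨hvU, ht.mem_fold_of_eq (hvu.trans hxu.symm) hx⟩, ?_⟩, hvu⟩
    rcases ht.fib v u hvu.symm with rfl | rfl
    exacts [absurd hvU hu, hu]

include hc ht in
lemma closedIn_image_opp : ClosedIn (f '' opp f σ U) B :=
  ⟨_, (((hc.isOpen.isClosed_compl.isCompact.image ht.cont).isClosed.inter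
    (hc.isOpen'.isClosed_compl.isCompact.image ht.cont).isClosed).inter
    (isClosed_image_fold ht)), hc.image_opp ht⟩

include hc ht in
lemma opp_eq : opp f σ U = U ∩ f ⁻¹' (f '' opp f σ U) := by
  ext w
  refine ⟨fun hw => ⟨hw.1.1, w, hw, rfl⟩, ?_⟩
  rintro ⟨hw, v, hv, hvw⟩
  rcases ht.fib v w hvw.symm with rfl | rfl
  exacts [hv, absurd hw hv.2]

include hc ht in
lemma properOn_opp : ProperOn f (opp f σ U) (f '' opp f σ U) :=
  (hc.properOn ht.cont).restrict (hc.closedIn_image_opp ht).subset (hc.opp_eq ht)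

set_option maxHeartbeats 1000000 in
/-- There are no three nested fold cells as below. -/
lemma not_nested {U₁ U₁' B₁ U₃ U₃' B₃ β : Set (Sph n)} (h₁ : IsFoldCell f σ U₁ U₁' B₁)
    (h₃ : IsFoldCell f σ U₃ U₃' B₃) (hβ : IsCell β) (h12 : U₁ ⊆ U) (h12' : U₁' ⊆ U₃')
    (hB : B₁ ⊆ B₃) (hUβ : U ⊆ β) (hβU : β ⊆ U₃) (hne : U₁.Nonempty) (hne' : U₁'.Nonempty)
    (hbdd : ∀ w ∈ U₁, w ∉ fold f → hc.Bdd ht hq w) : False := by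
  obtain ⟨w, hw⟩ := ht.exists_notMem_fold h₁.isOpen hne
  obtain ⟨w', hw'⟩ := ht.exists_notMem_fold h₁.isOpen' hne'
  have h23 : U ⊆ U₃ := hUβ.trans hβU
  have h13 : U₁ ⊆ U₃ := h12.trans h23
  obtain ⟨v, hv⟩ := hbdd w hw.1 hw.2
  obtain ⟨u, hu⟩ := h₁.exists_conn ht hw hw'
  have hon12 : OpenIn (U₁ ∩ fold f) (U ∩ fold f) := (OpenIn.of_isOpen h₁.isOpen h12).inter _
  have hon23 : OpenIn (U ∩ fold f) (U₃ ∩ fold f) := (OpenIn.of_isOpen hc.isOpen h23).inter _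
  have hon13 : OpenIn (U₁ ∩ fold f) (U₃ ∩ fold f) := (OpenIn.of_isOpen h₁.isOpen h13).inter _
  have hg12 := hq.openIn_fold hon12 inter_subset_right
  have hg23 := hq.openIn_fold hon23 inter_subset_right
  have hg13 := hq.openIn_fold hon13 inter_subset_right
  have hoff : OpenIn (g '' (U₁ \ fold f)) (g '' (U \ fold f)) :=
    hq.openIn (h₁.off ht).isOpen (h₁.sat_off ht) (sdiff_subset_sdiff_left h12)
  set s := pull (hq.properOn_map (h₁.properOn_on ht)) u with hs
  have key := (h₁.conn_quot ht hq hw hw' hu).ext (hq.openIn h₁.isOpen h₁.sat h12) hg12 hoff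
    (image_mono sdiff_subset) (by
      rw [← hq.image_inter h₁.sat]
      congr 1
      ext x; exact ⟨fun hx => ⟨⟨h12 hx.1, hx.2⟩, hx.1⟩, fun hx => ⟨hx.2, hx.1.2⟩⟩)
  rw [hc.ext_qcls ht hq h₁ h12 hoff hw] at key
  have hsum := key.add hv
  rw [H.add_self] at hsum
  obtain ⟨η, hη⟩ := hsum.exists_res (hc.closedIn_on ht hq) (hc.quot_off ht hq)
  have hU3 : OpenIn U U₃ := OpenIn.of_isOpen hc.isOpen h23
  have hgU3 : OpenIn (g '' U) (g '' U₃) := hq.openIn hc.isOpen hc.sat h23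
  have hz : ext hU3 (pull (hq.properOn hc.sat) η) = 0 := by
    rw [← ext_ext (OpenIn.of_isOpen hc.isOpen hUβ) (OpenIn.of_isOpen hβ.isOpen hβU),
      hβ.acyc (ext _ _), map_zero]
  have hU : U = U₃ ∩ g ⁻¹' (g '' U) := by
    rw [hq.preimage_image hc.sat]; exact (inter_eq_right.2 h23).symm
  have hz' : res (h₃.closedIn_on ht hq) (ext hgU3 η) = 0 := by
    refine (hq.pull_bijective (S := U₃ ∩ fold f) inter_subset_right n).1 ?_
    rw [map_zero]
    have e : pull (hq.properOn h₃.sat) (ext hgU3 η) = 0 := by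
      rw [pull_ext _ hgU3 hU3 (hq.properOn hc.sat) hU, hz]
    have e' := congrArg (res (A := U₃ ∩ fold f) ⟨_, isClosed_fold f, rfl⟩) e
    rw [map_zero] at e'
    rw [← e']
    exact pull_pull_eq (f := g) (g := id) (f' := id) (g' := g) (h₃.closedIn_on ht hq).properOn
      (hq.properOn (Sat.of_subset_fold inter_subset_right))
      (hq.properOn h₃.sat) (ClosedIn.properOn ⟨_, isClosed_fold f, rfl⟩) (fun x _ => rfl) _
  have hso : g '' (U ∩ fold f) = g '' U ∩ g '' (U₃ ∩ fold f) := by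
    rw [← hq.image_inter (Sat.of_subset_fold inter_subset_right)]
    congr 1
    ext x; exact ⟨fun hx => ⟨hx.1, h23 hx.1, hx.2⟩, fun hx => ⟨hx.1, hx.2.2⟩⟩
  rw [res_ext (h₃.closedIn_on ht hq) hgU3 hg23 (hc.closedIn_on ht hq) hso, hη, map_add,
    H.add_eq_zero, ext_ext hg12 hg23 hg13] at hz'
  have hT3 := hq.closedIn_fold (closedIn_opp_fold ht h₃.isOpen) inter_subset_right
  have hT1 := hq.closedIn_fold (closedIn_opp_fold ht h₁.isOpen) inter_subset_right
  have hd : Disjoint (g '' opp f σ U₃) (g '' same f σ U) := by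
    rw [disjoint_left]
    rintro _ ⟨x, hx, rfl⟩ ⟨y, hy, hxy⟩
    rcases hq.eq x y hxy with rfl | rfl
    · exact hx.2 (h23 hy.2)
    · rw [flip_of_mem hx.1.2] at hy; exact hx.2 (h23 hy.2)
  have hsm := openIn_same_fold ht hc.isOpen
  have hsm3 := hq.openIn_fold (hsm.trans hon23) inter_subset_right
  have hTopp : opp f σ U₁ = (U₁ ∩ fold f) ∩ opp f σ U₃ := by
    ext x
    constructor
    · intro hx
      refine ⟨hx.1, ⟨h13 hx.1.1, hx.1.2⟩, fun h => ?_⟩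
      have : σ x ∈ U₁ ∪ U₁' := by rw [← h₁.eq, mem_preimage, ht.map]; exact h₁.map_mem hx.1.1
      exact disjoint_left.1 h₃.disj h (h12' (this.resolve_left hx.2))
    · rintro ⟨h1, h2⟩
      exact ⟨h1, fun h => h2.2 (h13 h)⟩
  have hToo : OpenIn (opp f σ U₁) (opp f σ U₃) := by
    obtain ⟨O, hO, hO'⟩ := hon13
    refine ⟨O, hO, ?_⟩
    rw [hTopp, hO']
    ext x; exact ⟨fun hx => ⟨hx.2, hx.1.2⟩, fun hx => ⟨⟨hx.1.1, hx.2⟩, hx.1⟩⟩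
  have hTo := hq.openIn_fold hToo ((opp_subset U₃).trans inter_subset_right)
  have e3 := congrArg (res hT3) hz'
  rw [ext_ext _ hg23 hsm3, res_ext_of_disjoint hT3 hsm3 hd, res_ext hT3 hg13 hTo hT1 (by
    rw [← hq.image_inter (Sat.of_subset_fold ((opp_subset U₃).trans inter_subset_right)),
      ← hTopp])] at e3
  -- transport to the target
  have hE1 : ClosedIn (f '' opp f σ U₁) (B₁ ∩ f '' fold f) :=
    (h₁.closedIn_image_opp ht).restrict (fun y hy => by
      refine ⟨(h₁.closedIn_image_opp ht).subset hy, ?_⟩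
      obtain ⟨x, hx, rfl⟩ := hy; exact ⟨x, hx.1.2, rfl⟩) inter_subset_left
  have hEo : f '' opp f σ U₁ = f '' opp f σ U₃ ∩ B₁ := by
    ext y
    constructor
    · rintro ⟨x, hx, rfl⟩
      exact ⟨⟨x, hToo.subset hx, rfl⟩, h₁.map_mem hx.1.1⟩
    · rintro ⟨⟨x, hx, rfl⟩, hxB⟩
      have h1 : x ∈ U₁ ∪ U₁' := by rw [← h₁.eq]; exact hxB
      have hx1 : x ∈ U₁ := h1.resolve_right fun h => disjoint_left.1 h₃.disj hx.1.1 (h12' h)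
      exact ⟨x, ⟨⟨hx1, hx.1.2⟩, fun h => hx.2 (h13 h)⟩, rfl⟩
  have hEoo : OpenIn (f '' opp f σ U₁) (f '' opp f σ U₃) := ⟨B₁, h₁.openB, hEo⟩
  have hp1 := hq.properOn_map (h₁.properOn_opp ht)
  have hp3 := hq.properOn_map (h₃.properOn_opp ht)
  have e4 : res hT1 s = pull hp1 (res hE1 u) :=
    pull_pull_eq (f := id) (g := h) (f' := h) (g' := id)
      (hq.properOn_map (h₁.properOn_on ht)) hT1.properOn hE1.properOn hp1 (fun x _ => rfl) u
  have hpre : opp f σ U₁ = opp f σ U₃ ∩ f ⁻¹' (f '' opp f σ U₁) := by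
    rw [hEo]
    ext x
    constructor
    · intro hx
      exact ⟨hToo.subset hx, ⟨x, hToo.subset hx, rfl⟩, h₁.map_mem hx.1.1⟩
    · rintro ⟨hx, -, hxB⟩
      have h1 : x ∈ U₁ ∪ U₁' := by rw [← h₁.eq]; exact hxB
      have hx1 : x ∈ U₁ := h1.resolve_right fun h => disjoint_left.1 h₃.disj hx.1.1 (h12' h)
      exact ⟨⟨hx1, hx.1.2⟩, fun h => hx.2 (h13 h)⟩
  rw [e4, ← pull_ext hp3 hEoo hTo hp1 (hq.image_eq hpre)] at e3
  have : Nonempty Q := ⟨g (Classical.arbitrary _)⟩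
  obtain ⟨hi, hhi⟩ := HomOn.of_properOn hp3 (by
      rintro _ ⟨x, hx, rfl⟩ _ ⟨y, hy, rfl⟩ hxy
      rw [hq.map, hq.map] at hxy
      rcases ht.fib y x hxy with rfl | rfl
      · rfl
      · exact absurd hx.1.1 hy.2) (by
      rintro _ ⟨x, hx, rfl⟩
      exact ⟨g x, ⟨x, hx, rfl⟩, hq.map x⟩)
  have e5 : ext hEoo (res hE1 u) = 0 := by
    refine (hhi.pull_bijective n).1 ?_
    rw [map_zero]; exact e3
  have hEf : ∀ y ∈ f '' opp f σ U₃, y ∈ f '' fold f := by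
    rintro _ ⟨x, hx, rfl⟩; exact ⟨x, hx.1.2, rfl⟩
  have hO1 : IsOpen (B₁ \ f '' opp f σ U₁) := by
    obtain ⟨O, hO, hO'⟩ := (h₁.closedIn_image_opp ht).diff
    rw [hO']; exact h₁.openB.inter hO
  have hO3 : IsOpen (B₃ \ f '' opp f σ U₃) := by
    obtain ⟨O, hO, hO'⟩ := (h₃.closedIn_image_opp ht).diff
    rw [hO']; exact h₃.openB.inter hO
  have ho1 : OpenIn (B₁ \ f '' fold f) (B₁ \ f '' opp f σ U₁) :=
    OpenIn.of_isOpen (h₁.off ht).openB fun y hy => ⟨hy.1, fun h => hy.2 (hEf y (hEoo.subset h))⟩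
  have ho3 : OpenIn (B₁ \ f '' opp f σ U₁) (B₃ \ f '' opp f σ U₃) :=
    OpenIn.of_isOpen hO1 fun y hy => ⟨hB hy.1, fun h => hy.2 (by rw [hEo]; exact ⟨h, hy.1⟩)⟩
  have hsh := (hu.shrink hE1 ho1).ext (OpenIn.of_isOpen h₁.openB hB) hEoo ho3 sdiff_subset hEo
  rw [e5] at hsh
  have hfin := Conn.eq_zero (isOpen_lc h₃.openB) (h₃.closedIn_image_opp ht) rfl hsh
  have hzw := (h₁.off ht).map_mem hw
  have hzw' := (h₁.off ht).symm.map_mem hw'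
  rw [map_add, ext_cls (h₁.off ht).openB hO1 ho1 hzw, ext_cls (h₁.off ht).openB hO1 ho1 hzw', map_add,
    ext_cls hO1 hO3 ho3 (ho1.subset hzw), ext_cls hO1 hO3 ho3 (ho1.subset hzw')] at hfin
  set O := B₃ \ f '' U₃'ᶜ with hO
  have hOo : IsOpen O := h₃.openB.sdiff (h₃.isOpen'.isClosed_compl.isCompact.image ht.cont).isClosed
  have hOc : ClosedIn O (B₃ \ f '' opp f σ U₃) := by
    refine ⟨f '' U₃ᶜ, (h₃.isOpen.isClosed_compl.isCompact.image ht.cont).isClosed, ?_⟩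
    ext y
    constructor
    · rintro ⟨h1, h2⟩
      refine ⟨⟨h1, ?_⟩, ?_⟩
      · rintro ⟨x, hx, rfl⟩
        exact h2 ⟨x, fun h => disjoint_left.1 h₃.disj hx.1.1 h, rfl⟩
      · obtain ⟨x, rfl⟩ := ht.surj y
        exact ⟨x, fun hx => h2 ⟨x, fun h => disjoint_left.1 h₃.disj hx h, rfl⟩, rfl⟩
    · rintro ⟨⟨h1, h2⟩, x, hx, rfl⟩
      refine ⟨h1, ?_⟩
      rintro ⟨y, hy, hyx⟩
      have hyU : y ∈ U₃ ∪ U₃' := by rw [← h₃.eq, mem_preimage, hyx]; exact h1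
      have hyU := hyU.resolve_right hy
      have hxy : x = σ y := ht.eq_of_ne hyx.symm (by rintro rfl; exact hx hyU)
      have hyD : y ∈ fold f := by
        by_contra hD
        exact hx (hxy ▸ h₃.stab y hyU hD)
      exact h2 ⟨y, ⟨⟨hyU, hyD⟩, hxy ▸ hx⟩, hyx⟩
  have hz'O : f w' ∈ O := by
    refine ⟨hB hzw'.1, ?_⟩
    rintro ⟨y, hy, hyx⟩
    rcases ht.fib w' y hyx with rfl | rfl
    exacts [hy (h12' hw'.1), hy (h12' (h₁.stab' w' hw'.1 hw'.2))]
  have hzO : f w ∉ O := fun h => h.2 ⟨w, fun h' => disjoint_left.1 h₃.disj (h13 hw.1) h', rfl⟩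
  have e6 := congrArg (res hOc) hfin
  rw [map_add, res_cls_of_mem hO3 hOo hOc hz'O, res_cls_of_notMem hO3 hOc (ho3.subset (ho1.subset hzw)) hzO,
    map_zero, zero_add] at e6
  exact cls_ne_zero hOo hz'O e6

end IsFoldCell

/-- Opposite points of the fold stay a definite distance apart. -/
lemma IsTwo.exists_gap (ht : IsTwo f σ) : ∃ ε > 0, ∀ x ∈ fold f, ε ≤ dist x (σ x) := by
  obtain ⟨g, h, hq⟩ := ht.exists_isQuot
  by_contra! hcon
  choose x hxD hx using fun k : ℕ => hcon (1 / ((k : ℝ) + 1)) (by positivity)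
  obtain ⟨p, hp, φ, hφ, hlim⟩ := (isClosed_fold f).isCompact.tendsto_subseq hxD
  have hdist : Filter.Tendsto (fun k => dist ((x ∘ φ) k) (σ (x (φ k)))) Filter.atTop (nhds 0) := by
    refine squeeze_zero (fun _ => dist_nonneg) (fun k => (hx (φ k)).le) ?_
    exact tendsto_one_div_add_atTop_nhds_zero_nat.comp hφ.tendsto_atTop
  have hlim' : Filter.Tendsto (fun k => σ (x (φ k))) Filter.atTop (nhds p) :=
    (tendsto_iff_of_dist hdist).1 hlim
  obtain ⟨P, P', hP, hP', hpP, hpP', hd⟩ := t2_separation (ht.ne p).symm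
  obtain ⟨U₃, U₃', B₃, h₃, hp3, hp3', -, -, -⟩ :=
    ht.exists_foldCell hp hP hP' hpP hpP' hd isOpen_univ (mem_univ _)
  obtain ⟨β₂, hβ₂, hpβ₂, hβU₂⟩ := exists_cell h₃.isOpen hp3
  obtain ⟨U₂, U₂', B₂, h₂, hp2, hp2', hB₂, hU₂, hU₂'⟩ := ht.exists_foldCell hp hβ₂.isOpen h₃.isOpen'
    hpβ₂ hp3' (h₃.disj.mono_left hβU₂) h₃.openB (h₃.map_mem hp3)
  obtain ⟨β₁, hβ₁, hpβ₁, hβU₁⟩ := exists_cell h₂.isOpen hp2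
  obtain ⟨U₁, U₁', B₁, h₁, hp1, hp1', hB₁, hU₁, hU₁'⟩ := ht.exists_foldCell hp hβ₁.isOpen h₂.isOpen'
    hpβ₁ hp2' (h₂.disj.mono_left hβU₁) h₂.openB (h₂.map_mem hp2)
  obtain ⟨k, hk, hk'⟩ := ((hlim.eventually (h₁.isOpen.mem_nhds hp1)).and
    (hlim'.eventually (h₁.isOpen.mem_nhds hp1))).exists
  have h12 : U₁ ⊆ U₂ := hU₁.trans hβU₁
  exact h₂.not_nested ht hq h₁ h₃ hβ₂ h12 (hU₁'.trans hU₂') (hB₁.trans hB₂) hU₂ hβU₂ ⟨p, hp1⟩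
    ⟨_, hp1'⟩ fun w hw hwD => h₂.bdd_of_cell ht hq hβ₁ hβU₁ h₁.isOpen hU₁ hk
      ⟨⟨h12 hk, hxD _⟩, h12 hk'⟩ hw hwD

end Gap

section Monodromy

variable {n : ℕ} [hn : Fact (2 ≤ n)] {f σ τ : Sph n → Sph n}

lemma IsTwo.exists_gap_of_fold_eq_empty (ht : IsTwo f σ) (hD : fold f = ∅) :
    ∃ ε > 0, ∀ x, ε ≤ dist x (σ x) := by
  by_contra! hcon
  choose x hx using fun k : ℕ => hcon (1 / ((k : ℝ) + 1)) (by positivity)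
  obtain ⟨p, -, φ, hφ, hlim⟩ := isCompact_univ.tendsto_subseq fun k => mem_univ (x k)
  have hdist : Filter.Tendsto (fun k => dist ((x ∘ φ) k) (σ (x (φ k)))) Filter.atTop (nhds 0) := by
    refine squeeze_zero (fun _ => dist_nonneg) (fun k => (hx (φ k)).le) ?_
    exact tendsto_one_div_add_atTop_nhds_zero_nat.comp hφ.tendsto_atTop
  have hlim' : Filter.Tendsto (fun k => σ (x (φ k))) Filter.atTop (nhds p) :=
    (tendsto_iff_of_dist hdist).1 hlim
  obtain ⟨W, hW, hpW, hi⟩ := ht.exists_injOn (x := p) (by rw [hD]; exact notMem_empty p)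
  obtain ⟨k, hk, hk'⟩ := ((hlim.eventually (hW.mem_nhds hpW)).and
    (hlim'.eventually (hW.mem_nhds hpW))).exists
  exact ht.ne _ (hi hk' hk (ht.map _))

/-- `w` and `w'` agree up to `τ` and an error less than `η`. -/
def Close (τ : Sph n → Sph n) (η : ℝ) (w w' : Sph n) : Prop := dist w w' < η ∨ dist (τ w) w' < η

/-- A labelling of `f ⁻¹' B` by sheets. -/
structure IsLabel (f σ τ : Sph n → Sph n) (η : ℝ) (B : Set (Sph n)) (lab : Sph n → ZMod 2) :
    Prop where
  close : ∀ w ∈ f ⁻¹' B, ∀ w' ∈ f ⁻¹' B, Close τ η w w' ↔ lab w = lab w'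
  inv : ∀ w ∈ f ⁻¹' B, lab (τ w) = lab w
  swap : ∀ w ∈ f ⁻¹' B, τ w = w → lab (σ w) ≠ lab w

lemma IsTwo.exists_nhds_image (ht : IsTwo f σ) {p : Sph n} {U : Set (Sph n)} (hU : IsOpen U)
    (hp : p ∈ U) (hp' : σ p ∈ U) : ∃ B, IsOpen B ∧ f p ∈ B ∧ f ⁻¹' B ⊆ U := by
  refine ⟨(f '' Uᶜ)ᶜ, (hU.isClosed_compl.isCompact.image ht.cont).isClosed.isOpen_compl, ?_,
    fun x hx => ?_⟩
  · rintro ⟨x, hx, hxp⟩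
    rcases ht.fib p x hxp with rfl | rfl
    exacts [hx hp, hx hp']
  · by_contra h
    exact hx ⟨x, h, rfl⟩

variable (ht : IsTwo f σ) (hτ : Continuous τ) (hττ : ∀ x, τ (τ x) = x)
  (hτσ : ∀ x, τ x = x ∨ τ x = σ x) {η : ℝ} (hη : 0 < η)
  (hgap : ∀ x, τ x = x → 4 * η ≤ dist x (σ x))

include ht hτ hττ hτσ hη hgap in
open Classical in
lemma exists_isLabel (y : Sph n) : ∃ B lab, IsOpen B ∧ y ∈ B ∧ IsLabel f σ τ η B lab := by
  obtain ⟨p, rfl⟩ := ht.surj y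
  have hclosed : IsClosed {x | τ x = x} := isClosed_eq hτ continuous_id
  have hη2 : 0 < η / 2 := by positivity
  by_cases hD : ∃ x, τ x = x ∧ f x = f p
  · obtain ⟨q, hq, hqp⟩ := hD
    rw [← hqp]
    have hq' : τ (σ q) = σ q := by
      rcases hτσ (σ q) with h | h
      · exact h
      · rw [ht.invol] at h
        exact absurd (by rw [← hττ (σ q), h, hq]) (ht.ne q)
    have hfar : ∀ a ∈ ball q (η / 2), ∀ b ∈ ball (σ q) (η / 2), 3 * η ≤ dist a b := by
      intro a ha b hb
      have h1 := hgap q hq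
      have h2 := dist_triangle4 q a b (σ q)
      rw [mem_ball] at ha hb
      rw [dist_comm q a] at h2
      linarith
    have hnear : ∀ c : Sph n, ∀ a ∈ ball c (η / 2), ∀ b ∈ ball c (η / 2), dist a b < η := by
      intro c a ha b hb
      have := dist_triangle_right a b c
      rw [mem_ball] at ha hb
      linarith
    obtain ⟨B, hB, hqB, hBU⟩ := ht.exists_nhds_image (p := q)
      (U := (ball q (η / 2) ∩ τ ⁻¹' ball q (η / 2)) ∪ (ball (σ q) (η / 2) ∩ τ ⁻¹' ball (σ q) (η / 2)))
      ((isOpen_ball.inter (isOpen_ball.preimage hτ)).union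
        (isOpen_ball.inter (isOpen_ball.preimage hτ)))
      (Or.inl ⟨mem_ball_self hη2, by rw [mem_preimage, hq]; exact mem_ball_self hη2⟩)
      (Or.inr ⟨mem_ball_self hη2, by rw [mem_preimage, hq']; exact mem_ball_self hη2⟩)
    set lab : Sph n → ZMod 2 := fun w => if w ∈ ball q (η / 2) then 0 else 1 with hlab
    have l0 : ∀ w ∈ ball q (η / 2), lab w = 0 := fun w hw => if_pos hw
    have l1 : ∀ w ∈ ball (σ q) (η / 2), lab w = 1 := fun w hw => if_neg fun h => by
      have := hfar w h w hw
      rw [dist_self] at this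
      linarith
    have h01 : (0 : ZMod 2) ≠ 1 := zero_ne_one
    refine ⟨B, lab, hB, hqB, ⟨fun w hw w' hw' => ?_, fun w hw => ?_, fun w hw hwτ => ?_⟩⟩
    · rcases hBU hw with ⟨h1, h2⟩ | ⟨h1, h2⟩ <;> rcases hBU hw' with ⟨h3, h4⟩ | ⟨h3, h4⟩
      · rw [l0 w h1, l0 w' h3]
        exact iff_of_true (Or.inl (hnear _ _ h1 _ h3)) rfl
      · rw [l0 w h1, l1 w' h3]
        refine iff_of_false ?_ h01
        have e1 := hfar _ h1 _ h3
        have e2 := hfar _ h2 _ h3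
        rintro (h | h) <;> linarith
      · rw [l1 w h1, l0 w' h3]
        refine iff_of_false ?_ h01.symm
        have e1 := hfar _ h3 _ h1
        have e2 := hfar _ h3 _ h2
        rw [dist_comm] at e1 e2
        rintro (h | h) <;> linarith
      · rw [l1 w h1, l1 w' h3]
        exact iff_of_true (Or.inl (hnear _ _ h1 _ h3)) rfl
    · rcases hBU hw with ⟨h1, h2⟩ | ⟨h1, h2⟩
      · rw [l0 w h1, l0 _ h2]
      · rw [l1 w h1, l1 _ h2]
    · have hg := hgap w hwτ
      have hσw : σ w ∈ f ⁻¹' B := by rw [mem_preimage, ht.map]; exact hw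
      rcases hBU hw with ⟨h1, h2⟩ | ⟨h1, h2⟩ <;> rcases hBU hσw with ⟨h3, h4⟩ | ⟨h3, h4⟩
      · have := hnear _ _ h1 _ h3
        linarith
      · rw [l0 w h1, l1 _ h3]; exact h01.symm
      · rw [l1 w h1, l0 _ h3]; exact h01
      · have := hnear _ _ h1 _ h3
        linarith
  · push Not at hD
    have hp : τ p = σ p := (hτσ p).resolve_left fun h => hD p h rfl
    obtain ⟨V, hV⟩ : ∃ V, V = ball p (η / 2) ∩ τ ⁻¹' ball (τ p) (η / 2) := ⟨_, rfl⟩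
    have hVm : ∀ w, w ∈ V ↔ w ∈ ball p (η / 2) ∧ τ w ∈ ball (τ p) (η / 2) := fun w => by
      rw [hV, mem_inter_iff, mem_preimage]
    have hVo : IsOpen V := hV ▸ isOpen_ball.inter (isOpen_ball.preimage hτ)
    have hpV : p ∈ V := (hVm p).2 ⟨mem_ball_self hη2, mem_ball_self hη2⟩
    obtain ⟨B, hB, hpB, hBU⟩ := ht.exists_nhds_image (p := p) (U := V ∪ τ ⁻¹' V)
      (hVo.union (hVo.preimage hτ)) (Or.inl hpV)
      (Or.inr (by rw [mem_preimage, ← hp, hττ]; exact hpV))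
    have hnear : ∀ c : Sph n, ∀ a ∈ ball c (η / 2), ∀ b ∈ ball c (η / 2), dist a b < η := by
      intro c a ha b hb
      have := dist_triangle_right a b c
      rw [mem_ball] at ha hb
      linarith
    have hpD : f p ∉ f '' {x | τ x = x} := by
      rintro ⟨x, hx, hxp⟩
      exact hD x hx hxp
    refine ⟨B \ f '' {x | τ x = x}, fun _ => 0,
      hB.sdiff (hclosed.isCompact.image ht.cont).isClosed, ⟨hpB, hpD⟩,
      ⟨fun w hw w' hw' => iff_of_true ?_ rfl, fun w hw => rfl, fun w hw hwτ => ?_⟩⟩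
    · have key : ∀ w, τ w ∈ V → w ∈ ball (τ p) (η / 2) ∧ τ w ∈ ball p (η / 2) := fun w hw => by
        rw [hVm, hττ] at hw
        exact hw.symm
      have hsplit : ∀ w ∈ f ⁻¹' (B \ f '' {x | τ x = x}), w ∈ V ∨ τ w ∈ V := fun w hw => hBU hw.1
      rcases hsplit w hw with h1 | h1 <;> rcases hsplit w' hw' with h3 | h3
      · exact Or.inl (hnear _ _ ((hVm w).1 h1).1 _ ((hVm w').1 h3).1)
      · exact Or.inr (hnear _ _ ((hVm w).1 h1).2 _ (key w' h3).1)
      · exact Or.inr (hnear _ _ (key w h1).2 _ ((hVm w').1 h3).1)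
      · exact Or.inl (hnear _ _ (key w h1).1 _ (key w' h3).1)
    · exact absurd ⟨w, hwτ, rfl⟩ hw.2

include ht hτ hττ hτσ hη hgap in
open Classical in
lemma monodromy_contradiction {p : Sph n} (hp : τ p = p) : False := by
  choose s hs using ht.surj
  choose B lab hB hyB hlab using exists_isLabel ht hτ hττ hτσ hη hgap
  obtain ⟨δ, hδ, hδB⟩ := lebesgue_number_lemma_of_metric (isCompact_univ (X := Sph n)) hB
    (fun y _ => mem_iUnion.2 ⟨y, hyB y⟩)
  set P : Sph n → Sph n → ZMod 2 := fun y y' => if Close τ η (s y) (s y') then 0 else 1 with hP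
  have hPlab : ∀ i, ∀ y ∈ B i, ∀ y' ∈ B i, P y y' = lab i (s y) + lab i (s y') := by
    intro i y hy y' hy'
    have h1 := (hlab i).close (s y) (by rwa [mem_preimage, hs]) (s y') (by rwa [mem_preimage, hs])
    have h2 : ∀ a b : ZMod 2, (if a = b then (0 : ZMod 2) else 1) = a + b := by decide
    rw [← h2]
    simp only [hP, h1]
  set φ : List (Sph n) → ZMod 2 := fun l =>
    match l with
    | [y, y'] => P y y'
    | _ => 0 with hφ
  have hc : Cocyc 2 univ φ := by
    refine ⟨⟨univ, subset_rfl, isCompact_univ, fun l _ hl => ?_⟩, δ, hδ, fun l hl _ hsm => ?_⟩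
    · rcases l with _ | ⟨a, l⟩
      · rfl
      · exact absurd (mem_univ a) (hl a (by simp))
    · obtain ⟨a, b, c, rfl⟩ := List.length_eq_three.1 hl
      obtain ⟨i, hi⟩ := hδB a (mem_univ a)
      have ha : a ∈ B i := hi (mem_ball_self hδ)
      have hb : b ∈ B i := hi (mem_ball.2 (hsm b (by simp) a (by simp)))
      have hc : c ∈ B i := hi (mem_ball.2 (hsm c (by simp) a (by simp)))
      simp only [d_cons, d_nil, hφ, hPlab i a ha b hb, hPlab i a ha c hc, hPlab i b hb c hc]
      generalize lab i (s a) = u, lab i (s b) = v, lab i (s c) = w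
      revert u v w; decide
  obtain ⟨ψ, -, ε, hε, hψ⟩ := mk_eq_zero.1 (acyc_two_sphere (mk hc))
  have hψ2 : ∀ y y' : Sph n, dist y y' < ε → P y y' = ψ [y] + ψ [y'] := by
    intro y y' hd
    have h1 := hψ [y, y'] rfl (fun _ _ => mem_univ _) (by
      intro a ha b hb
      simp only [List.mem_cons, List.not_mem_nil, or_false] at ha hb
      rcases ha with rfl | rfl <;> rcases hb with rfl | rfl
      · rwa [dist_self]
      · exact hd
      · rwa [dist_comm]
      · rwa [dist_self])
    simp only [Pi.add_apply, d_cons, d_nil, hφ] at h1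
    have key : ∀ u v w : ZMod 2, u + (w + (v + 0)) = 0 → u = v + w := by decide
    exact key _ _ _ h1
  set G : Sph n → ZMod 2 := fun x =>
    ψ [f x] + if x = s (f x) ∨ x = τ (s (f x)) then 0 else 1 with hG
  have he : ∀ i, ∀ x ∈ f ⁻¹' B i, (if x = s (f x) ∨ x = τ (s (f x)) then (0 : ZMod 2) else 1) =
      lab i x + lab i (s (f x)) := by
    intro i x hx
    have hsB : s (f x) ∈ f ⁻¹' B i := by rw [mem_preimage, hs]; exact hx
    have h2 : ∀ a b : ZMod 2, a ≠ b → a + b = 1 := by decide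
    split_ifs with h
    · have : lab i x = lab i (s (f x)) := by
        rcases h with h | h
        · exact congrArg (lab i) h
        · rw [← (hlab i).inv _ hsB]; exact congrArg (lab i) h
      rw [this, add_self_zmod]
    · push Not at h
      have hxs : x = σ (s (f x)) := ht.eq_of_ne (hs (f x)).symm h.1
      have hfix : τ (s (f x)) = s (f x) := (hτσ _).resolve_right fun h' => h.2 (h' ▸ hxs)
      have := (hlab i).swap _ hsB hfix
      rw [← hxs] at this
      exact (h2 _ _ this).symm
  have hloc : IsLocallyConstant G := by
    rw [IsLocallyConstant.iff_eventually_eq]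
    intro x
    obtain ⟨i, hi⟩ := hδB (f x) (mem_univ _)
    have hx : f x ∈ B i := hi (mem_ball_self hδ)
    filter_upwards [ht.cont.continuousAt.preimage_mem_nhds ((hB i).mem_nhds hx),
      ht.cont.continuousAt.preimage_mem_nhds (ball_mem_nhds (f x) hε), ball_mem_nhds x hη] with
      x' h1 h2 h3
    have e1 := hψ2 (f x') (f x) (mem_ball.1 h2)
    rw [hPlab i _ h1 _ hx] at e1
    have e2 : lab i x' = lab i x := ((hlab i).close x' h1 x hx).1 (Or.inl (mem_ball.1 h3))
    have key : ∀ u v w a b : ZMod 2, w + v = b + a → b + (u + w) = a + (u + v) := by decide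
    simp only [hG, he i x hx, he i x' h1, e2]
    exact key _ _ _ _ _ e1
  have hrank : 1 < Module.rank ℝ (EuclideanSpace ℝ (Fin (n + 1))) := by
    have := hn.out
    rw [← Module.finrank_eq_rank, finrank_euclideanSpace_fin]
    exact_mod_cast (by omega : 1 < n + 1)
  have : PreconnectedSpace (Sph n) :=
    isPreconnected_iff_preconnectedSpace.1 (isPreconnected_sphere hrank _ _)
  have hG' := hloc.apply_eq_of_preconnectedSpace (σ p) p
  have hpB := hyB (f p)
  have hσp : σ p ∈ f ⁻¹' B (f p) := by rw [mem_preimage, ht.map]; exact hpB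
  have hsw := (hlab (f p)).swap p hpB hp
  have hσe := he _ _ hσp
  rw [ht.map] at hσe
  simp only [hG, ht.map, hσe, he _ p hpB] at hG'
  exact hsw (add_right_cancel (add_left_cancel hG'))

end Monodromy

theorem not_isTwo {n : ℕ} [hn : Fact (2 ≤ n)] {f σ : Sph n → Sph n} (ht : IsTwo f σ) : False := by
  rcases (fold f).eq_empty_or_nonempty with hD | ⟨p, hp⟩
  · obtain ⟨ε, hε, hgap⟩ := ht.exists_gap_of_fold_eq_empty hD
    exact monodromy_contradiction (τ := id) (η := ε / 4) ht continuous_id (fun _ => rfl)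
      (fun _ => Or.inl rfl) (by positivity) (fun x _ => by linarith [hgap x])
      (p := Classical.arbitrary _) rfl
  · obtain ⟨ε, hε, hgap⟩ := ht.exists_gap
    refine monodromy_contradiction (τ := flip f σ) (η := ε / 4) ht ht.continuous_flip ht.flip_flip
      (fun x => ?_) (by positivity) (fun x hx => ?_) (flip_of_mem hp)
    · by_cases hx : x ∈ fold f
      exacts [Or.inl (flip_of_mem hx), Or.inr (flip_of_notMem hx)]
    · have : x ∈ fold f := by
        by_contra h
        rw [flip_of_notMem h] at hx
        exact ht.ne x hx
      linarith [hgap x this]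

section Doubling

/-- The doubling map on pairs of real coordinates. -/
noncomputable def double (p : EuclideanSpace ℝ (Fin 2)) : EuclideanSpace ℝ (Fin 2) :=
  !₂[p 0 ^ 2 - p 1 ^ 2, 2 * p 0 * p 1]

lemma continuous_double : Continuous double := by
  unfold double
  refine (PiLp.continuous_toLp 2 _).comp (continuous_pi fun i => ?_)
  fin_cases i <;> simp <;> fun_prop

lemma mem_circle {p : EuclideanSpace ℝ (Fin 2)} :
    p ∈ sphere (0 : EuclideanSpace ℝ (Fin 2)) 1 ↔ p 0 ^ 2 + p 1 ^ 2 = 1 := by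
  rw [mem_sphere_zero_iff_norm, EuclideanSpace.norm_eq, Real.sqrt_eq_one, Fin.sum_univ_two]
  simp

lemma double_mem {p : EuclideanSpace ℝ (Fin 2)}
    (hp : p ∈ sphere (0 : EuclideanSpace ℝ (Fin 2)) 1) :
    double p ∈ sphere (0 : EuclideanSpace ℝ (Fin 2)) 1 := by
  rw [mem_circle] at hp ⊢
  have h0 : double p 0 = p 0 ^ 2 - p 1 ^ 2 := rfl
  have h1 : double p 1 = 2 * p 0 * p 1 := rfl
  rw [h0, h1]
  linear_combination (p 0 ^ 2 + p 1 ^ 2 + 1) * hp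

lemma exists_double_eq {q : EuclideanSpace ℝ (Fin 2)}
    (hq : q ∈ sphere (0 : EuclideanSpace ℝ (Fin 2)) 1) :
    ∃ p ∈ sphere (0 : EuclideanSpace ℝ (Fin 2)) 1, double p = q := by
  rw [mem_circle] at hq
  obtain ⟨a, b, h1, h2, h3⟩ :
      ∃ a b : ℝ, a ^ 2 + b ^ 2 = 1 ∧ a ^ 2 - b ^ 2 = q 0 ∧ 2 * a * b = q 1 := by
    have hc : 0 ≤ (1 + q 0) / 2 := by nlinarith [sq_nonneg (q 1)]
    rcases hc.eq_or_lt with h | h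
    · have h0 : q 0 = -1 := by linarith
      have h1 : q 1 = 0 := by rw [h0] at hq; nlinarith
      exact ⟨0, 1, by norm_num, by rw [h0]; norm_num, by rw [h1]; norm_num⟩
    · have hs := Real.sq_sqrt hc
      have hpos := Real.sqrt_pos.2 h
      set a := Real.sqrt ((1 + q 0) / 2)
      have hb : (q 1 / (2 * a)) ^ 2 = (1 - q 0) / 2 := by
        rw [div_pow, div_eq_iff (by positivity), mul_pow, hs]
        linear_combination hq
      refine ⟨a, q 1 / (2 * a), ?_, ?_, ?_⟩
      · rw [hb, hs]; ring
      · rw [hb, hs]; ring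
      · field_simp
  refine ⟨!₂[a, b], mem_circle.2 h1, ?_⟩
  ext i
  fin_cases i
  exacts [h2, h3]

lemma eq_or_eq_neg_of_double_eq {p q : EuclideanSpace ℝ (Fin 2)}
    (hp : p ∈ sphere (0 : EuclideanSpace ℝ (Fin 2)) 1)
    (hq : q ∈ sphere (0 : EuclideanSpace ℝ (Fin 2)) 1) (h : double q = double p) :
    q = p ∨ q = -p := by
  rw [mem_circle] at hp hq
  have h0 : q 0 ^ 2 - q 1 ^ 2 = p 0 ^ 2 - p 1 ^ 2 := congrFun (congrArg WithLp.ofLp h) 0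
  have h1 : 2 * q 0 * q 1 = 2 * p 0 * p 1 := congrFun (congrArg WithLp.ofLp h) 1
  have e0 : q 0 ^ 2 = p 0 ^ 2 := by linarith
  have e1 : q 1 ^ 2 = p 1 ^ 2 := by linarith
  have hsq : (p 0 * q 0 + p 1 * q 1) ^ 2 = 1 ^ 2 := by
    linear_combination (p 0 ^ 2) * e0 + p 1 ^ 2 * e1 + p 0 * p 1 * h1 +
      (p 0 ^ 2 + p 1 ^ 2 + 1) * hp
  rcases sq_eq_sq_iff_eq_or_eq_neg.1 hsq with h2 | h2
  · left
    have h3 : q 0 - p 0 = 0 ∧ q 1 - p 1 = 0 := by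
      constructor <;> nlinarith [sq_nonneg (q 0 - p 0), sq_nonneg (q 1 - p 1)]
    ext i
    fin_cases i
    exacts [sub_eq_zero.1 h3.1, sub_eq_zero.1 h3.2]
  · right
    have h3 : q 0 + p 0 = 0 ∧ q 1 + p 1 = 0 := by
      constructor <;> nlinarith [sq_nonneg (q 0 + p 0), sq_nonneg (q 1 + p 1)]
    ext i
    fin_cases i
    exacts [eq_neg_of_add_eq_zero_left h3.1, eq_neg_of_add_eq_zero_left h3.2]

lemma exists_two_to_one_circle :
    ∃ f : sphere (0 : EuclideanSpace ℝ (Fin 2)) 1 → sphere (0 : EuclideanSpace ℝ (Fin 2)) 1,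
      Continuous f ∧ Function.Surjective f ∧ ∀ y, Nat.card (f ⁻¹' {y}) = 2 := by
  set f : sphere (0 : EuclideanSpace ℝ (Fin 2)) 1 → sphere (0 : EuclideanSpace ℝ (Fin 2)) 1 :=
    fun p => ⟨double p, double_mem p.2⟩ with hf
  have hs : Function.Surjective f := fun q => by
    obtain ⟨p, hp, h⟩ := exists_double_eq q.2
    exact ⟨⟨p, hp⟩, Subtype.ext h⟩
  refine ⟨f, (continuous_double.comp continuous_subtype_val).subtype_mk _, hs, fun y => ?_⟩
  obtain ⟨p, rfl⟩ := hs y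
  have hset : f ⁻¹' {f p} = {p, -p} := by
    ext q
    rw [mem_preimage, mem_singleton_iff, mem_insert_iff, mem_singleton_iff]
    constructor
    · intro h
      exact (eq_or_eq_neg_of_double_eq p.2 q.2 (congrArg Subtype.val h)).imp
        (fun h => Subtype.ext h) fun h => Subtype.ext h
    · rintro (rfl | rfl)
      · rfl
      · refine Subtype.ext ?_
        show double (-p.1) = double p.1
        ext i
        fin_cases i <;> simp [double]
  have hne : p ≠ -p := ne_neg_of_mem_unit_sphere ℝ p
  rw [hset]
  exact ncard_pair hne

end Doubling

end CompactCohomology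

open CompactCohomology

/-- (Henderson) The circle `S¹` is the only sphere `Sⁿ` (`n ≥ 1`) admitting a
continuous exactly 2-to-1 map onto a sphere: if `Sⁿ` (`n ≥ 1`) maps onto some
sphere `Sᵐ` by a continuous exactly 2-to-1 map then `n = 1`, and such a map
does exist for `n = 1` (e.g. the doubling map of the circle). -/
theorem circle_only_sphere_with_two_to_one_map :
    (∀ n m : ℕ, 1 ≤ n →
      (∃ f : (Metric.sphere (0 : EuclideanSpace ℝ (Fin (n + 1))) 1) →
          (Metric.sphere (0 : EuclideanSpace ℝ (Fin (m + 1))) 1),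
        Continuous f ∧ Function.Surjective f ∧
          ∀ y, Nat.card (f ⁻¹' {y}) = 2) → n = 1) ∧
    ∃ m : ℕ, ∃ f : (Metric.sphere (0 : EuclideanSpace ℝ (Fin 2)) 1) →
        (Metric.sphere (0 : EuclideanSpace ℝ (Fin (m + 1))) 1),
      Continuous f ∧ Function.Surjective f ∧ ∀ y, Nat.card (f ⁻¹' {y}) = 2 := by
  refine ⟨fun n m hn ⟨f, hf, hs, h⟩ => ?_, 1, exists_two_to_one_circle⟩
  by_contra hne
  have : Fact (2 ≤ n) := ⟨by omega⟩
  obtain ⟨σ, ht⟩ := exists_isTwo hf hs h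
  obtain rfl := le_antisymm ht.le_dim ht.dim_le
  exact not_isTwo ht
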